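/- arXiv:2110.06008 — 2 statements merged into one kernel-verified Lean document; each statement's English description precedes it below -/
import Mathlib

section
/- Let n ≥ 2 be an even integer and set α = n/2. For (x,y) ∈ D₊ let A_{x,y} = inf_{w∈ℝ²} θ̂_{x,y}(w;α) and B_{x,y} = sup_{w∈ℝ²} θ̂_{x,y}(w;α). Then A_{x,y} > 0 and B_{x,y}/A_{x,y} ≥ B_{1/2,√3/2}/A_{1/2,√3/2}, with equality if and only if (x,y) = (1/2, √3/2). (Up to the factor n, A_{x,y} and B_{x,y} are the sharp frame bounds of the Gaussian Gabor frame over the lattice of density n with parameters (x,y); thus the ratio B/A of the optimal frame bounds is minimized precisely by the hexagonal lattice, as conjectured by Strohmer and Beaver.) -/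
/-- The charged (dual) lattice theta function `θ̂_{x,y}(z;α)`. -/
noncomputable def latticeThetaHat (x y : ℝ) (z : ℝ × ℝ) (α : ℝ) : ℝ :=
  ∑' p : ℤ × ℤ,
    Real.exp (-(Real.pi * α / y) *
      ((p.1 : ℝ) ^ 2 + 2 * x * (p.1 : ℝ) * (p.2 : ℝ) + (x ^ 2 + y ^ 2) * (p.2 : ℝ) ^ 2)) *
    Real.cos (2 * Real.pi * ((p.1 : ℝ) * z.2 - (p.2 : ℝ) * z.1))

/-- The right half of the fundamental domain of the modular group. -/
def Dplus : Set (ℝ × ℝ) :=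
  {p | 0 ≤ p.1 ∧ p.1 ≤ 1 / 2 ∧ 0 < p.2 ∧ 1 ≤ p.1 ^ 2 + p.2 ^ 2}

/-- Lower frame quantity `A_{x,y}`. -/
noncomputable def frameA (x y α : ℝ) : ℝ := ⨅ w : ℝ × ℝ, latticeThetaHat x y w α

/-- Upper frame quantity `B_{x,y}`. -/
noncomputable def frameB (x y α : ℝ) : ℝ := ⨆ w : ℝ × ℝ, latticeThetaHat x y w α

namespace LatticeTheta

open Real

/-! ### Summation over the integer lattice -/

lemma hasSum_pow_natAbs {r : ℝ} (h0 : 0 ≤ r) (h1 : r < 1) :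
    HasSum (fun k : ℤ => r ^ k.natAbs) ((1 + r) / (1 - r)) := by
  have h := hasSum_geometric_of_lt_one h0 h1
  have h2 : HasSum (fun n : ℕ => r ^ (-((n : ℤ) + 1)).natAbs) (r * (1 - r)⁻¹) := by
    have : (fun n : ℕ => r ^ (-((n : ℤ) + 1)).natAbs) = fun n : ℕ => r * r ^ n := by
      funext n
      rw [Int.natAbs_neg, show ((n : ℤ) + 1).natAbs = n + 1 from by omega, pow_succ, mul_comm]
    rw [this]
    exact h.mul_left r
  have h3 : HasSum (fun n : ℕ => r ^ ((n : ℤ)).natAbs) (1 - r)⁻¹ := by simpa using h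
  have := HasSum.of_nat_of_neg_add_one (f := fun k : ℤ => r ^ k.natAbs) h3 h2
  convert this using 1
  have : 1 - r ≠ 0 := by linarith
  field_simp

lemma hasSum_pow_natAbs_add {r : ℝ} (h0 : 0 ≤ r) (h1 : r < 1) :
    HasSum (fun v : ℤ × ℤ => r ^ (v.1.natAbs + v.2.natAbs)) (((1 + r) / (1 - r)) ^ 2) := by
  have h := hasSum_pow_natAbs h0 h1
  have hs : Summable fun v : ℤ × ℤ => r ^ v.1.natAbs * r ^ v.2.natAbs :=
    h.summable.mul_of_nonneg h.summable (fun _ => by positivity) (fun _ => by positivity)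
  have := h.mul h hs
  simpa only [pow_add, sq] using this

lemma summable_of_le_half_pow {g : ℤ × ℤ → ℝ} {C : ℝ} (h0 : ∀ v, 0 ≤ g v)
    (h : ∀ v, g v ≤ C * (1 / 2) ^ (v.1.natAbs + v.2.natAbs)) : Summable g :=
  Summable.of_nonneg_of_le h0 h
    ((hasSum_pow_natAbs_add (by norm_num) (by norm_num)).summable.mul_left C)

lemma tsum_le_of_le_half_pow {g : ℤ × ℤ → ℝ} {C : ℝ} (h0 : ∀ v, 0 ≤ g v)
    (h : ∀ v, g v ≤ C * (1 / 2) ^ (v.1.natAbs + v.2.natAbs)) : ∑' v, g v ≤ 9 * C := by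
  have hs := (hasSum_pow_natAbs_add (r := 1 / 2) (by norm_num) (by norm_num)).mul_left C
  have := (summable_of_le_half_pow h0 h).tsum_le_tsum h hs.summable
  rw [hs.tsum_eq] at this
  linarith

/-! ### Quadratic forms and their symmetries -/

/-- The quadratic form of unit determinant attached to the parameters `(x, y)`. -/
noncomputable def quadForm (x y : ℝ) (v : ℤ × ℤ) : ℝ :=
  ((v.1 : ℝ) ^ 2 + 2 * x * v.1 * v.2 + (x ^ 2 + y ^ 2) * (v.2 : ℝ) ^ 2) / y

/-- The norm form of the hexagonal lattice. -/
def hexNorm (v : ℤ × ℤ) : ℤ := v.1 ^ 2 + v.1 * v.2 + v.2 ^ 2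

/-- The Gaussian weight `exp (-β q(v))`. -/
noncomputable def gauss (x y β : ℝ) (v : ℤ × ℤ) : ℝ := exp (-(β * quadForm x y v))

lemma gauss_pos (x y β : ℝ) (v : ℤ × ℤ) : 0 < gauss x y β v := exp_pos _

lemma quadForm_lower {x y : ℝ} (hy : 0 < y) (v : ℤ × ℤ) :
    y / (1 + x ^ 2 + y ^ 2) * ((v.1 : ℝ) ^ 2 + (v.2 : ℝ) ^ 2) ≤ quadForm x y v := by
  have hT : 0 < 1 + x ^ 2 + y ^ 2 := by positivity
  unfold quadForm
  rw [div_mul_eq_mul_div, div_le_div_iff₀ hT hy]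
  nlinarith [sq_nonneg ((v.1 : ℝ) + x * v.2), sq_nonneg (x * (v.1 : ℝ) + (x ^ 2 + y ^ 2) * v.2)]

lemma summable_gauss {x y β : ℝ} (hy : 0 < y) (hβ : 0 < β) : Summable (gauss x y β) := by
  set c := β * (y / (1 + x ^ 2 + y ^ 2)) with hc
  have hcpos : 0 < c := by positivity
  have hs := (hasSum_pow_natAbs_add (r := exp (-c)) (exp_pos _).le
    (by rw [exp_lt_one_iff]; linarith)).summable
  refine Summable.of_nonneg_of_le (fun v => (gauss_pos x y β v).le) (fun v => ?_) hs
  unfold gauss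
  rw [← exp_nat_mul, exp_le_exp]
  have h1 : ∀ k : ℤ, (k.natAbs : ℝ) ≤ (k : ℝ) ^ 2 := by
    intro k
    have : (k.natAbs : ℤ) ≤ k ^ 2 := by
      rw [← Int.natAbs_sq]
      exact_mod_cast Nat.le_self_pow two_ne_zero _
    calc (k.natAbs : ℝ) = ((k.natAbs : ℤ) : ℝ) := (Int.cast_natCast _).symm
      _ ≤ ((k ^ 2 : ℤ) : ℝ) := Int.cast_le.mpr this
      _ = (k : ℝ) ^ 2 := by push_cast; ring
  have h2 := mul_le_mul_of_nonneg_left (quadForm_lower (x := x) hy v) hβ.le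
  have h3 : c * ((v.1.natAbs : ℝ) + v.2.natAbs) ≤ c * ((v.1 : ℝ) ^ 2 + (v.2 : ℝ) ^ 2) :=
    mul_le_mul_of_nonneg_left (add_le_add (h1 _) (h1 _)) hcpos.le
  push_cast
  rw [← mul_assoc, ← hc] at h2
  linarith

/-- The rotation of order three preserving `hexNorm`. -/
def rot : ℤ × ℤ ≃ ℤ × ℤ where
  toFun v := (-v.1 - v.2, v.1)
  invFun v := (v.2, -v.1 - v.2)
  left_inv v := by ext <;> simp
  right_inv v := by ext <;> simp; ring

@[simp] lemma rot_fst (v : ℤ × ℤ) : (rot v).1 = -v.1 - v.2 := rfl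

@[simp] lemma rot_snd (v : ℤ × ℤ) : (rot v).2 = v.1 := rfl

@[simp] lemma hexNorm_rot (v : ℤ × ℤ) : hexNorm (rot v) = hexNorm v := by
  simp only [hexNorm, rot_fst, rot_snd]; ring

/-- Membership in the sublattice of index three on which the barycentric character is trivial. -/
def InSub (v : ℤ × ℤ) : Prop := (3 : ℤ) ∣ v.1 - v.2

instance : DecidablePred InSub := fun v => inferInstanceAs (Decidable ((3 : ℤ) ∣ v.1 - v.2))

@[simp] lemma inSub_rot (v : ℤ × ℤ) : InSub (rot v) ↔ InSub v := by
  simp only [InSub, rot_fst, rot_snd]; omega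

lemma quadForm_rot_sum (x y : ℝ) (v : ℤ × ℤ) :
    quadForm x y v + quadForm x y (rot v) + quadForm x y (rot (rot v)) =
      2 * hexNorm v * ((1 - x + x ^ 2 + y ^ 2) / y) := by
  simp only [quadForm, hexNorm, rot_fst, rot_snd]
  push_cast
  ring

lemma hasSum_rot_sum {g : ℤ × ℤ → ℝ} {s : ℝ} (hg : HasSum g s) :
    HasSum (fun v => g v + g (rot v) + g (rot (rot v))) (3 * s) := by
  have h1 : HasSum (fun v => g (rot v)) s := (Equiv.hasSum_iff rot (f := g)).mpr hg
  have h2 : HasSum (fun v => g (rot (rot v))) s :=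
    (Equiv.hasSum_iff rot (f := fun v => g (rot v))).mpr h1
  have h3 := (hg.add h1).add h2
  rwa [show s + s + s = 3 * s from by ring] at h3

lemma four_hexNorm_ge (v : ℤ × ℤ) : ((v.1.natAbs : ℤ) + v.2.natAbs) ^ 2 ≤ 4 * hexNorm v := by
  unfold hexNorm
  have h1 : (v.1.natAbs : ℤ) = |v.1| := Int.natCast_natAbs _
  have h2 : (v.2.natAbs : ℤ) = |v.2| := Int.natCast_natAbs _
  rw [h1, h2]
  have h3 := sq_abs v.1
  have h4 := sq_abs v.2
  have h5 : -(|v.1| * |v.2|) ≤ v.1 * v.2 := by rw [← abs_mul]; exact neg_abs_le _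
  nlinarith [sq_nonneg (|v.1| - |v.2|)]

lemma hexNorm_nonneg (v : ℤ × ℤ) : 0 ≤ hexNorm v := by
  nlinarith [four_hexNorm_ge v, sq_nonneg ((v.1.natAbs : ℤ) + v.2.natAbs)]

lemma natAbs_add_le_hexNorm {v : ℤ × ℤ} (h : 3 ≤ hexNorm v) :
    (v.1.natAbs : ℤ) + v.2.natAbs ≤ hexNorm v := by
  by_contra! hlt
  nlinarith [four_hexNorm_ge v]

lemma natAbs_add_le_two_thirds_hexNorm {v : ℤ × ℤ} (h : 9 ≤ hexNorm v) :
    3 * ((v.1.natAbs : ℤ) + v.2.natAbs) ≤ 2 * hexNorm v := by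
  by_contra! hlt
  nlinarith [four_hexNorm_ge v]

/-! ### Positivity of the charged theta function -/

/-- The phase of the character attached to `z`. -/
noncomputable def phase (z : ℝ × ℝ) (v : ℤ × ℤ) : ℝ := 2 * π * (v.1 * z.2 - v.2 * z.1)

lemma latticeThetaHat_eq (x y : ℝ) (z : ℝ × ℝ) (α : ℝ) :
    latticeThetaHat x y z α = ∑' v, gauss x y (π * α) v * cos (phase z v) := by
  unfold latticeThetaHat gauss quadForm phase
  refine tsum_congr fun v => ?_
  congr 2
  ring

lemma summable_gauss_mul_cos {x y β : ℝ} (hy : 0 < y) (hβ : 0 < β) (t : ℤ × ℤ → ℝ) :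
    Summable fun v => gauss x y β v * cos (t v) := by
  refine Summable.of_norm_bounded (summable_gauss (x := x) hy hβ) fun v => ?_
  rw [norm_mul, norm_eq_abs, norm_eq_abs, abs_of_pos (gauss_pos _ _ _ _)]
  exact mul_le_of_le_one_right (gauss_pos _ _ _ _).le (abs_cos_le_one _)

lemma latticeThetaHat_zero (x y α : ℝ) :
    latticeThetaHat x y 0 α = ∑' v, gauss x y (π * α) v := by
  rw [latticeThetaHat_eq]
  refine tsum_congr fun v => ?_
  simp [phase]

lemma latticeThetaHat_le {x y α : ℝ} (hy : 0 < y) (hα : 0 < α) (z : ℝ × ℝ) :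
    latticeThetaHat x y z α ≤ ∑' v, gauss x y (π * α) v := by
  rw [latticeThetaHat_eq]
  have hβ : 0 < π * α := by positivity
  refine (summable_gauss_mul_cos hy hβ _).tsum_le_tsum (fun v => ?_) (summable_gauss hy hβ)
  exact mul_le_of_le_one_right (gauss_pos _ _ _ _).le (cos_le_one _)

lemma summable_int_gaussian_shift {c : ℝ} (hc : 0 < c) (t : ℝ) :
    Summable fun n : ℤ => exp (-c * (n - t) ^ 2) := by
  have h0 := (hasSum_pow_natAbs (r := exp (-c)) (exp_pos _).le
    (by rw [exp_lt_one_iff]; linarith)).summable.mul_left (exp (c * (|t| + 1) ^ 2))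
  refine Summable.of_nonneg_of_le (fun n => (exp_pos _).le) (fun n => ?_) h0
  rw [← exp_nat_mul, ← exp_add, exp_le_exp]
  have h1 : (n.natAbs : ℝ) = |(n : ℝ)| := by rw [Nat.cast_natAbs, Int.cast_abs]
  rw [h1]
  have h2 : |(n : ℝ)| ≤ (n - t) ^ 2 + (|t| + 1) ^ 2 := by
    have := abs_sub_abs_le_abs_sub (n : ℝ) t
    rw [← sq_abs ((n : ℝ) - t)]
    nlinarith [abs_nonneg t, abs_nonneg ((n : ℝ) - t), sq_nonneg (|(n : ℝ) - t| - 1 / 2)]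
  nlinarith

lemma one_sub_le_tsum_cos {r : ℝ} (h0 : 0 ≤ r) (h1 : r < 1) (g c : ℤ → ℝ)
    (hg : ∀ l, 0 ≤ g l ∧ g l ≤ r ^ l.natAbs) (hg0 : g 0 = 1) (hc0 : c 0 = 0) :
    2 - (1 + r) / (1 - r) ≤ ∑' l, g l * cos (c l) := by
  have hs := hasSum_pow_natAbs h0 h1
  have hgs : Summable fun l => g l * cos (c l) := by
    refine Summable.of_norm_bounded hs.summable fun l => ?_
    rw [norm_mul, norm_eq_abs, norm_eq_abs, abs_of_nonneg (hg l).1]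
    exact (mul_le_of_le_one_right (hg l).1 (abs_cos_le_one _)).trans (hg l).2
  have h2 : HasSum (fun l : ℤ => if l = 0 then (2 : ℝ) else 0) 2 := hasSum_ite_eq 0 2
  have h3 := h2.sub hs
  rw [← h3.tsum_eq]
  refine h3.summable.tsum_le_tsum (fun l => ?_) hgs
  split_ifs with hl
  · subst hl; rw [hg0, hc0]; norm_num
  · have := (hg l)
    nlinarith [neg_one_le_cos (c l)]

lemma latticeThetaHat_dual {x y α : ℝ} (hy : 0 < y) (hα : 0 < α) (z : ℝ × ℝ) :
    latticeThetaHat x y z α = (α / y) ^ (-(1 / 2) : ℝ) *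
      ∑' n : ℤ, exp (-(π / (α / y)) * (n - z.2) ^ 2) *
      ∑' l : ℤ, exp (-(π * α * y) * l ^ 2) * cos (2 * π * l * (x * (n - z.2) - z.1)) := by
  set a := α / y with ha
  have hapos : 0 < a := by positivity
  have hay : α * y = a * y ^ 2 := by rw [ha]; field_simp
  let F : ℤ × ℤ → ℂ := fun v => Complex.exp (-(π * α) * quadForm x y v + Complex.I * phase z v)
  let G : ℤ × ℤ → ℂ := fun p => Complex.exp (-(π / a) * (p.1 - z.2) ^ 2 + -(π * α * y) * p.2 ^ 2
    + Complex.I * (2 * π * p.2 * (x * (p.1 - z.2) - z.1)))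
  have hFre : ∀ v, (F v).re = gauss x y (π * α) v * cos (phase z v) := by
    intro v
    have : F v = Complex.exp ((-(π * α * quadForm x y v) : ℝ) + (phase z v : ℝ) * Complex.I) := by
      simp only [F]; congr 1; push_cast; ring
    rw [this, Complex.exp_add, ← Complex.ofReal_exp, Complex.re_ofReal_mul,
      Complex.exp_ofReal_mul_I_re]
    rfl
  have hGeq : ∀ p, G p = ((exp (-(π / a) * (p.1 - z.2) ^ 2) * exp (-(π * α * y) * p.2 ^ 2) : ℝ) : ℂ)
      * Complex.exp ((2 * π * p.2 * (x * (p.1 - z.2) - z.1) : ℝ) * Complex.I) := by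
    intro p
    rw [← exp_add, Complex.ofReal_exp, ← Complex.exp_add]
    simp only [G]; congr 1; push_cast; ring
  have hFs : Summable F := by
    refine Summable.of_norm_bounded (summable_gauss (x := x) hy (by positivity : 0 < π * α))
      fun v => le_of_eq ?_
    simp only [F]
    rw [Complex.norm_exp]
    unfold gauss
    congr 1
    simp
  have hsr : Summable fun l : ℤ => exp (-(π * α * y) * (l : ℝ) ^ 2) := by
    simpa using summable_int_gaussian_shift (c := π * α * y) (by positivity) 0
  have hsg := summable_int_gaussian_shift (c := π / a) (by positivity) z.2
  have hGs : Summable G := by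
    refine Summable.of_norm_bounded (hsg.mul_of_nonneg hsr (fun _ => (exp_pos _).le)
      (fun _ => (exp_pos _).le)) fun p => ?_
    rw [hGeq, norm_mul, Complex.norm_exp_ofReal_mul_I, mul_one, Complex.norm_real, norm_eq_abs,
      abs_of_pos (by positivity)]
  have hpoisson : ∀ l : ℤ, ∑' k : ℤ, F (k, l) = 1 / (a : ℂ) ^ (1 / 2 : ℂ) * ∑' n : ℤ, G (n, l) := by
    intro l
    have h := Complex.tsum_exp_neg_quadratic (a := a) (by simpa using hapos)
      (-a * x * l + Complex.I * z.2)
    have hy' : (y : ℂ) ≠ 0 := by exact_mod_cast hy.ne'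
    have ha' : (a : ℂ) ≠ 0 := by exact_mod_cast hapos.ne'
    have hα' : (α : ℂ) = a * y := by rw [ha]; push_cast; field_simp
    have e1 : ∀ k : ℤ, F (k, l) =
        Complex.exp (-(π * a * (x ^ 2 + y ^ 2)) * l ^ 2 - 2 * π * Complex.I * (l * z.1)) *
        Complex.exp (-π * a * k ^ 2 + 2 * π * (-a * x * l + Complex.I * z.2) * k) := by
      intro k
      rw [← Complex.exp_add]
      simp only [F, quadForm, phase, hα']
      congr 1
      push_cast
      field_simp
      ring
    have e2 : ∀ n : ℤ, G (n, l) =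
        Complex.exp (-(π * a * (x ^ 2 + y ^ 2)) * l ^ 2 - 2 * π * Complex.I * (l * z.1)) *
        Complex.exp (-π / a * (n + Complex.I * (-a * x * l + Complex.I * z.2)) ^ 2) := by
      intro n
      rw [← Complex.exp_add]
      simp only [G, hα']
      congr 1
      have hI : Complex.I ^ 2 = -1 := Complex.I_sq
      have hI4 : Complex.I ^ 4 = 1 := Complex.I_pow_four
      have hI3 : Complex.I ^ 3 = -Complex.I := Complex.I_pow_three
      field_simp
      ring_nf
      simp only [hI, hI3, hI4]
      ring
    simp_rw [e1, e2, tsum_mul_left]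
    rw [h]
    ring
  have hFG : ∑' v, F v = 1 / (a : ℂ) ^ (1 / 2 : ℂ) * ∑' p, G p := by
    have hF' : Summable fun p : ℤ × ℤ => F p.swap :=
      (Equiv.summable_iff (Equiv.prodComm ℤ ℤ)).mpr hFs
    have hG' : Summable fun p : ℤ × ℤ => G p.swap :=
      (Equiv.summable_iff (Equiv.prodComm ℤ ℤ)).mpr hGs
    have a1 : ∑' p : ℤ × ℤ, F p.swap = ∑' v, F v := Equiv.tsum_eq (Equiv.prodComm ℤ ℤ) F
    have a2 : ∑' p : ℤ × ℤ, G p.swap = ∑' v, G v := Equiv.tsum_eq (Equiv.prodComm ℤ ℤ) G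
    rw [← a1, ← a2, hF'.tsum_prod, hG'.tsum_prod, ← tsum_mul_left]
    exact tsum_congr hpoisson
  have hconst : 1 / (a : ℂ) ^ (1 / 2 : ℂ) = ((a ^ (-(1 / 2) : ℝ) : ℝ) : ℂ) := by
    rw [Complex.ofReal_cpow hapos.le, one_div, ← Complex.cpow_neg]
    push_cast
    rfl
  have hGre : ∀ p, (G p).re = exp (-(π / a) * (p.1 - z.2) ^ 2) *
      (exp (-(π * α * y) * p.2 ^ 2) * cos (2 * π * p.2 * (x * (p.1 - z.2) - z.1))) := by
    intro p
    rw [hGeq, Complex.re_ofReal_mul, Complex.exp_ofReal_mul_I_re]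
    ring
  have hGrs : Summable fun p => (G p).re := (Complex.hasSum_re hGs.hasSum).summable
  rw [latticeThetaHat_eq]
  calc ∑' v, gauss x y (π * α) v * cos (phase z v) = (∑' v, F v).re := by
        rw [Complex.re_tsum hFs]; exact tsum_congr fun v => (hFre v).symm
    _ = a ^ (-(1 / 2) : ℝ) * ∑' p, (G p).re := by
        rw [hFG, hconst, Complex.re_ofReal_mul, Complex.re_tsum hGs]
    _ = _ := by
        rw [hGrs.tsum_prod]
        congr 1
        refine tsum_congr fun n => ?_
        rw [← tsum_mul_left]
        exact tsum_congr fun l => hGre (n, l)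

lemma exists_pos_le_latticeThetaHat {x y α : ℝ} (hy : 0 < y) (hα : 0 < α)
    (hr : exp (-(π * α * y)) < 1 / 3) :
    ∃ c, 0 < c ∧ ∀ z, c ≤ latticeThetaHat x y z α := by
  set r := exp (-(π * α * y)) with hrdef
  have hr0 : 0 < r := exp_pos _
  set δ := 2 - (1 + r) / (1 - r) with hδ
  have hδpos : 0 < δ := by
    have : (1 + r) / (1 - r) < 2 := by rw [div_lt_iff₀] <;> linarith
    linarith
  have ha : 0 < α / y := by positivity
  refine ⟨(α / y) ^ (-(1 / 2) : ℝ) * (exp (-(π / (α / y)) * (1 / 4)) * δ),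
    by positivity, fun z => ?_⟩
  rw [latticeThetaHat_dual hy hα]
  refine mul_le_mul_of_nonneg_left ?_ (by positivity)
  set I : ℤ → ℝ := fun n =>
    ∑' l : ℤ, exp (-(π * α * y) * l ^ 2) * cos (2 * π * l * (x * (n - z.2) - z.1)) with hI
  have hg : ∀ l : ℤ, 0 ≤ exp (-(π * α * y) * (l : ℝ) ^ 2) ∧
      exp (-(π * α * y) * (l : ℝ) ^ 2) ≤ r ^ l.natAbs := by
    intro l
    refine ⟨(exp_pos _).le, ?_⟩
    rw [hrdef, ← exp_nat_mul, exp_le_exp]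
    have h1 : (l.natAbs : ℝ) ≤ (l : ℝ) ^ 2 := by
      have h2 : (l.natAbs : ℝ) ≤ (l.natAbs : ℝ) ^ 2 := by
        exact_mod_cast Nat.le_self_pow two_ne_zero _
      rwa [Nat.cast_natAbs, Int.cast_abs, sq_abs, ← Int.cast_abs, ← Nat.cast_natAbs] at h2
    have : 0 < π * α * y := by positivity
    nlinarith
  have hIδ : ∀ n, δ ≤ I n := fun n =>
    one_sub_le_tsum_cos hr0.le (by linarith) _ _ hg (by simp) (by simp)
  have hrs := hasSum_pow_natAbs hr0.le (by linarith : r < 1)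
  have hIle : ∀ n, ‖I n‖ ≤ (1 + r) / (1 - r) := fun n => by
    refine tsum_of_norm_bounded hrs fun l => ?_
    rw [norm_mul, norm_eq_abs, norm_eq_abs, abs_of_nonneg (hg l).1]
    exact (mul_le_of_le_one_right (hg l).1 (abs_cos_le_one _)).trans (hg l).2
  have hsg := summable_int_gaussian_shift (c := π / (α / y)) (by positivity) z.2
  have hs : Summable fun n : ℤ => exp (-(π / (α / y)) * (n - z.2) ^ 2) * I n := by
    refine Summable.of_norm_bounded (hsg.mul_right ((1 + r) / (1 - r))) fun n => ?_
    rw [norm_mul, norm_eq_abs, abs_of_pos (exp_pos _)]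
    exact mul_le_mul_of_nonneg_left (hIle n) (exp_pos _).le
  refine le_trans ?_ (hs.le_tsum (round z.2) fun n _ =>
    mul_nonneg (exp_pos _).le (hδpos.le.trans (hIδ n)))
  refine mul_le_mul (exp_le_exp.mpr ?_) (hIδ _) hδpos.le (exp_pos _).le
  have h1 := abs_sub_round z.2
  have h2 : ((round z.2 : ℝ) - z.2) ^ 2 ≤ 1 / 4 := by
    rw [← sq_abs, abs_sub_comm]
    nlinarith [abs_nonneg (z.2 - round z.2)]
  have : 0 < π / (α / y) := by positivity
  nlinarith

/-! ### The hexagonal lattice -/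

/-- The order of the hexagonal norm form as a natural number. -/
def hexNat (v : ℤ × ℤ) : ℕ := (hexNorm v).toNat

lemma hexNat_cast (v : ℤ × ℤ) : ((hexNat v : ℕ) : ℤ) = hexNorm v :=
  Int.toNat_of_nonneg (hexNorm_nonneg v)

lemma hexNat_cast_real (v : ℤ × ℤ) : (hexNat v : ℝ) = (hexNorm v : ℝ) := by
  rw [← hexNat_cast]; norm_cast

@[simp] lemma hexNat_rot (v : ℤ × ℤ) : hexNat (rot v) = hexNat v := by simp [hexNat]

/-- The nome of the hexagonal lattice. -/
noncomputable def hexNome (β : ℝ) : ℝ := exp (-(2 * β / √3))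

lemma hexNome_pos (β : ℝ) : 0 < hexNome β := exp_pos _

lemma exp_362_ge : 37 ≤ exp (3.62 : ℝ) := by
  have h1 : 1 + 0.905 + 0.905 ^ 2 / 2 + 0.905 ^ 3 / 6 + 0.905 ^ 4 / 24 + 0.905 ^ 5 / 120 ≤
      exp (0.905 : ℝ) := by
    have := sum_le_exp_of_nonneg (x := 0.905) (by norm_num) 6
    norm_num [Finset.sum_range_succ, Nat.factorial] at this ⊢
    linarith
  have h2 : exp (3.62 : ℝ) = exp 0.905 ^ 4 := by rw [← exp_nat_mul]; norm_num
  have h3 : (2.467 : ℝ) ≤ exp 0.905 := by norm_num at h1 ⊢; linarith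
  rw [h2]
  calc (37 : ℝ) ≤ 2.467 ^ 4 := by norm_num
    _ ≤ _ := by gcongr

lemma sqrt_three_bounds : 1.73205 < √3 ∧ √3 < 1.73206 := by
  constructor
  · rw [lt_sqrt] <;> norm_num
  · rw [sqrt_lt] <;> norm_num

lemma hexNome_le {β : ℝ} (hβ : π ≤ β) : hexNome β ≤ 1 / 37 := by
  have h1 : 3.62 ≤ 2 * β / √3 := by
    rw [le_div_iff₀ (by positivity)]
    have := sqrt_three_bounds.2
    have := pi_gt_d4
    linarith
  unfold hexNome
  rw [exp_neg, one_div]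
  exact inv_anti₀ (by norm_num) (exp_362_ge.trans (exp_le_exp.mpr h1))

lemma quadForm_hex (v : ℤ × ℤ) : quadForm (1 / 2) (√3 / 2) v = 2 / √3 * hexNorm v := by
  unfold quadForm hexNorm
  have h3 : √3 ^ 2 = 3 := sq_sqrt (by norm_num)
  have : √3 ≠ 0 := by positivity
  field_simp
  push_cast
  rw [h3]
  ring

lemma gauss_hex (β : ℝ) (v : ℤ × ℤ) : gauss (1 / 2) (√3 / 2) β v = hexNome β ^ hexNat v := by
  unfold gauss hexNome
  rw [← exp_nat_mul, quadForm_hex, hexNat_cast_real]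
  congr 1
  ring

/-- The part of the theta series off the sublattice. -/
noncomputable def offSum (x y β : ℝ) : ℝ := ∑' v, if InSub v then 0 else gauss x y β v

/-- The part of the theta series on the sublattice. -/
noncomputable def subSum (x y β : ℝ) : ℝ := ∑' v, if InSub v then gauss x y β v else 0

lemma summable_ite_of_summable {g : ℤ × ℤ → ℝ} (hg : Summable g) (p : ℤ × ℤ → Prop)
    [DecidablePred p] :
    Summable fun v => if p v then g v else 0 :=
  (hg.indicator {v | p v}).congr fun v => by simp [Set.indicator]

lemma summable_ite_not_of_summable {g : ℤ × ℤ → ℝ} (hg : Summable g) (p : ℤ × ℤ → Prop)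
    [DecidablePred p] : Summable fun v => if p v then 0 else g v :=
  (hg.indicator {v | ¬ p v}).congr fun v => by by_cases h : p v <;> simp [h]

lemma tsum_eq_ite_add_ite {g : ℤ × ℤ → ℝ} (hg : Summable g) (p : ℤ × ℤ → Prop) [DecidablePred p] :
    (∑' v, if p v then g v else 0) + (∑' v, if p v then 0 else g v) = ∑' v, g v := by
  rw [← (summable_ite_of_summable hg p).tsum_add (summable_ite_not_of_summable hg p)]
  exact tsum_congr fun v => by split_ifs <;> simp

lemma tsum_ite_mem (g : ℤ × ℤ → ℝ) (s : Finset (ℤ × ℤ)) :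
    (∑' v, if v ∈ s then g v else 0) = ∑ v ∈ s, g v := by
  rw [tsum_eq_sum (s := s) fun v hv => if_neg hv]
  exact Finset.sum_congr rfl fun v hv => if_pos hv

lemma subSum_add_offSum {x y β : ℝ} (hy : 0 < y) (hβ : 0 < β) :
    subSum x y β + offSum x y β = ∑' v, gauss x y β v :=
  tsum_eq_ite_add_ite (summable_gauss hy hβ) InSub

lemma cos_phase_barycenter (v : ℤ × ℤ) :
    cos (phase (1 / 3, 1 / 3) v) = if InSub v then 1 else -(1 / 2) := by
  have hc : cos (2 * π / 3) = -(1 / 2) := by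
    rw [show 2 * π / 3 = π - π / 3 from by ring, cos_pi_sub, cos_pi_div_three]
  have hp : phase (1 / 3, 1 / 3) v = 2 * π / 3 * ((v.1 - v.2 : ℤ) : ℝ) := by
    unfold phase; push_cast; ring
  rw [hp]
  by_cases hv : InSub v
  · rw [if_pos hv]
    obtain ⟨j, hj⟩ := hv
    have : 2 * π / 3 * ((v.1 - v.2 : ℤ) : ℝ) = j * (2 * π) := by rw [hj]; push_cast; ring
    rw [this, cos_int_mul_two_pi]
  · rw [if_neg hv]
    unfold InSub at hv
    obtain ⟨j, hj | hj⟩ : ∃ j, v.1 - v.2 = 3 * j + 1 ∨ v.1 - v.2 = 3 * j - 1 :=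
      ⟨(v.1 - v.2 + 1) / 3, by omega⟩
    · have : 2 * π / 3 * ((v.1 - v.2 : ℤ) : ℝ) = 2 * π / 3 + j * (2 * π) := by
        rw [hj]; push_cast; ring
      rw [this, cos_add_int_mul_two_pi, hc]
    · have : 2 * π / 3 * ((v.1 - v.2 : ℤ) : ℝ) = -(2 * π / 3) + j * (2 * π) := by
        rw [hj]; push_cast; ring
      rw [this, cos_add_int_mul_two_pi, cos_neg, hc]

lemma latticeThetaHat_barycenter {x y α : ℝ} (hy : 0 < y) (hα : 0 < α) :
    latticeThetaHat x y (1 / 3, 1 / 3) α = subSum x y (π * α) - 1 / 2 * offSum x y (π * α) := by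
  have hs := summable_gauss (x := x) hy (by positivity : 0 < π * α)
  unfold subSum offSum
  rw [latticeThetaHat_eq, ← tsum_mul_left, ← (summable_ite_of_summable hs InSub).tsum_sub
    ((summable_ite_not_of_summable hs InSub).mul_left _)]
  refine tsum_congr fun v => ?_
  rw [cos_phase_barycenter]
  split_ifs <;> ring

/-! ### Trigonometric inequalities -/

lemma cos_add_cos_add_cos_eq (a b : ℝ) : cos a + cos b + cos (a + b) =
    2 * cos ((a + b) / 2) * cos ((a - b) / 2) + 2 * cos ((a + b) / 2) ^ 2 - 1 := by
  rw [cos_add_cos, show a + b = 2 * ((a + b) / 2) from by ring, cos_two_mul]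
  ring_nf

lemma neg_three_halves_le_cos_sum (a b : ℝ) : -(3 / 2) ≤ cos a + cos b + cos (a + b) := by
  rw [cos_add_cos_add_cos_eq]
  nlinarith [sq_nonneg (2 * cos ((a + b) / 2) + cos ((a - b) / 2)), cos_sq_le_one ((a - b) / 2)]

lemma quartic_nonneg {P Q : ℝ} (hP : |P| ≤ 1) (hQ : |Q| ≤ 1) :
    0 ≤ 16 * P ^ 2 + 10 * (P * Q) + 2 * Q ^ 2 + 8 * P ^ 3 * Q := by
  have h1 : -(|P| * |Q|) ≤ P * Q := by rw [← abs_mul]; exact neg_abs_le _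
  rw [show 8 * P ^ 3 * Q = 8 * |P| ^ 2 * (P * Q) from by rw [sq_abs]; ring, ← sq_abs P, ← sq_abs Q]
  generalize P * Q = m at *
  have hT := abs_nonneg P
  have hR := abs_nonneg Q
  generalize |P| = T at *
  generalize |Q| = R at *
  suffices h : 0 ≤ R ^ 2 - (5 * T + 4 * T ^ 3) * R + 8 * T ^ 2 by
    nlinarith [mul_nonneg (sq_nonneg T) (by linarith : 0 ≤ m + T * R)]
  rcases le_or_gt T (2 / 5) with h | h
  · have h2 : (5 + 4 * T ^ 2) ^ 2 ≤ 32 := by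
      have : T ^ 2 ≤ 4 / 25 := by nlinarith
      nlinarith [sq_nonneg T]
    have h3 : T ^ 2 * (5 + 4 * T ^ 2) ^ 2 ≤ T ^ 2 * 32 := mul_le_mul_of_nonneg_left h2 (sq_nonneg T)
    nlinarith [sq_nonneg (2 * R - (5 * T + 4 * T ^ 3))]
  · have h2 : 0 ≤ (1 - R) * (5 * T + 4 * T ^ 3 - 1 - R) := by
      apply mul_nonneg (by linarith)
      have : 0 ≤ T ^ 3 := by positivity
      linarith
    have h3 : 0 ≤ (1 - T) * (1 - 2 * T) ^ 2 := mul_nonneg (by linarith) (sq_nonneg _)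
    nlinarith

lemma three_sub_cos_sum_le (a b : ℝ) :
    3 - (cos (a - b) + cos (a + 2 * b) + cos (2 * a + b)) ≤
      8 * (cos a + cos b + cos (a + b) + 3 / 2) := by
  rw [cos_add_cos_add_cos_eq]
  have h1 : cos (a - b) = 2 * cos ((a - b) / 2) ^ 2 - 1 := by
    rw [← cos_two_mul]; congr 1; ring
  have h2 : cos (a + 2 * b) + cos (2 * a + b) =
      2 * (4 * cos ((a + b) / 2) ^ 3 - 3 * cos ((a + b) / 2)) * cos ((a - b) / 2) := by
    rw [← cos_three_mul, cos_add_cos, ← cos_neg ((a - b) / 2)]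
    ring_nf
  have := quartic_nonneg (abs_cos_le_one ((a + b) / 2)) (abs_cos_le_one ((a - b) / 2))
  nlinarith

lemma abs_sin_nat_mul_le (n : ℕ) (t : ℝ) : |sin (n * t)| ≤ n * |sin t| := by
  induction n with
  | zero => simp
  | succ k ih =>
    push_cast
    rw [add_mul, one_mul, sin_add]
    refine (abs_add_le _ _).trans ?_
    rw [abs_mul, abs_mul]
    nlinarith [abs_cos_le_one t, abs_cos_le_one (k * t), abs_nonneg (sin t),
      abs_nonneg (sin (k * t))]

lemma one_sub_cos_eq (t : ℝ) : 1 - cos t = 2 * sin (t / 2) ^ 2 := by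
  have := cos_sq' (t / 2)
  have h2 := cos_two_mul (t / 2)
  rw [show 2 * (t / 2) = t from by ring] at h2
  linarith

lemma one_sub_cos_int_mul_le (n : ℤ) (t : ℝ) : 1 - cos (n * t) ≤ (n : ℝ) ^ 2 * (1 - cos t) := by
  have key : ∀ k : ℕ, 1 - cos (k * t) ≤ (k : ℝ) ^ 2 * (1 - cos t) := by
    intro k
    have h := abs_sin_nat_mul_le k (t / 2)
    rw [one_sub_cos_eq, one_sub_cos_eq, ← sq_abs (sin _), ← sq_abs (sin (t / 2)), mul_div_assoc]
    nlinarith [abs_nonneg (sin (k * (t / 2)))]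
  obtain ⟨k, rfl | rfl⟩ := n.eq_nat_or_neg
  · simpa using key k
  · simpa using key k

lemma one_sub_cos_add_le (s t : ℝ) : 1 - cos (s + t) ≤ 2 * (1 - cos s) + 2 * (1 - cos t) := by
  rw [one_sub_cos_eq, one_sub_cos_eq, one_sub_cos_eq, add_div, sin_add]
  have h1 := sin_sq_add_cos_sq (s / 2)
  have h2 := sin_sq_add_cos_sq (t / 2)
  have h3 : sin (s / 2) ^ 2 * cos (t / 2) ^ 2 ≤ sin (s / 2) ^ 2 :=
    mul_le_of_le_one_right (sq_nonneg _) (cos_sq_le_one _)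
  have h4 : cos (s / 2) ^ 2 * sin (t / 2) ^ 2 ≤ sin (t / 2) ^ 2 :=
    mul_le_of_le_one_left (sq_nonneg _) (cos_sq_le_one _)
  nlinarith [sq_nonneg (sin (s / 2) * cos (t / 2) - cos (s / 2) * sin (t / 2))]

lemma one_sub_cos_comb_le (p q : ℤ) (s t : ℝ) : 1 - cos (p * s + q * t) ≤
    2 * (p : ℝ) ^ 2 * (1 - cos s) + 2 * (q : ℝ) ^ 2 * (1 - cos t) := by
  have := one_sub_cos_add_le (p * s) (q * t)
  have := one_sub_cos_int_mul_le p s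
  have := one_sub_cos_int_mul_le q t
  nlinarith

/-! ### The deep hole of the hexagonal lattice -/

/-- The excess of the three shortest characters over their common minimum. -/
noncomputable def excess (z : ℝ × ℝ) : ℝ :=
  cos (2 * π * z.2) + cos (2 * π * z.1) + cos (2 * π * z.2 + 2 * π * z.1) + 3 / 2

lemma excess_nonneg (z : ℝ × ℝ) : 0 ≤ excess z := by
  have := neg_three_halves_le_cos_sum (2 * π * z.2) (2 * π * z.1)
  unfold excess; linarith

/-- The sum of a character over an orbit of the rotation. -/
noncomputable def orbitCos (z : ℝ × ℝ) (v : ℤ × ℤ) : ℝ :=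
  cos (phase z v) + cos (phase z (rot v)) + cos (phase z (rot (rot v)))

lemma orbitCos_ge (z : ℝ × ℝ) (v : ℤ × ℤ) : -(3 / 2) ≤ orbitCos z v := by
  have := neg_three_halves_le_cos_sum (phase z v) (phase z (rot v))
  have h : phase z (rot (rot v)) = -(phase z v + phase z (rot v)) := by
    simp only [phase, rot_fst, rot_snd]; push_cast; ring
  rw [orbitCos, h, cos_neg]
  exact this

lemma three_sub_orbitCos_le (z : ℝ × ℝ) {v : ℤ × ℤ} (hv : InSub v) :
    3 - orbitCos z v ≤ 32 / 3 * hexNat v * excess z := by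
  obtain ⟨j, hj⟩ := hv
  have hk : v.1 = v.2 + 3 * j := by linarith
  rw [hexNat_cast_real]
  set a := 2 * π * z.2 with ha
  set b := 2 * π * z.1 with hb
  have e0 : phase z v = (v.2 + j : ℤ) * (a - b) + (j : ℤ) * (2 * a + b) := by
    simp only [phase, ha, hb, hk]; push_cast; ring
  have e1 : phase z (rot v) = (-(v.2 + j) : ℤ) * (2 * a + b) + (j : ℤ) * -(a + 2 * b) := by
    simp only [phase, ha, hb, hk, rot_fst, rot_snd]; push_cast; ring
  have e2 : phase z (rot (rot v)) = (v.2 + j : ℤ) * (a + 2 * b) + (-j : ℤ) * (a - b) := by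
    simp only [phase, ha, hb, hk, rot_fst, rot_snd]; push_cast; ring
  have h0 := one_sub_cos_comb_le (v.2 + j) j (a - b) (2 * a + b)
  have h1 := one_sub_cos_comb_le (-(v.2 + j)) j (2 * a + b) (-(a + 2 * b))
  have h2 := one_sub_cos_comb_le (v.2 + j) (-j) (a + 2 * b) (a - b)
  rw [← e0] at h0
  rw [← e1, cos_neg] at h1
  rw [← e2] at h2
  have h3 := three_sub_cos_sum_le a b
  have h4 : excess z = cos a + cos b + cos (a + b) + 3 / 2 := rfl
  have hS := excess_nonneg z
  rw [← h4] at h3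
  push_cast at h0 h1 h2
  have h5 : (hexNorm v : ℝ) = 3 * (v.2 : ℝ) ^ 2 + 9 * j * v.2 + 9 * (j : ℝ) ^ 2 := by
    unfold hexNorm; rw [hk]; push_cast; ring
  have h6 : 3 - orbitCos z v ≤ 2 * (((v.2 : ℝ) + j) ^ 2 + (j : ℝ) ^ 2) *
      (3 - (cos (a - b) + cos (a + 2 * b) + cos (2 * a + b))) := by
    unfold orbitCos; nlinarith
  have h7 : 2 * (((v.2 : ℝ) + j) ^ 2 + (j : ℝ) ^ 2) *
      (3 - (cos (a - b) + cos (a + 2 * b) + cos (2 * a + b))) ≤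
      2 * (((v.2 : ℝ) + j) ^ 2 + (j : ℝ) ^ 2) * (8 * excess z) :=
    mul_le_mul_of_nonneg_left h3 (by positivity)
  have h8 : (((v.2 : ℝ) + j) ^ 2 + (j : ℝ) ^ 2) * excess z ≤ 2 / 3 * hexNorm v * excess z := by
    refine mul_le_mul_of_nonneg_right ?_ hS
    rw [h5]; nlinarith [sq_nonneg ((v.2 : ℝ) + 2 * j)]
  linarith

/-- The six shortest nonzero vectors of the hexagonal lattice. -/
def shortVectors : Finset (ℤ × ℤ) := {(1, 0), (-1, 1), (0, -1), (-1, 0), (1, -1), (0, 1)}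

lemma shortVectors_props {v : ℤ × ℤ} (hv : v ∈ shortVectors) : hexNat v = 1 ∧ ¬ InSub v := by
  revert v; decide

lemma orbitCos_shortVectors (z : ℝ × ℝ) {v : ℤ × ℤ} (hv : v ∈ shortVectors) :
    orbitCos z v = excess z - 3 / 2 := by
  have hc : ∀ a b c : ℝ, b = -a → c = a → cos b = cos c := by rintro a b c rfl rfl; exact cos_neg _
  simp only [shortVectors, Finset.mem_insert, Finset.mem_singleton] at hv
  have e1 : cos (-(2 * π * z.2) - 2 * π * z.1) = cos (2 * π * z.2 + 2 * π * z.1) := by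
    rw [← cos_neg]; congr 1; ring
  have e2 : cos (-(2 * π * z.2)) = cos (2 * π * z.2) := cos_neg _
  have e3 : cos (-(2 * π * z.1)) = cos (2 * π * z.1) := cos_neg _
  rcases hv with rfl | rfl | rfl | rfl | rfl | rfl <;>
  · simp only [orbitCos, phase, excess, rot_fst, rot_snd]
    push_cast
    ring_nf at e1 e2 e3 ⊢
    simp only [e1, e2, e3]
    try ring

lemma nat_mul_pow_le {t : ℝ} (h0 : 0 ≤ t) (h1 : t ≤ 3 / 4) {n : ℕ} (hn : 3 ≤ n) :
    n * t ^ n ≤ 3 * t ^ 3 := by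
  induction n, hn using Nat.le_induction with
  | base => norm_num
  | succ k hk ih =>
    refine le_trans ?_ ih
    have hk' : (3 : ℝ) ≤ k := by exact_mod_cast hk
    have : ((k : ℝ) + 1) * t ≤ k := by nlinarith
    rw [pow_succ]
    push_cast
    nlinarith [pow_nonneg h0 k]

lemma three_dvd_hexNorm_iff (v : ℤ × ℤ) : InSub v ↔ (3 : ℤ) ∣ hexNorm v := by
  have h : hexNorm v = (v.1 - v.2) * (v.1 - v.2) + 3 * (v.1 * v.2) := by unfold hexNorm; ring
  rw [h, Int.dvd_add_left (Dvd.intro _ rfl), Int.prime_three.dvd_mul, or_self]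
  rfl

lemma eq_zero_of_hexNat_eq_zero {v : ℤ × ℤ} (h : hexNat v = 0) : v = 0 := by
  have h1 := four_hexNorm_ge v
  have h2 := hexNat_cast v
  rw [h] at h2
  rw [← h2] at h1
  have h3 : (v.1.natAbs : ℤ) + v.2.natAbs = 0 := by
    by_contra hne
    have : 1 ≤ (v.1.natAbs : ℤ) + v.2.natAbs := by omega
    rw [Nat.cast_zero] at h1
    nlinarith
  ext <;> simp <;> omega

lemma three_le_hexNat {v : ℤ × ℤ} (hv : InSub v) (h0 : v ≠ 0) : 3 ≤ hexNat v := by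
  have h1 := (three_dvd_hexNorm_iff v).mp hv
  rw [← hexNat_cast] at h1
  have h2 : hexNat v ≠ 0 := fun h => h0 (eq_zero_of_hexNat_eq_zero h)
  omega

lemma pow_hexNat_le {v : ℤ × ℤ} (h : 3 ≤ hexNat v) :
    (1 / 2 : ℝ) ^ hexNat v ≤ (1 / 2) ^ (v.1.natAbs + v.2.natAbs) := by
  refine pow_le_pow_of_le_one (by norm_num) (by norm_num) ?_
  have h1 := natAbs_add_le_hexNorm (v := v) (by rw [← hexNat_cast]; exact_mod_cast h)
  rw [← hexNat_cast] at h1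
  exact_mod_cast h1

lemma summable_hexNome_pow {β : ℝ} (hβ : 0 < β) : Summable fun v => hexNome β ^ hexNat v :=
  (summable_gauss (x := 1 / 2) (y := √3 / 2) (by positivity) hβ).congr fun v => gauss_hex β v

lemma weighted_tail_term_le {h : ℝ} (h0 : 0 < h) (h1 : h ≤ 1 / 37) {v : ℤ × ℤ}
    (hv : InSub v) :
    hexNat v * h ^ hexNat v ≤ 24 * h ^ 3 * (1 / 2) ^ (v.1.natAbs + v.2.natAbs) := by
  by_cases hv0 : v = 0
  · subst hv0
    simp [hexNat, hexNorm]
    positivity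
  have hN := three_le_hexNat hv hv0
  have h2 := nat_mul_pow_le (t := 2 * h) (by positivity) (by linarith) hN
  have h3 : (hexNat v : ℝ) * h ^ hexNat v = hexNat v * (2 * h) ^ hexNat v * (1 / 2) ^ hexNat v := by
    rw [mul_assoc, ← mul_pow]; congr 2; ring
  rw [h3]
  calc _ ≤ 3 * (2 * h) ^ 3 * (1 / 2) ^ hexNat v := by gcongr
    _ ≤ 3 * (2 * h) ^ 3 * (1 / 2) ^ (v.1.natAbs + v.2.natAbs) := by
        exact mul_le_mul_of_nonneg_left (pow_hexNat_le hN) (by positivity)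
    _ = _ := by ring

lemma hex_barycenter_le {α : ℝ} (hα : 1 ≤ α) (z : ℝ × ℝ) :
    latticeThetaHat (1 / 2) (√3 / 2) (1 / 3, 1 / 3) α ≤ latticeThetaHat (1 / 2) (√3 / 2) z α := by
  have hβ : π ≤ π * α := le_mul_of_one_le_right pi_pos.le hα
  have hβ0 : 0 < π * α := pi_pos.trans_le hβ
  have hy : (0 : ℝ) < √3 / 2 := by positivity
  rw [latticeThetaHat_eq, latticeThetaHat_eq]
  set h := hexNome (π * α) with hh
  have h0 : 0 < h := hexNome_pos _
  have h1 : h ≤ 1 / 37 := hexNome_le hβ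
  simp_rw [cos_phase_barycenter, gauss_hex, ← hh]
  have hs := summable_hexNome_pow hβ0
  rw [← hh] at hs
  have hs1 : Summable fun v => h ^ hexNat v * cos (phase z v) :=
    (summable_gauss_mul_cos (x := 1 / 2) hy hβ0 (phase z)).congr fun v => by rw [gauss_hex]
  have hs2 : Summable fun v => h ^ hexNat v * (if InSub v then 1 else -(1 / 2) : ℝ) :=
    (summable_gauss_mul_cos (x := 1 / 2) hy hβ0 (phase (1 / 3, 1 / 3))).congr fun v => by
      rw [gauss_hex, cos_phase_barycenter]
  have hA := hasSum_rot_sum hs1.hasSum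
  have hB := hasSum_rot_sum hs2.hasSum
  have hC := hA.sub hB
  set s1 := ∑' v, h ^ hexNat v * cos (phase z v)
  set s2 := ∑' v, h ^ hexNat v * (if InSub v then 1 else -(1 / 2) : ℝ)
  set S := excess z with hS
  have hS0 : 0 ≤ S := excess_nonneg z
  have hT0 : ∀ v, 0 ≤ (if InSub v then hexNat v * h ^ hexNat v else 0 : ℝ) := fun v => by
    split_ifs <;> positivity
  have hT1 : ∀ v, (if InSub v then hexNat v * h ^ hexNat v else 0 : ℝ) ≤
      24 * h ^ 3 * (1 / 2) ^ (v.1.natAbs + v.2.natAbs) := fun v => by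
    split_ifs with hv
    · exact weighted_tail_term_le h0 h1 hv
    · positivity
  have hTs := summable_of_le_half_pow hT0 hT1
  have hTb := tsum_le_of_le_half_pow hT0 hT1
  set T := ∑' v, (if InSub v then hexNat v * h ^ hexNat v else 0 : ℝ)
  have hP : HasSum (fun v => if v ∈ shortVectors then h else 0) (6 * h) := by
    have : HasSum (fun v => if v ∈ shortVectors then h else 0)
        (∑ v ∈ shortVectors, if v ∈ shortVectors then h else 0) :=
      hasSum_sum_of_ne_finset_zero fun v hv => if_neg hv
    have hsum : ∑ v ∈ shortVectors, (if v ∈ shortVectors then h else 0) = 6 * h := by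
      rw [Finset.sum_congr rfl fun v hv => if_pos hv, Finset.sum_const,
        show shortVectors.card = 6 from rfl, nsmul_eq_mul]
      norm_num
    rwa [hsum] at this
  have hD := (hP.mul_left S).sub (hTs.hasSum.mul_left (32 / 3 * S))
  have hle := hasSum_le (fun v => ?_) hD hC
  · have : 0 ≤ S * (6 * h) - 32 / 3 * S * T := by
      have h2 : T ≤ 9 / 16 * h := by nlinarith [mul_pos h0 h0]
      nlinarith
    linarith
  · simp only [hexNat_rot, inSub_rot]
    have hN : 0 < h ^ hexNat v := by positivity
    have e : h ^ hexNat v * cos (phase z v) + h ^ hexNat v * cos (phase z (rot v)) +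
        h ^ hexNat v * cos (phase z (rot (rot v))) = h ^ hexNat v * orbitCos z v := by
      unfold orbitCos; ring
    rw [e]
    by_cases hv : v ∈ shortVectors
    · obtain ⟨hv1, hv2⟩ := shortVectors_props hv
      rw [if_pos hv, if_neg hv2, if_neg hv2, orbitCos_shortVectors z hv, hv1]
      apply le_of_eq; ring
    · by_cases hv2 : InSub v
      · rw [if_neg hv, if_pos hv2, if_pos hv2]
        have := three_sub_orbitCos_le z hv2
        nlinarith
      · rw [if_neg hv, if_neg hv2, if_neg hv2]
        have := orbitCos_ge z v
        nlinarith

/-! ### Shells of the two partial theta series -/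

/-- The sublattice vectors of hexagonal norm three. -/
def mediumVectors : Finset (ℤ × ℤ) := {(1, 1), (-2, 1), (1, -2), (-1, -1), (2, -1), (-1, 2)}

lemma mediumVectors_props {v : ℤ × ℤ} (hv : v ∈ mediumVectors) : hexNat v = 3 ∧ InSub v := by
  revert v; decide

lemma natAbs_le_of_hexNat_le {v : ℤ × ℤ} (h : hexNat v ≤ 8) :
    v.1 ∈ Finset.Icc (-5 : ℤ) 5 ∧ v.2 ∈ Finset.Icc (-5 : ℤ) 5 := by
  have h1 := four_hexNorm_ge v
  rw [← hexNat_cast] at h1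
  have h2 : (hexNat v : ℤ) ≤ 8 := by exact_mod_cast h
  have h3 : (v.1.natAbs : ℤ) + v.2.natAbs ≤ 5 := by by_contra! hlt; nlinarith
  simp only [Finset.mem_Icc]
  omega

lemma four_le_hexNat {v : ℤ × ℤ} (h1 : ¬ InSub v) (h2 : v ∉ shortVectors) : 4 ≤ hexNat v := by
  by_contra! hlt
  obtain ⟨ha, hb⟩ := natAbs_le_of_hexNat_le (v := v) (by omega)
  have key : ∀ a ∈ Finset.Icc (-5 : ℤ) 5, ∀ b ∈ Finset.Icc (-5 : ℤ) 5,
      InSub (a, b) ∨ (a, b) ∈ shortVectors ∨ 4 ≤ hexNat (a, b) := by decide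
  rcases key _ ha _ hb with h | h | h
  · exact h1 h
  · exact h2 h
  · exact absurd h (not_le.mpr hlt)

lemma nine_le_hexNat {v : ℤ × ℤ} (h1 : InSub v) (h0 : v ≠ 0) (h2 : v ∉ mediumVectors) :
    9 ≤ hexNat v := by
  by_contra! hlt
  obtain ⟨ha, hb⟩ := natAbs_le_of_hexNat_le (v := v) (by omega)
  have key : ∀ a ∈ Finset.Icc (-5 : ℤ) 5, ∀ b ∈ Finset.Icc (-5 : ℤ) 5,
      ¬ InSub (a, b) ∨ (a, b) = 0 ∨ (a, b) ∈ mediumVectors ∨ 9 ≤ hexNat (a, b) := by decide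
  rcases key _ ha _ hb with h | h | h | h
  · exact h h1
  · exact h0 h
  · exact h2 h
  · exact absurd h (not_le.mpr hlt)

@[simp] lemma rot_mem_shortVectors (v : ℤ × ℤ) : rot v ∈ shortVectors ↔ v ∈ shortVectors := by
  constructor
  · intro h
    have key : ∀ w ∈ shortVectors, rot.symm w ∈ shortVectors := by decide
    simpa using key _ h
  · have key : ∀ w ∈ shortVectors, rot w ∈ shortVectors := by decide
    exact key v

/-- The contribution to `offSum` of all but the six shortest vectors. -/
noncomputable def farOffSum (x y β : ℝ) : ℝ :=
  ∑' v, if InSub v ∨ v ∈ shortVectors then 0 else gauss x y β v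

lemma offSum_eq {x y β : ℝ} (hy : 0 < y) (hβ : 0 < β) :
    offSum x y β = (∑ v ∈ shortVectors, gauss x y β v) + farOffSum x y β := by
  have hs := summable_gauss (x := x) hy hβ
  unfold offSum farOffSum
  rw [← tsum_eq_ite_add_ite (summable_ite_not_of_summable hs InSub) (· ∈ shortVectors),
    tsum_ite_mem]
  refine congrArg₂ (· + ·) (Finset.sum_congr rfl fun v hv => if_neg (shortVectors_props hv).2) ?_
  · refine tsum_congr fun v => ?_
    by_cases h1 : InSub v <;> by_cases h2 : v ∈ shortVectors <;> simp [h1, h2]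

lemma gauss_zero (x y β : ℝ) : gauss x y β 0 = 1 := by simp [gauss, quadForm]

lemma subSum_le {x y β C : ℝ} (hy : 0 < y) (hβ : 0 < β) (hC : ∀ v, InSub v → 9 ≤ hexNat v →
    gauss x y β v ≤ C * (1 / 2) ^ (v.1.natAbs + v.2.natAbs)) (hC0 : 0 ≤ C) :
    subSum x y β ≤ 1 + (∑ v ∈ mediumVectors, gauss x y β v) + 9 * C := by
  have hs := summable_gauss (x := x) hy hβ
  unfold subSum
  rw [← tsum_eq_ite_add_ite (summable_ite_of_summable hs InSub) (· ∈ insert 0 mediumVectors),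
    tsum_ite_mem, Finset.sum_insert (by decide), if_pos (by decide), gauss_zero]
  refine add_le_add (add_le_add le_rfl (le_of_eq ?_))
    (tsum_le_of_le_half_pow (fun v => ?_) fun v => ?_)
  · exact Finset.sum_congr rfl fun v hv => if_pos (mediumVectors_props hv).2
  · have := gauss_pos x y β v
    split_ifs <;> positivity
  · split_ifs with h1 h2
    · positivity
    · rw [Finset.mem_insert, not_or] at h1
      exact hC v h2 (nine_le_hexNat h2 h1.1 h1.2)
    · positivity

lemma one_le_subSum {x y β : ℝ} (hy : 0 < y) (hβ : 0 < β) : 1 ≤ subSum x y β := by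
  have hs := summable_ite_of_summable (summable_gauss (x := x) hy hβ) InSub
  have h := hs.le_tsum 0 fun v _ => by
    have := gauss_pos x y β v
    split_ifs <;> positivity
  rwa [if_pos (by decide), gauss_zero] at h

lemma offSum_pos {x y β : ℝ} (hy : 0 < y) (hβ : 0 < β) : 0 < offSum x y β := by
  have hs := summable_ite_not_of_summable (summable_gauss (x := x) hy hβ) InSub
  have h := hs.le_tsum (1, 0) fun v _ => by
    have := gauss_pos x y β v
    split_ifs <;> positivity
  rw [if_neg (by decide)] at h
  exact (gauss_pos _ _ _ _).trans_le h

lemma pow_mul_half_pow_le {h : ℝ} (h0 : 0 < h) (h1 : h ≤ 1 / 37) {v : ℤ × ℤ} (hv : 4 ≤ hexNat v) :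
    hexNat v * h ^ hexNat v ≤ 64 * h ^ 4 * (1 / 2) ^ (v.1.natAbs + v.2.natAbs) ∧
    h ^ hexNat v ≤ 16 * h ^ 4 * (1 / 2) ^ (v.1.natAbs + v.2.natAbs) := by
  have e : h ^ hexNat v = (2 * h) ^ hexNat v * (1 / 2) ^ hexNat v := by
    rw [← mul_pow]; congr 1; ring
  have hp := pow_hexNat_le (v := v) (by omega)
  obtain ⟨n, hn⟩ := Nat.exists_eq_add_of_le hv
  have hd : ∀ n : ℕ, ((4 + n : ℕ) : ℝ) * (2 * h) ^ (4 + n) ≤ 64 * h ^ 4 := by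
    intro n
    induction n with
    | zero => norm_num; linarith [show (2 * h) ^ 4 = 16 * h ^ 4 by ring]
    | succ k ih =>
      refine le_trans ?_ ih
      rw [show 4 + (k + 1) = 4 + k + 1 from rfl, pow_succ]
      push_cast
      have : (4 + (k : ℝ) + 1) * (2 * h) ≤ 4 + k := by nlinarith [(Nat.cast_nonneg k : (0 : ℝ) ≤ k)]
      nlinarith [pow_pos (by linarith : 0 < 2 * h) (4 + k)]
  have hd1 := hd n
  rw [← hn] at hd1
  have hd2 : (2 * h) ^ hexNat v ≤ 16 * h ^ 4 := by
    have h4 : (4 : ℝ) ≤ hexNat v := by exact_mod_cast hv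
    nlinarith [pow_pos (by linarith : 0 < 2 * h) (hexNat v)]
  rw [e, ← mul_assoc]
  constructor
  · exact mul_le_mul hd1 hp (by positivity) (by positivity)
  · exact mul_le_mul hd2 hp (by positivity) (by positivity)

lemma offSum_hex_le {β : ℝ} (hβ : π ≤ β) :
    offSum (1 / 2) (√3 / 2) β ≤ 6 * hexNome β + 144 * hexNome β ^ 4 := by
  have hβ0 := pi_pos.trans_le hβ
  rw [offSum_eq (by positivity) hβ0]
  have h1 : ∑ v ∈ shortVectors, gauss (1 / 2) (√3 / 2) β v = 6 * hexNome β := by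
    rw [Finset.sum_congr rfl fun v hv => by rw [gauss_hex, (shortVectors_props hv).1, pow_one],
      Finset.sum_const, show shortVectors.card = 6 from rfl, nsmul_eq_mul]
    norm_num
  have h0 := hexNome_pos β
  have h2 : farOffSum (1 / 2) (√3 / 2) β ≤ 9 * (16 * hexNome β ^ 4) := by
    refine tsum_le_of_le_half_pow (fun v => ?_) fun v => ?_
    · have := gauss_pos (1 / 2) (√3 / 2) β v
      split_ifs <;> positivity
    · split_ifs with hv
      · positivity
      · rw [not_or] at hv
        rw [gauss_hex]
        exact (pow_mul_half_pow_le h0 (hexNome_le hβ) (four_le_hexNat hv.1 hv.2)).2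
  linarith

lemma gauss_pair_ge (x y β : ℝ) (v : ℤ × ℤ) :
    2 * exp (-(β / y)) * gauss x y β v ≤ gauss x y β (v + (1, 0)) + gauss x y β (v - (1, 0)) := by
  set d := β * (2 * (v.1 + x * v.2) / y) with hd
  have e1 : gauss x y β (v + (1, 0)) = exp (-(β / y)) * gauss x y β v * exp (-d) := by
    unfold gauss quadForm
    rw [← exp_add, ← exp_add]
    congr 1
    simp [hd]
    ring
  have e2 : gauss x y β (v - (1, 0)) = exp (-(β / y)) * gauss x y β v * exp d := by
    unfold gauss quadForm
    rw [← exp_add, ← exp_add]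
    congr 1
    simp [hd]
    ring
  rw [e1, e2]
  have h1 : 2 ≤ exp (-d) + exp d := by
    have := one_le_cosh d
    rw [cosh_eq] at this
    linarith
  have h2 : 0 < exp (-(β / y)) * gauss x y β v := mul_pos (exp_pos _) (gauss_pos _ _ _ _)
  nlinarith

lemma two_mul_subSum_le_offSum {x y β : ℝ} (hy : 0 < y) (hβ : 0 < β) :
    2 * exp (-(β / y)) * subSum x y β ≤ offSum x y β := by
  have hs := summable_gauss (x := x) hy hβ
  let P : ℤ × ℤ → ℝ := fun v => if InSub (v - (1, 0)) then gauss x y β v else 0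
  let M : ℤ × ℤ → ℝ := fun v => if InSub (v + (1, 0)) then gauss x y β v else 0
  have hP : Summable P := summable_ite_of_summable hs fun v => InSub (v - (1, 0))
  have hM : Summable M := summable_ite_of_summable hs fun v => InSub (v + (1, 0))
  have hP' : HasSum (fun v => P (v + (1, 0))) (∑' v, P v) :=
    (Equiv.hasSum_iff (Equiv.addRight ((1, 0) : ℤ × ℤ)) (f := P)).mpr hP.hasSum
  have hM' : HasSum (fun v => M (v - (1, 0))) (∑' v, M v) :=
    (Equiv.hasSum_iff (Equiv.subRight ((1, 0) : ℤ × ℤ)) (f := M)).mpr hM.hasSum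
  have hPM : offSum x y β = ∑' v, P v + ∑' v, M v := by
    rw [← hP.tsum_add hM]
    refine tsum_congr fun v => ?_
    have h1 : InSub (v - (1, 0)) ↔ (v.1 - v.2) % 3 = 1 := by
      simp only [InSub, Prod.fst_sub, Prod.snd_sub]; omega
    have h2 : InSub (v + (1, 0)) ↔ (v.1 - v.2) % 3 = 2 := by
      simp only [InSub, Prod.fst_add, Prod.snd_add]; omega
    have h3 : InSub v ↔ (v.1 - v.2) % 3 = 0 := by simp only [InSub]; omega
    simp only [P, M, h1, h2, h3]
    have h4 : (v.1 - v.2) % 3 = 0 ∨ (v.1 - v.2) % 3 = 1 ∨ (v.1 - v.2) % 3 = 2 := by omega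
    rcases h4 with h | h | h <;> simp [h]
  rw [hPM]
  unfold subSum
  refine hasSum_le (fun v => ?_)
    ((summable_ite_of_summable hs InSub).hasSum.mul_left (2 * exp (-(β / y)))) (hP'.add hM')
  simp only [P, M, add_sub_cancel_right, sub_add_cancel]
  split_ifs
  · exact gauss_pair_ge x y β v
  · simp

/-! ### Comparison with the hexagonal theta series -/

/-- The deviation of the quadratic form from the hexagonal one. -/
noncomputable def deviation (x y : ℝ) (v : ℤ × ℤ) : ℝ :=
  quadForm x y v - quadForm (1 / 2) (√3 / 2) v

lemma deviation_rot_sum {x y : ℝ} (hy : 0 < y) (v : ℤ × ℤ) :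
    deviation x y v + deviation x y (rot v) + deviation x y (rot (rot v)) =
      2 * hexNat v * (((y - √3 / 2) ^ 2 + (1 / 2 - x) ^ 2) / y) := by
  have h1 := quadForm_rot_sum x y v
  have h2 := quadForm_rot_sum (1 / 2) (√3 / 2) v
  unfold deviation
  have h3 : (1 - 1 / 2 + (1 / 2) ^ 2 + (√3 / 2) ^ 2) / (√3 / 2) = √3 := by
    have : √3 ^ 2 = 3 := sq_sqrt (by norm_num)
    field_simp
    linarith
  rw [h3] at h2
  have h4 : ((y - √3 / 2) ^ 2 + (1 / 2 - x) ^ 2) / y = (1 - x + x ^ 2 + y ^ 2) / y - √3 := by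
    have : √3 ^ 2 = 3 := sq_sqrt (by norm_num)
    field_simp
    linarith
  rw [h4, hexNat_cast_real]
  linarith

lemma gauss_eq_mul_exp (x y β : ℝ) (v : ℤ × ℤ) :
    gauss x y β v = hexNome β ^ hexNat v * exp (-(β * deviation x y v)) := by
  rw [← gauss_hex]
  unfold gauss deviation
  rw [← exp_add]
  congr 1
  ring

lemma gauss_ge_linear (x y β : ℝ) (v : ℤ × ℤ) :
    hexNome β ^ hexNat v * (1 - β * deviation x y v) ≤ gauss x y β v := by
  rw [gauss_eq_mul_exp]
  refine mul_le_mul_of_nonneg_left ?_ (pow_nonneg (hexNome_pos β).le _)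
  linarith [add_one_le_exp (-(β * deviation x y v))]

lemma farOffSum_ge {x y β : ℝ} (hy : 0 < y) (hβ : π ≤ β) :
    farOffSum (1 / 2) (√3 / 2) β - 384 * β * hexNome β ^ 4 *
      (((y - √3 / 2) ^ 2 + (1 / 2 - x) ^ 2) / y) ≤ farOffSum x y β := by
  have hβ0 := pi_pos.trans_le hβ
  have h0 := hexNome_pos β
  set D := ((y - √3 / 2) ^ 2 + (1 / 2 - x) ^ 2) / y with hD
  have hDnn : 0 ≤ D := by positivity
  set h := hexNome β with hh
  let p : ℤ × ℤ → Prop := fun v => InSub v ∨ v ∈ shortVectors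
  have hs1 := summable_ite_not_of_summable (summable_gauss (x := x) hy hβ0) p
  have hs2 := summable_ite_not_of_summable
    (summable_gauss (x := 1 / 2) (y := √3 / 2) (by positivity) hβ0) p
  let W : ℤ × ℤ → ℝ := fun v => if p v then 0 else hexNat v * h ^ hexNat v
  have hW0 : ∀ v, 0 ≤ W v := fun v => by simp only [W]; split_ifs <;> positivity
  have hW1 : ∀ v, W v ≤ 64 * h ^ 4 * (1 / 2) ^ (v.1.natAbs + v.2.natAbs) := fun v => by
    simp only [W, p]
    split_ifs with hv
    · positivity
    · rw [not_or] at hv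
      exact (pow_mul_half_pow_le h0 (hexNome_le hβ) (four_le_hexNat hv.1 hv.2)).1
  have hWs := summable_of_le_half_pow hW0 hW1
  have hWb := tsum_le_of_le_half_pow hW0 hW1
  have hA := (hasSum_rot_sum hs2.hasSum).sub (hWs.hasSum.mul_left (2 * β * D))
  have hB := hasSum_rot_sum hs1.hasSum
  have hle := hasSum_le (fun v => ?_) hA hB
  · change 3 * farOffSum (1 / 2) (√3 / 2) β - 2 * β * D * (∑' v, W v) ≤ 3 * farOffSum x y β at hle
    have : 2 * β * D * (∑' v, W v) ≤ 2 * β * D * (9 * (64 * h ^ 4)) :=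
      mul_le_mul_of_nonneg_left hWb (by positivity)
    linarith
  · simp only [W, p, inSub_rot, rot_mem_shortVectors]
    split_ifs with hv
    · simp
    · have e := deviation_rot_sum (x := x) hy v
      have g0 := gauss_ge_linear x y β v
      have g1 := gauss_ge_linear x y β (rot v)
      have g2 := gauss_ge_linear x y β (rot (rot v))
      simp only [gauss_hex, hexNat_rot] at g0 g1 g2 ⊢
      rw [← hh] at g0 g1 g2 ⊢
      rw [← hD] at e
      have e' : h ^ hexNat v * (β * (deviation x y v + deviation x y (rot v) +
          deviation x y (rot (rot v)))) = h ^ hexNat v * (β * (2 * hexNat v * D)) := by rw [e]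
      linarith

lemma cubic_le_exp_neg {t : ℝ} (ht : 0 ≤ t) : 1 - t + t ^ 2 / 2 - t ^ 3 / 6 ≤ exp (-t) := by
  have hd : ∀ s : ℝ, HasDerivAt (fun s => exp s * (1 - s + s ^ 2 / 2 - s ^ 3 / 6))
      (exp s * (-(s ^ 3) / 6)) s := by
    intro s
    have h1 : HasDerivAt (fun s : ℝ => 1 - s + s ^ 2 / 2 - s ^ 3 / 6) (-1 + s - s ^ 2 / 2) s := by
      have := (((hasDerivAt_id' s).const_sub 1).fun_add
        ((hasDerivAt_pow 2 s).div_const 2)).fun_sub ((hasDerivAt_pow 3 s).div_const 6)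
      refine this.congr_deriv ?_
      norm_num
      ring
    refine ((Real.hasDerivAt_exp s).fun_mul h1).congr_deriv ?_
    ring
  have hanti : AntitoneOn (fun s : ℝ => exp s * (1 - s + s ^ 2 / 2 - s ^ 3 / 6)) (Set.Ici 0) := by
    refine antitoneOn_of_deriv_nonpos (convex_Ici 0)
      (fun s _ => (hd s).continuousAt.continuousWithinAt)
      (fun s _ => (hd s).differentiableAt.differentiableWithinAt) fun s hs => ?_
    rw [interior_Ici, Set.mem_Ioi] at hs
    rw [(hd s).deriv]
    have := mul_pos (exp_pos s) (pow_pos hs 3)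
    linarith
  have h := hanti (Set.mem_Ici.mpr le_rfl) (Set.mem_Ici.mpr ht) ht
  simp only [exp_zero] at h
  rw [exp_neg, ← one_div, le_div_iff₀ (exp_pos t)]
  linarith

lemma exp_le_quadratic (t : ℝ) : exp t ≤ 1 + t + t ^ 2 / 2 * max 1 (exp t) := by
  rcases le_total t 0 with ht | ht
  · have h1 : exp t ≤ 1 + t + t ^ 2 / 2 := by
      have h2 := quadratic_le_exp_of_nonneg (x := -t) (by linarith)
      have h3 : exp t * exp (-t) = 1 := by rw [← exp_add]; simp
      nlinarith [exp_pos t, sq_nonneg t, sq_nonneg (t ^ 2)]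
    nlinarith [le_max_left 1 (exp t), sq_nonneg t]
  · have h3 : exp t * exp (-t) = 1 := by rw [← exp_add]; simp
    have h4 := cubic_le_exp_neg ht
    have h5 : 1 ≤ (1 + t) * exp (-t) + t ^ 2 / 2 := by
      rcases le_total t 2 with h2 | h2
      · nlinarith [mul_le_mul_of_nonneg_left h4 (by linarith : 0 ≤ 1 + t), pow_nonneg ht 3]
      · nlinarith [exp_pos (-t)]
    have h6 := mul_le_mul_of_nonneg_left h5 (exp_pos t).le
    have h7 := mul_le_mul_of_nonneg_left (le_max_right 1 (exp t)) (by positivity : 0 ≤ t ^ 2 / 2)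
    have h8 : exp t * ((1 + t) * exp (-t)) = 1 + t := by linear_combination (1 + t) * h3
    linarith

/-! ### Elementary exponential estimates -/

lemma exp_three_halves_ge : 4 ≤ exp (1.5 : ℝ) := by
  have := sum_le_exp_of_nonneg (x := 1.5) (by norm_num) 5
  norm_num [Finset.sum_range_succ, Nat.factorial] at this ⊢
  linarith

lemma exp_111_ge : 3.01 ≤ exp (1.11 : ℝ) := by
  have := sum_le_exp_of_nonneg (x := 1.11) (by norm_num) 5
  norm_num [Finset.sum_range_succ, Nat.factorial] at this ⊢
  linarith

lemma exp_five_eighths_ge : 1.86 ≤ exp (0.625 : ℝ) := by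
  have := sum_le_exp_of_nonneg (x := 0.625) (by norm_num) 5
  norm_num [Finset.sum_range_succ, Nat.factorial] at this ⊢
  linarith

lemma exp_848_ge : 4600 ≤ exp (8.48 : ℝ) := by
  have h1 : (2.88 : ℝ) ≤ exp 1.06 := by
    have := sum_le_exp_of_nonneg (x := 1.06) (by norm_num) 6
    norm_num [Finset.sum_range_succ, Nat.factorial] at this ⊢
    linarith
  have h2 : exp (8.48 : ℝ) = exp 1.06 ^ 8 := by rw [← exp_nat_mul]; norm_num
  rw [h2]
  calc (4600 : ℝ) ≤ 2.88 ^ 8 := by norm_num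
    _ ≤ _ := by gcongr

lemma exp_neg_six_le : exp (-6 : ℝ) ≤ 1 / 400 := by
  have h2 : exp (6 : ℝ) = exp 1 ^ 6 := by rw [← exp_nat_mul]; norm_num
  rw [exp_neg, one_div, h2]
  refine inv_anti₀ (by norm_num) ?_
  calc (400 : ℝ) ≤ 2.718 ^ 6 := by norm_num
    _ ≤ _ := by gcongr; linarith [exp_one_gt_d9]

lemma exp_neg_eight_le : exp (-8 : ℝ) ≤ 1 / 2900 := by
  have h2 : exp (8 : ℝ) = exp 1 ^ 8 := by rw [← exp_nat_mul]; norm_num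
  rw [exp_neg, one_div, h2]
  refine inv_anti₀ (by norm_num) ?_
  calc (2900 : ℝ) ≤ 2.718 ^ 8 := by norm_num
    _ ≤ _ := by gcongr; linarith [exp_one_gt_d9]

lemma exp_neg_nine_le : exp (-9 : ℝ) ≤ 1 / 8000 := by
  have h2 : exp (9 : ℝ) = exp 1 ^ 9 := by rw [← exp_nat_mul]; norm_num
  rw [exp_neg, one_div, h2]
  refine inv_anti₀ (by norm_num) ?_
  calc (8000 : ℝ) ≤ 2.718 ^ 9 := by norm_num
    _ ≤ _ := by gcongr; linarith [exp_one_gt_d9]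

lemma exp_mul_le_cosh {w S : ℝ} (hw0 : 0 ≤ w) (hw : w ≤ 1 / 2) (hwS : w ≤ 2 / 5 * S) :
    exp (w * S) ≤ cosh S := by
  have hS : 0 ≤ S := by linarith
  rcases le_total S (5 / 4) with h | h
  · have h1 : w * S ≤ 2 / 5 * S ^ 2 := by nlinarith
    refine (exp_le_exp.mpr h1).trans ?_
    have h2 : 1 + S ^ 2 / 2 + S ^ 4 / 24 ≤ cosh S := by
      have := sum_le_hasSum (Finset.range 3) (fun n _ => by positivity) (Real.hasSum_cosh S)
      norm_num [Finset.sum_range_succ, Nat.factorial] at this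
      linarith
    refine le_trans ?_ h2
    set τ := 2 / 5 * S ^ 2 with hτ
    have hτ0 : 0 ≤ τ := by positivity
    have hτ1 : τ ≤ 5 / 8 := by rw [hτ]; nlinarith
    have h3 := exp_bound' hτ0 (by linarith) (n := 3) (by norm_num)
    norm_num [Finset.sum_range_succ, Nat.factorial] at h3
    have e1 : S ^ 2 = 5 / 2 * τ := by rw [hτ]; ring
    have e2 : S ^ 4 = 25 / 4 * τ ^ 2 := by rw [hτ]; ring
    rw [e1, e2]
    have h4 : 0 ≤ τ * (5 / 8 - τ) := mul_nonneg hτ0 (by linarith)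
    nlinarith [mul_nonneg h4 hτ0]
  · have h1 : w * S ≤ S / 2 := by nlinarith
    refine (exp_le_exp.mpr h1).trans ?_
    have hX : 1.86 ≤ exp (S / 2) :=
      exp_five_eighths_ge.trans (exp_le_exp.mpr (by linarith))
    rw [cosh_eq]
    have e1 : exp S = exp (S / 2) ^ 2 := by rw [← exp_nat_mul]; congr 1; push_cast; ring
    have e2 : exp (-S) = 1 / exp (S / 2) ^ 2 := by
      rw [← e1, exp_neg, one_div]
    rw [e1, e2]
    set X := exp (S / 2)
    have : 0 < X := exp_pos _
    have hp : 0 ≤ (X - 1) * (X ^ 3 - X ^ 2 - X - 1) := by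
      refine mul_nonneg (by linarith) ?_
      nlinarith [mul_nonneg (by linarith : 0 ≤ X - 1.86) (sq_nonneg X),
        mul_nonneg (by linarith : 0 ≤ X - 1.86) this.le]
    rw [le_div_iff₀ (by norm_num), ← sub_nonneg]
    have : X ^ 2 + 1 / X ^ 2 - X * 2 = (X - 1) * (X ^ 3 - X ^ 2 - X - 1) / X ^ 2 := by
      field_simp
      ring
    rw [this]
    positivity

lemma exp_add_two_exp_neg_ge {a p : ℝ} (hp : 0 ≤ p) (ha0 : 0.46 ≤ a) (ha1 : a ≤ 2 / 3)
    (hap : 2 - 3 * a ≤ 1.103 * a * p) :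
    3 + p ^ 2 / 2 ≤ exp (2 * a * p) + 2 * exp (-(p * (1 - a / 2))) := by
  have h1 : 1 + 2 * a * p + (2 * a * p) ^ 2 / 2 + (2 * a * p) ^ 3 / 6 + (2 * a * p) ^ 4 / 24 ≤
      exp (2 * a * p) := by
    have := sum_le_exp_of_nonneg (x := 2 * a * p) (by positivity) 5
    norm_num [Finset.sum_range_succ, Nat.factorial] at this ⊢
    linarith
  have h2 := cubic_le_exp_neg (t := p * (1 - a / 2)) (mul_nonneg hp (by linarith))
  have h3 : (2 - 3 * a) * p ≤ 1.103 * a * p * p := mul_le_mul_of_nonneg_right hap hp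
  have hp3 : 0 ≤ p ^ 3 := by positivity
  have ha3 : (0.46 : ℝ) ^ 3 ≤ a ^ 3 := by gcongr
  have ha4 : (0.46 : ℝ) ^ 4 ≤ a ^ 4 := by gcongr
  have hb3 : (1 - a / 2) ^ 3 ≤ 0.77 ^ 3 := by
    have : 0 ≤ 1 - a / 2 := by linarith
    gcongr
    linarith
  have h4 : 0.0085 ≤ 1 / 2 - 2.103 * a + 2.25 * a ^ 2 := by
    nlinarith [sq_nonneg (a - 0.4673)]
  have h5 : 0 ≤ p ^ 2 * (0.0085 - 0.0225 * p + 0.0297 * p ^ 2) := by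
    refine mul_nonneg (sq_nonneg _) ?_
    nlinarith [sq_nonneg (p - 0.379)]
  have h6 : p ^ 3 * 0.0973 ≤ p ^ 3 * a ^ 3 :=
    mul_le_mul_of_nonneg_left (by norm_num at ha3 ⊢; linarith) hp3
  have h7 : p ^ 4 * 0.0447 ≤ p ^ 4 * a ^ 4 :=
    mul_le_mul_of_nonneg_left (by norm_num at ha4 ⊢; linarith) (by positivity)
  have h8 : p ^ 3 * (1 - a / 2) ^ 3 ≤ p ^ 3 * 0.4566 :=
    mul_le_mul_of_nonneg_left (by norm_num at hb3 ⊢; linarith) hp3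
  have h9 : p ^ 2 * 0.0085 ≤ p ^ 2 * (1 / 2 - 2.103 * a + 2.25 * a ^ 2) :=
    mul_le_mul_of_nonneg_left h4 (sq_nonneg _)
  nlinarith

lemma sq_le_nine_mul_exp {t : ℝ} (ht : 0 ≤ t) : t ^ 2 ≤ 9 * exp (t / 4) := by
  have h1 : t / 3 ≤ exp (t / 8) := by
    have h2 := add_one_le_exp (t / 8 - 1)
    have h3 : exp (t / 8) = exp (t / 8 - 1) * exp 1 := by rw [← exp_add]; congr 1; ring
    rw [h3]
    nlinarith [exp_one_gt_d9]
  have h4 : exp (t / 4) = exp (t / 8) ^ 2 := by rw [← exp_nat_mul]; congr 1; push_cast; ring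
  rw [h4]
  nlinarith

lemma sq_mul_exp_neg_le {β : ℝ} (hβ : π ≤ β) : β ^ 2 * exp (-(2.7 * β)) ≤ 0.0022 := by
  have hπ := pi_gt_d4
  have hπ' := pi_lt_d4
  have h1 : exp (2.7 * β) = exp (2.7 * π) * exp ((2.7 * (β - π)) / 2) ^ 2 := by
    rw [← exp_nat_mul, ← exp_add]; congr 1; push_cast; ring
  have h2 : β / π ≤ exp ((2.7 * (β - π)) / 2) := by
    refine le_trans ?_ (add_one_le_exp _)
    rw [div_le_iff₀ pi_pos]
    nlinarith
  have h3 : 4600 ≤ exp (2.7 * π) := exp_848_ge.trans (exp_le_exp.mpr (by linarith))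
  have h4 : 4600 * (β / π) ^ 2 ≤ exp (2.7 * β) := by
    rw [h1]
    have : 0 ≤ β / π := div_nonneg (pi_pos.le.trans hβ) pi_pos.le
    gcongr
  rw [exp_neg, ← div_eq_mul_inv, div_le_iff₀ (exp_pos _)]
  have h5 : β ^ 2 = (β / π) ^ 2 * π ^ 2 := by field_simp
  have h6 : π ^ 2 ≤ 10 := by nlinarith
  have h7 : (β / π) ^ 2 * π ^ 2 ≤ (β / π) ^ 2 * 10 := by gcongr
  nlinarith [sq_nonneg (β / π)]

lemma offSum_hex_le_mul {β : ℝ} (hβ : π ≤ β) :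
    offSum (1 / 2) (√3 / 2) β ≤ 6.003 * hexNome β := by
  have h0 := hexNome_pos β
  have h1 := hexNome_le hβ
  have h2 := offSum_hex_le hβ
  have h3 : hexNome β ^ 3 ≤ (1 / 37) ^ 3 := by gcongr
  have h4 : hexNome β ^ 4 = hexNome β ^ 3 * hexNome β := by ring
  rw [h4] at h2
  nlinarith

/-! ### Lattices with a large imaginary part -/

lemma offSum_mul_lt_of_five_fourths_le {x y β : ℝ} (hy : 5 / 4 ≤ y) (hβ : π ≤ β) :
    offSum (1 / 2) (√3 / 2) β * subSum x y β < offSum x y β * subSum (1 / 2) (√3 / 2) β := by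
  have hβ0 := pi_pos.trans_le hβ
  have hy0 : 0 < y := by linarith
  have hv := one_le_subSum (x := x) hy0 hβ0
  have hvh := one_le_subSum (x := 1 / 2) (y := √3 / 2) (by positivity) hβ0
  have hu := offSum_pos (x := x) hy0 hβ0
  have h1 := two_mul_subSum_le_offSum (x := x) hy0 hβ0
  have h2 := offSum_hex_le_mul hβ
  have h0 := hexNome_pos β
  have h3 : 3.01 * hexNome β ≤ exp (-(β / y)) := by
    have e : exp (-(β / y)) = exp (2 * β / √3 - β / y) * hexNome β := by
      rw [hexNome, ← exp_add]; congr 1; ring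
    rw [e]
    refine mul_le_mul_of_nonneg_right (exp_111_ge.trans (exp_le_exp.mpr ?_)) h0.le
    have i1 : β / y ≤ 4 / 5 * β := by
      rw [div_le_iff₀ hy0]; nlinarith
    have i2 : 1.154 * β ≤ 2 * β / √3 := by
      rw [le_div_iff₀ (by positivity)]
      nlinarith [sqrt_three_bounds.2]
    nlinarith [pi_gt_d4]
  calc offSum (1 / 2) (√3 / 2) β * subSum x y β ≤ 6.003 * hexNome β * subSum x y β := by gcongr
    _ < 2 * exp (-(β / y)) * subSum x y β :=
      mul_lt_mul_of_pos_right (by linarith) (by linarith)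
    _ ≤ offSum x y β := h1
    _ ≤ _ := le_mul_of_one_le_right hu.le hvh

/-! ### The shortest vectors of a general lattice -/

lemma sum_shortVectors_eq (x y β : ℝ) : ∑ v ∈ shortVectors, gauss x y β v =
    2 * (exp (-(β / y)) + exp (-(β * ((x ^ 2 + y ^ 2) / y))) +
      exp (-(β * (((1 - x) ^ 2 + y ^ 2) / y)))) := by
  unfold shortVectors
  repeat rw [Finset.sum_insert (by decide)]
  rw [Finset.sum_singleton]
  unfold gauss quadForm
  push_cast
  ring_nf

lemma sum_mediumVectors_eq (x y β : ℝ) : ∑ v ∈ mediumVectors, gauss x y β v =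
    2 * (exp (-(β * (((1 + x) ^ 2 + y ^ 2) / y))) + exp (-(β * (((2 - x) ^ 2 + y ^ 2) / y))) +
      exp (-(β * (((1 - 2 * x) ^ 2 + 4 * y ^ 2) / y)))) := by
  unfold mediumVectors
  repeat rw [Finset.sum_insert (by decide)]
  rw [Finset.sum_singleton]
  unfold gauss quadForm
  push_cast
  ring_nf

lemma sum_shortVectors_ge {x y β : ℝ} (hx0 : 0 ≤ x) (hx1 : x ≤ 1 / 2) (hy0 : √3 / 2 ≤ y)
    (hy1 : y ≤ 5 / 4) (hβ : π ≤ β) :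
    hexNome β * (6 + (β * (y - √3 / 2)) ^ 2) ≤ ∑ v ∈ shortVectors, gauss x y β v := by
  have hβ0 := pi_pos.trans_le hβ
  have hs3 : √3 ^ 2 = 3 := sq_sqrt (by norm_num)
  obtain ⟨b1, b2⟩ := sqrt_three_bounds
  have hypos : 0 < y := by linarith
  set p := β * (y - √3 / 2) with hp
  set a := 1 / (√3 * y) with ha
  have hp0 : 0 ≤ p := mul_nonneg hβ0.le (by linarith)
  have h3y : 0 < √3 * y := by positivity
  have hG := exp_add_two_exp_neg_ge (a := a) hp0
    (by rw [ha, le_div_iff₀ h3y]; nlinarith) (by rw [ha, div_le_iff₀ h3y]; nlinarith)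
    (by
      have e : 2 - 3 * a = 2 * √3 * a * (y - √3 / 2) := by
        rw [ha]; field_simp; nlinarith
      have hapos : 0 < a := by positivity
      have h4 : 0 ≤ a * (y - √3 / 2) := mul_nonneg hapos.le (by linarith)
      have h5 : 2 * √3 ≤ 1.103 * β := by nlinarith [pi_gt_d4]
      rw [e, hp]
      nlinarith [mul_le_mul_of_nonneg_right h5 h4])
  rw [sum_shortVectors_eq]
  have e1 : exp (-(β / y)) = hexNome β * exp (2 * a * p) := by
    rw [hexNome, ← exp_add]; congr 1
    rw [ha, hp]; field_simp; ring_nf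
  set w := 1 / 2 - x with hw
  have e2 : exp (-(β * ((x ^ 2 + y ^ 2) / y))) + exp (-(β * (((1 - x) ^ 2 + y ^ 2) / y))) =
      hexNome β * exp (-(p * (1 - a / 2))) *
        (exp (-(w * (β * w / y))) * (2 * cosh (β * w / y))) := by
    have e3 : -(2 * β / √3) + -(p * (1 - a / 2)) = -(β * ((1 / 4 + y ^ 2) / y)) := by
      have e4 : a = √3 / (3 * y) := by
        rw [ha, div_eq_div_iff h3y.ne' (by positivity)]; linear_combination (-y) * hs3
      have e5 : 2 * β / √3 = 2 * β * √3 / 3 := by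
        rw [div_eq_div_iff (by positivity) (by positivity)]; linear_combination (-2 * β) * hs3
      rw [e4, e5, hp]
      field_simp
      linear_combination (-4) * hs3
    have e6 : exp (-(β * ((x ^ 2 + y ^ 2) / y))) = hexNome β * exp (-(p * (1 - a / 2))) *
        (exp (-(w * (β * w / y))) * exp (β * w / y)) := by
      rw [hexNome, ← exp_add, ← exp_add, ← exp_add, e3, hw]
      congr 1
      field_simp
      ring
    have e7 : exp (-(β * (((1 - x) ^ 2 + y ^ 2) / y))) = hexNome β * exp (-(p * (1 - a / 2))) *
        (exp (-(w * (β * w / y))) * exp (-(β * w / y))) := by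
      rw [hexNome, ← exp_add, ← exp_add, ← exp_add, e3, hw]
      congr 1
      field_simp
      ring
    rw [e6, e7, cosh_eq]
    ring
  have h6 : exp (w * (β * w / y)) ≤ cosh (β * w / y) := by
    refine exp_mul_le_cosh (by linarith) (by linarith) ?_
    rw [← mul_div_assoc, le_div_iff₀ hypos]
    have : 0 ≤ w := by linarith
    nlinarith [pi_gt_d4]
  have h7 : 2 ≤ exp (-(w * (β * w / y))) * (2 * cosh (β * w / y)) := by
    have h8 : exp (-(w * (β * w / y))) * exp (w * (β * w / y)) = 1 := by rw [← exp_add]; simp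
    have := mul_le_mul_of_nonneg_left h6 (exp_pos (-(w * (β * w / y)))).le
    linarith
  have h9 : 0 < hexNome β * exp (-(p * (1 - a / 2))) := mul_pos (hexNome_pos β) (exp_pos _)
  rw [add_assoc, e1, e2]
  nlinarith [mul_le_mul_of_nonneg_left h7 h9.le, mul_le_mul_of_nonneg_left hG (hexNome_pos β).le]

/-! ### Lattices with a moderate imaginary part -/

lemma sqrt_three_div_two_le {x y : ℝ} (hx0 : 0 ≤ x) (hx1 : x ≤ 1 / 2) (hy : 0 < y)
    (hxy : 1 ≤ x ^ 2 + y ^ 2) : √3 / 2 ≤ y := by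
  have h : √3 ≤ 2 * y := sqrt_le_iff.mpr ⟨by linarith, by nlinarith⟩
  linarith

lemma exp_neg_mul_le_half_pow {t : ℝ} (ht : 1.5 ≤ t) {v : ℤ × ℤ} (hv : 9 ≤ hexNat v) :
    exp (-(t * hexNat v)) ≤ 1 / 4096 * (1 / 2) ^ (v.1.natAbs + v.2.natAbs) := by
  have h1 : exp (-t) ≤ (1 / 2) ^ 2 := by
    rw [exp_neg]
    refine (inv_anti₀ (by norm_num) (exp_three_halves_ge.trans (exp_le_exp.mpr ht))).trans ?_
    norm_num
  have h2 : exp (-(t * hexNat v)) = exp (-t) ^ hexNat v := by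
    rw [← exp_nat_mul]; congr 1; ring
  have h3 := natAbs_add_le_two_thirds_hexNorm (v := v) (by rw [← hexNat_cast]; exact_mod_cast hv)
  rw [← hexNat_cast] at h3
  calc exp (-(t * hexNat v)) ≤ ((1 / 2) ^ 2) ^ hexNat v := by
        rw [h2]; exact pow_le_pow_left₀ (exp_pos _).le h1 _
    _ = (1 / 2) ^ (2 * hexNat v) := (pow_mul _ _ _).symm
    _ ≤ (1 / 2) ^ (12 + (v.1.natAbs + v.2.natAbs)) :=
        pow_le_pow_of_le_one (by norm_num) (by norm_num) (by omega)
    _ = _ := by rw [pow_add]; norm_num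

lemma half_hexNat_le_quadForm {x y : ℝ} (hx0 : 0 ≤ x) (hx1 : x ≤ 1 / 2) (hy0 : 0 < y)
    (hy : y ≤ 5 / 4) (hxy : 1 ≤ x ^ 2 + y ^ 2) (v : ℤ × ℤ) :
    1 / 2 * (hexNat v : ℝ) ≤ quadForm x y v := by
  have hN : (hexNat v : ℝ) = (v.1 : ℝ) ^ 2 + v.1 * v.2 + (v.2 : ℝ) ^ 2 := by
    rw [hexNat_cast_real, hexNorm]; push_cast; ring
  have hN0 : (0 : ℝ) ≤ hexNat v := Nat.cast_nonneg _
  set k : ℝ := (v.1 : ℝ) with hk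
  set l : ℝ := (v.2 : ℝ) with hl
  have h1 : k ^ 2 + 2 * x * k * l + l ^ 2 ≤ k ^ 2 + 2 * x * k * l + (x ^ 2 + y ^ 2) * l ^ 2 := by
    nlinarith [sq_nonneg l]
  have h2 : 2 / 3 * (hexNat v : ℝ) ≤ k ^ 2 + 2 * x * k * l + l ^ 2 := by
    rcases le_total 0 (k * l) with h | h
    · nlinarith [mul_nonneg hx0 h, sq_nonneg (k - l)]
    · nlinarith [mul_nonneg (by linarith : 0 ≤ 1 - 2 * x) (by linarith : 0 ≤ -(k * l))]
  rw [quadForm, le_div_iff₀ hy0]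
  nlinarith

lemma subSum_le_of_le_five_fourths {x y β : ℝ} (hx0 : 0 ≤ x) (hx1 : x ≤ 1 / 2) (hy0 : 0 < y)
    (hy : y ≤ 5 / 4) (hxy : 1 ≤ x ^ 2 + y ^ 2) (hβ : π ≤ β) :
    subSum x y β ≤ 1 + (∑ v ∈ mediumVectors, gauss x y β v) + 9 * (1 / 4096) := by
  have hβ0 := pi_pos.trans_le hβ
  refine subSum_le hy0 hβ0 (fun v _ hv => ?_) (by norm_num)
  refine le_trans (exp_le_exp.mpr ?_)
    (exp_neg_mul_le_half_pow (t := β / 2) (by linarith [pi_gt_d4]) hv)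
  have := mul_le_mul_of_nonneg_left (half_hexNat_le_quadForm hx0 hx1 hy0 hy hxy v) hβ0.le
  linarith

lemma offSum_ge_of_le_five_fourths {x y β : ℝ} (hx0 : 0 ≤ x) (hx1 : x ≤ 1 / 2)
    (hy0 : √3 / 2 ≤ y) (hy1 : y ≤ 5 / 4) (hβ : π ≤ β) :
    hexNome β * (6 + (β * (y - √3 / 2)) ^ 2) ≤ offSum x y β := by
  have hy : 0 < y := lt_of_lt_of_le (by positivity) hy0
  rw [offSum_eq hy (pi_pos.trans_le hβ)]
  have h1 := sum_shortVectors_ge hx0 hx1 hy0 hy1 hβ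
  have h2 : 0 ≤ farOffSum x y β := tsum_nonneg fun v => by
    have := gauss_pos x y β v
    split_ifs <;> positivity
  linarith

lemma offSum_mul_lt_of_le_five_fourths {x y β m η : ℝ} (hx0 : 0 ≤ x) (hx1 : x ≤ 1 / 2)
    (hy0 : √3 / 2 ≤ y) (hy1 : y ≤ 5 / 4) (hxy : 1 ≤ x ^ 2 + y ^ 2) (hβ : π ≤ β)
    (hm : ∑ v ∈ mediumVectors, gauss x y β v ≤ m) (hη0 : 0 ≤ η) (hη : η ≤ y - √3 / 2)
    (hmη : 6.003 * (1.0022 + m) < 6 + 9.869 * η ^ 2) :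
    offSum (1 / 2) (√3 / 2) β * subSum x y β < offSum x y β * subSum (1 / 2) (√3 / 2) β := by
  have hβ0 := pi_pos.trans_le hβ
  have hy : 0 < y := lt_of_lt_of_le (by positivity) hy0
  have hv := subSum_le_of_le_five_fourths hx0 hx1 hy hy1 hxy hβ
  have hv1 := one_le_subSum (x := x) hy hβ0
  have hvh := one_le_subSum (x := 1 / 2) (y := √3 / 2) (by positivity) hβ0
  have hu := offSum_ge_of_le_five_fourths hx0 hx1 hy0 hy1 hβ
  have huh := offSum_hex_le_mul hβ
  have h0 := hexNome_pos β
  have hu0 := offSum_pos (x := x) hy hβ0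
  have hp : 9.869 * η ^ 2 ≤ (β * (y - √3 / 2)) ^ 2 := by
    have h1 : 9.869 ≤ β ^ 2 := by nlinarith [pi_gt_d4]
    rw [mul_pow]
    exact mul_le_mul h1 (pow_le_pow_left₀ hη0 hη 2) (sq_nonneg _) (sq_nonneg _)
  calc offSum (1 / 2) (√3 / 2) β * subSum x y β ≤ 6.003 * hexNome β * subSum x y β := by gcongr
    _ = hexNome β * (6.003 * subSum x y β) := by ring
    _ < hexNome β * (6 + (β * (y - √3 / 2)) ^ 2) :=
        mul_lt_mul_of_pos_left (by linarith) h0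
    _ ≤ offSum x y β := hu
    _ ≤ _ := le_mul_of_one_le_right hu0.le hvh

lemma exp_neg_mul_le_of_le {β c s q : ℝ} (hβ : π ≤ β) (hc : 0 ≤ c) (hs : s ≤ 3.1415 * c)
    (hq : c ≤ q) : exp (-(β * q)) ≤ exp (-s) := by
  refine exp_le_exp.mpr ?_
  have : π * c ≤ β * q := mul_le_mul hβ hq hc (pi_pos.le.trans hβ)
  nlinarith [pi_gt_d4]

lemma offSum_mul_lt_of_mem_Icc {x y β : ℝ} (hx0 : 0 ≤ x) (hx1 : x ≤ 1 / 2) (hy0 : 0.92 ≤ y)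
    (hy1 : y ≤ 5 / 4) (hxy : 1 ≤ x ^ 2 + y ^ 2) (hβ : π ≤ β) :
    offSum (1 / 2) (√3 / 2) β * subSum x y β < offSum x y β * subSum (1 / 2) (√3 / 2) β := by
  have hy : 0 < y := by linarith
  obtain ⟨-, b2⟩ := sqrt_three_bounds
  have i2 : exp (-(β * (((2 - x) ^ 2 + y ^ 2) / y))) ≤ exp (-9) := by
    refine exp_neg_mul_le_of_le (c := 3) hβ (by norm_num) (by norm_num) ?_
    rw [le_div_iff₀ hy]
    nlinarith [sq_nonneg (y - 1.5)]
  have i3 : exp (-(β * (((1 - 2 * x) ^ 2 + 4 * y ^ 2) / y))) ≤ exp (-9) := by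
    refine exp_neg_mul_le_of_le (c := 3) hβ (by norm_num) (by norm_num) ?_
    rw [le_div_iff₀ hy]
    nlinarith [sq_nonneg (1 - 2 * x)]
  have e9 := exp_neg_nine_le
  rcases le_total 0.95 y with h | h
  · have i1 : exp (-(β * (((1 + x) ^ 2 + y ^ 2) / y))) ≤ exp (-6) := by
      refine exp_neg_mul_le_of_le (c := 2) hβ (by norm_num) (by norm_num) ?_
      rw [le_div_iff₀ hy]
      nlinarith [sq_nonneg (y - 1)]
    refine offSum_mul_lt_of_le_five_fourths (m := 0.0055) (η := 0.083) hx0 hx1 (by linarith) hy1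
      hxy hβ ?_ (by norm_num) (by linarith) (by norm_num)
    rw [sum_mediumVectors_eq]
    linarith [exp_neg_six_le]
  · have hx : 0.31 ≤ x := by nlinarith
    have i1 : exp (-(β * (((1 + x) ^ 2 + y ^ 2) / y))) ≤ exp (-8) := by
      refine exp_neg_mul_le_of_le (c := 2.6) hβ (by norm_num) (by norm_num) ?_
      rw [le_div_iff₀ hy]
      nlinarith
    refine offSum_mul_lt_of_le_five_fourths (m := 0.0012) (η := 0.0539) hx0 hx1 (by linarith) hy1
      hxy hβ ?_ (by norm_num) (by linarith) (by norm_num)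
    rw [sum_mediumVectors_eq]
    linarith [exp_neg_eight_le]

/-! ### Lattices close to the hexagonal one -/

lemma sub_half_le {x y : ℝ} (hx0 : 0 ≤ x) (hx1 : x ≤ 1 / 2) (hy0 : √3 / 2 ≤ y)
    (hy1 : y ≤ 0.92) (hxy : 1 ≤ x ^ 2 + y ^ 2) :
    1 / 2 - x ≤ 0.11 ∧ 1 / 2 - x ≤ 2.01 * (y - √3 / 2) := by
  obtain ⟨b1, b2⟩ := sqrt_three_bounds
  have hs3 : √3 ^ 2 = 3 := sq_sqrt (by norm_num)
  set w := 1 / 2 - x with hw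
  set η := y - √3 / 2 with hη
  have hη0 : 0 ≤ η := by linarith
  have hη1 : η ≤ 0.054 := by linarith
  have h1 : w * (1 - w) ≤ η * (√3 + η) := by
    have e1 : x = 1 / 2 - w := by ring
    have e2 : y = √3 / 2 + η := by ring
    rw [e1, e2] at hxy
    nlinarith
  have h2 : η * (√3 + η) ≤ η * 1.7861 := mul_le_mul_of_nonneg_left (by linarith) hη0
  have h3 : w ≤ 0.11 := by
    by_contra! h
    nlinarith [mul_nonneg (by linarith : 0 ≤ w - 0.11) (by linarith : 0 ≤ 0.5 - w)]
  refine ⟨h3, ?_⟩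
  nlinarith

lemma abs_deviation_le {x y : ℝ} (hx0 : 0 ≤ x) (hx1 : x ≤ 1 / 2) (hy0 : √3 / 2 ≤ y)
    (hy1 : y ≤ 0.92) (hxy : 1 ≤ x ^ 2 + y ^ 2) (v : ℤ × ℤ) :
    |deviation x y v| ≤ 4.4 * (y - √3 / 2) * hexNat v := by
  obtain ⟨b1, b2⟩ := sqrt_three_bounds
  have hs3 : √3 ^ 2 = 3 := sq_sqrt (by norm_num)
  have hy : 0 < y := by linarith
  obtain ⟨hw1, hw2⟩ := sub_half_le hx0 hx1 hy0 hy1 hxy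
  set w := 1 / 2 - x with hw
  set η := y - √3 / 2 with hη
  have hw0 : 0 ≤ w := by linarith
  have hη0 : 0 ≤ η := by linarith
  have hN : (hexNat v : ℝ) = (v.1 : ℝ) ^ 2 + v.1 * v.2 + (v.2 : ℝ) ^ 2 := by
    rw [hexNat_cast_real, hexNorm]; push_cast; ring
  set l : ℝ := (v.2 : ℝ) with hl
  set M : ℝ := (v.1 : ℝ) + l / 2 with hM
  set N : ℝ := (hexNat v : ℝ) with hNd
  have hNM : N = M ^ 2 + 3 / 4 * l ^ 2 := by rw [hN, hM]; ring
  have hdev : deviation x y v =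
      -(2 * η / (√3 * y)) * M ^ 2 + η * l ^ 2 - w / y * (2 * M * l) + w * w / y * l ^ 2 := by
    rw [deviation, quadForm_hex, ← hexNat_cast_real, ← hNd, hNM, quadForm, ← hl,
      show (v.1 : ℝ) = M - l / 2 by rw [hM]; ring, show x = 1 / 2 - w by rw [hw]; ring, hη]
    field_simp
    ring_nf
    rw [hs3]
    ring
  have c1 : 2 * η / (√3 * y) ≤ 4 / 3 * η := by
    rw [div_le_iff₀ (by positivity)]
    have : 1.5 ≤ √3 * y := by nlinarith
    nlinarith
  have c1' : 0 ≤ 2 * η / (√3 * y) := by positivity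
  have c2 : w / y ≤ 2.321 * η := by rw [div_le_iff₀ hy]; nlinarith
  have c2' : 0 ≤ w / y := by positivity
  have c3 : w * w / y ≤ 0.2554 * η := by
    rw [mul_div_assoc]
    calc w * (w / y) ≤ 0.11 * (2.321 * η) := mul_le_mul hw1 c2 c2' (by norm_num)
      _ ≤ 0.2554 * η := by linarith
  have c3' : 0 ≤ w * w / y := by positivity
  have hMl : |2 * M * l| ≤ 1.15475 * N := by
    rw [hNM, abs_le]
    constructor <;> linarith [sq_nonneg (M + 0.866 * l), sq_nonneg (M - 0.866 * l), sq_nonneg M,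
      sq_nonneg l]
  have hMl2 : |w / y * (2 * M * l)| ≤ 2.321 * η * (1.15475 * N) := by
    rw [abs_mul, abs_of_nonneg c2']
    exact mul_le_mul c2 hMl (abs_nonneg _) (by positivity)
  rw [abs_le] at hMl2
  have t1 : 2 * η / (√3 * y) * M ^ 2 ≤ 4 / 3 * η * M ^ 2 :=
    mul_le_mul_of_nonneg_right c1 (sq_nonneg _)
  have t1' : 0 ≤ 2 * η / (√3 * y) * M ^ 2 := by positivity
  have t3 : w * w / y * l ^ 2 ≤ 0.2554 * η * l ^ 2 := mul_le_mul_of_nonneg_right c3 (sq_nonneg _)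
  have t3' : 0 ≤ w * w / y * l ^ 2 := by positivity
  have z1 : 0 ≤ η * M ^ 2 := by positivity
  have z2 : 0 ≤ η * l ^ 2 := by positivity
  have z3 : η * N = η * M ^ 2 + 3 / 4 * (η * l ^ 2) := by rw [hNM]; ring
  rw [hdev, abs_le]
  constructor <;> linarith

lemma gauss_le_quadratic {x y β ρ : ℝ} (hβ : 0 < β) (hρ : ρ ≤ 0.25) {v : ℤ × ℤ}
    (hdev : |deviation x y v| ≤ ρ * hexNat v) :
    gauss x y β v ≤ hexNome β ^ hexNat v * (1 - β * deviation x y v) +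
      ρ ^ 2 / 2 * ((β * hexNat v) ^ 2 * exp (-(0.9 * β * hexNat v))) := by
  have hN0 : (0 : ℝ) ≤ hexNat v := Nat.cast_nonneg _
  have h23 : 1.154 ≤ 2 / √3 := by
    rw [le_div_iff₀ (by positivity)]
    linarith [sqrt_three_bounds.2]
  have h0 : 0 < hexNome β ^ hexNat v := pow_pos (hexNome_pos β) _
  set E := exp (-(0.9 * β * hexNat v)) with hE
  set d := deviation x y v with hd
  have hβN : 0 ≤ β * hexNat v := by positivity
  have e1 : hexNome β ^ hexNat v ≤ E := by
    rw [← gauss_hex, gauss, quadForm_hex, ← hexNat_cast_real, hE, exp_le_exp]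
    nlinarith
  have e2 : hexNome β ^ hexNat v * exp (-(β * d)) ≤ E := by
    rw [hd, ← gauss_eq_mul_exp, gauss, hE, exp_le_exp]
    have h1 : quadForm x y v = d + 2 / √3 * hexNat v := by
      rw [hd, deviation, quadForm_hex, ← hexNat_cast_real]; ring
    have h2 : 0.9 * (hexNat v : ℝ) ≤ quadForm x y v := by
      rw [h1]
      nlinarith [neg_abs_le d]
    nlinarith
  have e3 : hexNome β ^ hexNat v * max 1 (exp (-(β * d))) ≤ E := by
    rcases max_choice 1 (exp (-(β * d))) with h | h <;> rw [h]
    · rwa [mul_one]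
    · exact e2
  have e4 : (β * d) ^ 2 ≤ ρ ^ 2 * (β * hexNat v) ^ 2 := by
    have : d ^ 2 ≤ (ρ * hexNat v) ^ 2 :=
      sq_le_sq' (by linarith [neg_abs_le d]) ((le_abs_self d).trans hdev)
    calc (β * d) ^ 2 = β ^ 2 * d ^ 2 := by ring
      _ ≤ β ^ 2 * (ρ * hexNat v) ^ 2 := by gcongr
      _ = _ := by ring
  have e5 := mul_le_mul_of_nonneg_left (exp_le_quadratic (-(β * d))) h0.le
  have e6 : (β * d) ^ 2 / 2 * (hexNome β ^ hexNat v * max 1 (exp (-(β * d)))) ≤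
      ρ ^ 2 * (β * hexNat v) ^ 2 / 2 * E :=
    mul_le_mul (by linarith) e3 (by positivity) (by positivity)
  rw [gauss_eq_mul_exp, ← hd]
  linarith

/-- The summand bounding the second order error on the sublattice. -/
noncomputable def quadError (β : ℝ) (v : ℤ × ℤ) : ℝ :=
  if InSub v then (β * hexNat v) ^ 2 * exp (-(0.9 * β * hexNat v)) else 0

lemma quadError_nonneg (β : ℝ) (v : ℤ × ℤ) : 0 ≤ quadError β v := by
  unfold quadError
  split_ifs <;> positivity

lemma quadError_le {β : ℝ} (hβ : π ≤ β) (v : ℤ × ℤ) : quadError β v ≤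
    (if v ∈ mediumVectors then 0.0198 else 0) +
      9 / 4096 * (1 / 2) ^ (v.1.natAbs + v.2.natAbs) := by
  have hp : (0 : ℝ) ≤ 9 / 4096 * (1 / 2) ^ (v.1.natAbs + v.2.natAbs) := by positivity
  have hβ0 := pi_pos.trans_le hβ
  unfold quadError
  split_ifs with h1 h2 h2
  · rw [(mediumVectors_props h2).1]
    have h3 := sq_mul_exp_neg_le hβ
    push_cast
    rw [show 0.9 * β * 3 = 2.7 * β by ring]
    linarith
  · rcases eq_or_ne v 0 with h0 | h0
    · subst h0
      norm_num [hexNat, hexNorm]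
    · have h3 := sq_le_nine_mul_exp (t := β * hexNat v) (by positivity)
      have h4 := exp_neg_mul_le_half_pow (t := 0.65 * β) (by nlinarith [pi_gt_d4])
        (nine_le_hexNat h1 h0 h2)
      have h5 : exp (β * hexNat v / 4) * exp (-(0.9 * β * hexNat v)) =
          exp (-(0.65 * β * hexNat v)) := by
        rw [← exp_add]; congr 1; ring
      calc (β * hexNat v) ^ 2 * exp (-(0.9 * β * hexNat v))
          ≤ 9 * exp (β * hexNat v / 4) * exp (-(0.9 * β * hexNat v)) := by gcongr
        _ = 9 * exp (-(0.65 * β * hexNat v)) := by rw [mul_assoc, h5]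
        _ ≤ _ := by linarith
  · linarith
  · linarith

lemma summable_quadError_bound : Summable fun v : ℤ × ℤ =>
    (if v ∈ mediumVectors then (0.0198 : ℝ) else 0) +
      9 / 4096 * (1 / 2) ^ (v.1.natAbs + v.2.natAbs) := by
  refine Summable.add ?_
    ((hasSum_pow_natAbs_add (by norm_num) (by norm_num)).summable.mul_left _)
  exact summable_of_ne_finset_zero (s := mediumVectors) fun v hv => if_neg hv

lemma summable_quadError {β : ℝ} (hβ : π ≤ β) : Summable (quadError β) :=
  Summable.of_nonneg_of_le (quadError_nonneg β) (quadError_le hβ) summable_quadError_bound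

lemma tsum_quadError_le {β : ℝ} (hβ : π ≤ β) : ∑' v, quadError β v ≤ 0.1386 := by
  refine ((summable_quadError hβ).tsum_le_tsum (quadError_le hβ)
    summable_quadError_bound).trans ?_
  have hs := hasSum_pow_natAbs_add (r := 1 / 2) (by norm_num) (by norm_num)
  rw [Summable.tsum_add (summable_of_ne_finset_zero (s := mediumVectors) fun v hv => if_neg hv)
    (hs.summable.mul_left _), tsum_ite_mem (fun _ => 0.0198), tsum_mul_left, hs.tsum_eq]
  rw [Finset.sum_const, show mediumVectors.card = 6 by decide]
  norm_num

lemma subSum_le_quadratic {x y β ρ : ℝ} (hy : 0 < y) (hβ : π ≤ β) (hρ : ρ ≤ 0.25)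
    (hdev : ∀ v, |deviation x y v| ≤ ρ * hexNat v) :
    subSum x y β ≤ subSum (1 / 2) (√3 / 2) β + ρ ^ 2 / 2 * 0.1386 := by
  have hβ0 := pi_pos.trans_le hβ
  have hs1 := summable_ite_of_summable (summable_gauss (x := x) hy hβ0) InSub
  have hs2 := summable_ite_of_summable
    (summable_gauss (x := 1 / 2) (y := √3 / 2) (by positivity) hβ0) InSub
  have hA := hasSum_rot_sum (hs2.hasSum.add ((summable_quadError hβ).hasSum.mul_left (ρ ^ 2 / 2)))
  have hB := hasSum_rot_sum hs1.hasSum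
  have hle := hasSum_le (fun v => ?_) hB hA
  · change 3 * subSum x y β ≤ 3 * (subSum (1 / 2) (√3 / 2) β + _) at hle
    have := mul_le_mul_of_nonneg_left (tsum_quadError_le hβ) (by positivity : 0 ≤ ρ ^ 2 / 2)
    linarith
  · simp only [quadError, inSub_rot, hexNat_rot]
    split_ifs with hv
    · have e := deviation_rot_sum (x := x) hy v
      have g0 := gauss_le_quadratic hβ0 hρ (hdev v)
      have g1 := gauss_le_quadratic hβ0 hρ (hdev (rot v))
      have g2 := gauss_le_quadratic hβ0 hρ (hdev (rot (rot v)))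
      simp only [gauss_hex, hexNat_rot] at g0 g1 g2 ⊢
      have h0 : 0 ≤ hexNome β ^ hexNat v := pow_nonneg (hexNome_pos β).le _
      have e' : 0 ≤ hexNome β ^ hexNat v * (β * (deviation x y v + deviation x y (rot v) +
          deviation x y (rot (rot v)))) := by rw [e]; positivity
      linarith
    · simp

lemma offSum_mul_lt_of_near {x y β : ℝ} (hx0 : 0 ≤ x) (hx1 : x ≤ 1 / 2) (hy0 : √3 / 2 < y)
    (hy1 : y ≤ 0.92) (hxy : 1 ≤ x ^ 2 + y ^ 2) (hβ : π ≤ β) :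
    offSum (1 / 2) (√3 / 2) β * subSum x y β < offSum x y β * subSum (1 / 2) (√3 / 2) β := by
  obtain ⟨b1, b2⟩ := sqrt_three_bounds
  have hβ0 := pi_pos.trans_le hβ
  have hy : 0 < y := by linarith
  have hh : 0 < √3 / 2 := by positivity
  obtain ⟨hw1, hw2⟩ := sub_half_le hx0 hx1 hy0.le hy1 hxy
  have hv := subSum_le_quadratic hy hβ (by linarith)
    (abs_deviation_le hx0 hx1 hy0.le hy1 hxy)
  have hvh := one_le_subSum (x := 1 / 2) hh hβ0
  have huh := offSum_hex_le_mul hβ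
  have huh0 := offSum_pos (x := 1 / 2) hh hβ0
  have h0 := hexNome_pos β
  have h1 := hexNome_le hβ
  have hfar := farOffSum_ge (x := x) hy hβ
  have hshort := sum_shortVectors_ge hx0 hx1 hy0.le (by linarith) hβ
  have hshorthex : ∑ v ∈ shortVectors, gauss (1 / 2) (√3 / 2) β v = 6 * hexNome β := by
    rw [Finset.sum_congr rfl fun v hv => by rw [gauss_hex, (shortVectors_props hv).1, pow_one],
      Finset.sum_const, show shortVectors.card = 6 by decide, nsmul_eq_mul]
    norm_num
  have ehex := offSum_eq (x := 1 / 2) hh hβ0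
  have eoff := offSum_eq (x := x) hy hβ0
  rw [hshorthex] at ehex
  set h := hexNome β
  set w := 1 / 2 - x with hw
  set η := y - √3 / 2 with hη
  have hη0 : 0 < η := by linarith
  have hw0 : 0 ≤ w := by linarith
  have hD : (η ^ 2 + w ^ 2) / y ≤ 5.83 * η ^ 2 := by
    rw [div_le_iff₀ hy]
    have h2 : w ^ 2 ≤ (2.01 * η) ^ 2 := by gcongr
    have h3 : η ^ 2 * 0.866 ≤ η ^ 2 * y := by
      refine mul_le_mul_of_nonneg_left ?_ (sq_nonneg _)
      linarith
    nlinarith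
  have hD0 : 0 ≤ (η ^ 2 + w ^ 2) / y := by positivity
  have hβπ : 3.1415 ≤ β := pi_gt_d4.le.trans hβ
  have hββ : β ≤ β ^ 2 := le_self_pow₀ (by linarith) two_ne_zero
  have hβ9 : 9.869 ≤ β ^ 2 := by
    calc (9.869 : ℝ) ≤ 3.1415 ^ 2 := by norm_num
      _ ≤ β ^ 2 := by gcongr
  have hh3 : h ^ 3 ≤ (1 / 37) ^ 3 := by gcongr
  have hcube : 384 * β * h ^ 4 * ((η ^ 2 + w ^ 2) / y) ≤ h * (0.045 * (β ^ 2 * η ^ 2)) := by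
    calc 384 * β * h ^ 4 * ((η ^ 2 + w ^ 2) / y)
        = 384 * h * (β * h ^ 3 * ((η ^ 2 + w ^ 2) / y)) := by ring
      _ ≤ 384 * h * (β ^ 2 * (1 / 37) ^ 3 * (5.83 * η ^ 2)) := by gcongr
      _ = h * (384 * (1 / 37) ^ 3 * 5.83 * (β ^ 2 * η ^ 2)) := by ring
      _ ≤ h * (0.045 * (β ^ 2 * η ^ 2)) := by gcongr; norm_num
  have hdiff : h * (9.42 * η ^ 2) ≤ offSum x y β - offSum (1 / 2) (√3 / 2) β := by
    have h2 : h * (9.869 * η ^ 2) ≤ h * (β ^ 2 * η ^ 2) := by gcongr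
    rw [eoff, ehex]
    rw [mul_pow] at hshort
    linarith [mul_nonneg h0.le (sq_nonneg η)]
  have hsub : subSum x y β - subSum (1 / 2) (√3 / 2) β ≤ 1.3417 * η ^ 2 := by
    have h2 : (4.4 * η) ^ 2 / 2 * 0.1386 ≤ 1.3417 * η ^ 2 := by linarith [sq_nonneg η]
    linarith
  have hη2 : 0 < h * η ^ 2 := by positivity
  have k1 : h * (9.42 * η ^ 2) * 1 ≤
      (offSum x y β - offSum (1 / 2) (√3 / 2) β) * subSum (1 / 2) (√3 / 2) β :=
    mul_le_mul hdiff hvh zero_le_one (le_trans (by positivity) hdiff)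
  have k2 : offSum (1 / 2) (√3 / 2) β * (subSum x y β - subSum (1 / 2) (√3 / 2) β) ≤
      6.003 * h * (1.3417 * η ^ 2) :=
    (mul_le_mul_of_nonneg_left hsub huh0.le).trans
      (mul_le_mul_of_nonneg_right huh (by positivity))
  linarith

theorem offSum_mul_subSum_lt {x y β : ℝ} (hxy : (x, y) ∈ Dplus) (hβ : π ≤ β)
    (hne : (x, y) ≠ (1 / 2, √3 / 2)) :
    offSum (1 / 2) (√3 / 2) β * subSum x y β < offSum x y β * subSum (1 / 2) (√3 / 2) β := by
  obtain ⟨hx0, hx1, hy, hn⟩ := hxy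
  dsimp only at hx0 hx1 hy hn
  have hy0 := sqrt_three_div_two_le hx0 hx1 hy hn
  rcases le_total (5 / 4) y with h | h
  · exact offSum_mul_lt_of_five_fourths_le h hβ
  rcases le_total 0.92 y with h' | h'
  · exact offSum_mul_lt_of_mem_Icc hx0 hx1 h' h hn hβ
  refine offSum_mul_lt_of_near hx0 hx1 (lt_of_le_of_ne hy0 fun e => hne ?_) h' hn hβ
  have hs3 : √3 ^ 2 = 3 := sq_sqrt (by norm_num)
  have hx : x = 1 / 2 := by
    rw [← e] at hn
    nlinarith
  rw [hx, e]

/-! ### Frame bounds -/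

lemma frameB_eq {x y α : ℝ} (hy : 0 < y) (hα : 0 < α) :
    frameB x y α = subSum x y (π * α) + offSum x y (π * α) := by
  rw [subSum_add_offSum hy (by positivity)]
  refine le_antisymm (ciSup_le (latticeThetaHat_le hy hα)) ?_
  rw [← latticeThetaHat_zero]
  exact le_ciSup (f := fun w => latticeThetaHat x y w α)
    ⟨_, Set.forall_mem_range.mpr (latticeThetaHat_le hy hα)⟩ 0

lemma exists_pos_le_latticeThetaHat_of_mem {x y α : ℝ} (hxy : (x, y) ∈ Dplus) (hα : 1 ≤ α) :
    ∃ c, 0 < c ∧ ∀ z, c ≤ latticeThetaHat x y z α := by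
  obtain ⟨hx0, hx1, hy, hn⟩ := hxy
  dsimp only at hx0 hx1 hy hn
  have hy0 := sqrt_three_div_two_le hx0 hx1 hy hn
  refine exists_pos_le_latticeThetaHat hy (by linarith) ?_
  have h1 : 1.5 ≤ π * α * y := by
    have h2 : 0.8 ≤ y := by linarith [sqrt_three_bounds.1]
    have h3 : 3.1415 ≤ π * α := by nlinarith [pi_gt_d4]
    nlinarith
  have h4 := exp_three_halves_ge.trans (exp_le_exp.mpr h1)
  rw [exp_neg]
  refine (inv_anti₀ (by norm_num) h4).trans_lt (by norm_num)

lemma frameA_pos {x y α : ℝ} (hxy : (x, y) ∈ Dplus) (hα : 1 ≤ α) : 0 < frameA x y α := by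
  obtain ⟨c, hc, h⟩ := exists_pos_le_latticeThetaHat_of_mem hxy hα
  exact hc.trans_le (le_ciInf h)

lemma frameA_le {x y α : ℝ} (hxy : (x, y) ∈ Dplus) (hα : 1 ≤ α) :
    frameA x y α ≤ subSum x y (π * α) - 1 / 2 * offSum x y (π * α) := by
  obtain ⟨c, hc, h⟩ := exists_pos_le_latticeThetaHat_of_mem hxy hα
  rw [← latticeThetaHat_barycenter hxy.2.2.1 (by linarith)]
  exact ciInf_le (f := fun w => latticeThetaHat x y w α)
    ⟨c, Set.forall_mem_range.mpr h⟩ (1 / 3, 1 / 3)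

lemma hex_mem_Dplus : ((1 / 2 : ℝ), √3 / 2) ∈ Dplus := by
  have hs3 : √3 ^ 2 = 3 := sq_sqrt (by norm_num)
  refine ⟨by norm_num, le_rfl, by positivity, ?_⟩
  dsimp only
  linarith

lemma frameA_hex {α : ℝ} (hα : 1 ≤ α) : frameA (1 / 2) (√3 / 2) α =
    subSum (1 / 2) (√3 / 2) (π * α) - 1 / 2 * offSum (1 / 2) (√3 / 2) (π * α) := by
  refine le_antisymm (frameA_le hex_mem_Dplus hα) ?_
  rw [← latticeThetaHat_barycenter hex_mem_Dplus.2.2.1 (by linarith)]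
  exact le_ciInf (hex_barycenter_le hα)

theorem frame_ratio_lt {x y α : ℝ} (hxy : (x, y) ∈ Dplus) (hα : 1 ≤ α)
    (hne : (x, y) ≠ (1 / 2, √3 / 2)) :
    frameB (1 / 2) (√3 / 2) α / frameA (1 / 2) (√3 / 2) α < frameB x y α / frameA x y α := by
  have hβ : π ≤ π * α := le_mul_of_one_le_right pi_pos.le hα
  have hβ0 := pi_pos.trans_le hβ
  have hy : 0 < y := hxy.2.2.1
  have hα0 : 0 < α := by linarith
  have key := offSum_mul_subSum_lt hxy hβ hne
  have hA := frameA_pos hxy hα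
  have hAle := frameA_le hxy hα
  have hAh := frameA_pos hex_mem_Dplus hα
  rw [frameB_eq hy hα0, frameB_eq hex_mem_Dplus.2.2.1 hα0]
  have hu := offSum_pos (x := x) hy hβ0
  have hv := one_le_subSum (x := x) hy hβ0
  rw [frameA_hex hα] at hAh ⊢
  calc _ < (subSum x y (π * α) + offSum x y (π * α)) /
        (subSum x y (π * α) - 1 / 2 * offSum x y (π * α)) := by
        rw [div_lt_div_iff₀ hAh (hA.trans_le hAle)]
        linarith
    _ ≤ _ := div_le_div_of_nonneg_left (by linarith) hA hAle

end LatticeTheta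

/-- Strohmer–Beaver conjecture: for every even density `n ≥ 2` (with `α = n/2`),
`A_{x,y} > 0` and the ratio `B/A` is minimized over `D₊` exactly by the hexagonal lattice. -/
theorem strohmer_beaver (n : ℕ) (hn : 2 ≤ n) (hne : Even n)
    (x y : ℝ) (hxy : (x, y) ∈ Dplus) :
    0 < frameA x y ((n : ℝ) / 2) ∧
    frameB (1 / 2) (Real.sqrt 3 / 2) ((n : ℝ) / 2) /
        frameA (1 / 2) (Real.sqrt 3 / 2) ((n : ℝ) / 2) ≤
      frameB x y ((n : ℝ) / 2) / frameA x y ((n : ℝ) / 2) ∧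
    (frameB x y ((n : ℝ) / 2) / frameA x y ((n : ℝ) / 2) =
        frameB (1 / 2) (Real.sqrt 3 / 2) ((n : ℝ) / 2) /
          frameA (1 / 2) (Real.sqrt 3 / 2) ((n : ℝ) / 2) ↔
      (x, y) = (1 / 2, Real.sqrt 3 / 2)) := by
  have hα : (1 : ℝ) ≤ (n : ℝ) / 2 := by
    rw [le_div_iff₀ two_pos]
    exact_mod_cast (by omega : 1 * 2 ≤ n)
  refine ⟨LatticeTheta.frameA_pos hxy hα, ?_⟩
  by_cases h : (x, y) = (1 / 2, Real.sqrt 3 / 2)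
  · obtain ⟨rfl, rfl⟩ := Prod.mk.inj h
    exact ⟨le_rfl, iff_of_true rfl rfl⟩
  · have hlt := LatticeTheta.frame_ratio_lt hxy hα h
    exact ⟨hlt.le, iff_of_false hlt.ne' h⟩
end

section
/- For every fixed α > 0, every y ≥ 1/√2, and every x ∈ (0,1/2), the partial derivatives with respect to x of the functions x ↦ θ_{x,y}(b(x,y);α) and x ↦ θ̂_{x,y}(b(x,y);α) (with y and α held fixed, and with the shift b(x,y) varying with x) are both strictly positive. -/
/-- The shifted lattice theta function `θ_{x,y}(z;α)`. -/
noncomputable def latticeTheta (x y : ℝ) (z : ℝ × ℝ) (α : ℝ) : ℝ :=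
  ∑' p : ℤ × ℤ,
    Real.exp (-(Real.pi * α / y) *
      (((p.1 : ℝ) + z.1) ^ 2 + 2 * x * ((p.1 : ℝ) + z.1) * ((p.2 : ℝ) + z.2) +
        (x ^ 2 + y ^ 2) * ((p.2 : ℝ) + z.2) ^ 2))

/-- The special shift `b(x,y)`. -/
noncomputable def bPoint (x y : ℝ) : ℝ × ℝ :=
  ((x + (1 - x) * 4 * y ^ 2) / (8 * y ^ 2), (4 * y ^ 2 - 1) / (8 * y ^ 2))

open Real in
lemma summable_pow_mul_gauss (k : ℕ) {t : ℝ} (ht : 0 < t) (b : ℝ) :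
    Summable fun n : ℤ => |(n : ℝ)| ^ k * exp (-t * (n - b) ^ 2) := by
  have h := (summable_pow_mul_jacobiTheta₂_term_bound (t * |b| / π) (div_pos ht pi_pos) k)
  refine Summable.of_nonneg_of_le (fun n => by positivity) (fun n => ?_) h
  push_cast
  refine mul_le_mul_of_nonneg_left (Real.exp_le_exp.mpr ?_) (by positivity)
  have e : -π * (t / π * (n : ℝ) ^ 2 - 2 * (t * |b| / π) * |(n : ℝ)|)
      = -t * n ^ 2 + 2 * t * (|b| * |(n : ℝ)|) := by
    field_simp; ring
  rw [e, ← abs_mul]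
  nlinarith [le_abs_self (b * (n : ℝ)), mul_nonneg ht.le (sq_nonneg b),
    mul_le_mul_of_nonneg_left (le_abs_self (b * (n : ℝ))) ht.le]

section
open Complex

lemma jacobiTheta₂_term_gauss (t b v : ℝ) (n : ℤ) :
    jacobiTheta₂_term n (v - I * (t * b / Real.pi)) (I * (t / Real.pi)) =
      (Real.exp (t * b ^ 2) * Real.exp (-t * (n - b) ^ 2) : ℝ) *
        cexp ((2 * Real.pi * n * v : ℝ) * I) := by
  have hpi : (Real.pi : ℂ) ≠ 0 := by exact_mod_cast Real.pi_ne_zero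
  rw [jacobiTheta₂_term, ← Real.exp_add, ofReal_exp, ← Complex.exp_add]
  congr 1
  push_cast
  field_simp
  ring_nf
  simp only [I_sq]
  ring

lemma jacobiTheta₂_term_gauss_dual {t : ℝ} (ht : 0 < t) (b v : ℝ) (n : ℤ) :
    cexp (-Real.pi * I * (v - I * (t * b / Real.pi)) ^ 2 / (I * (t / Real.pi))) *
      jacobiTheta₂_term n ((v - I * (t * b / Real.pi)) / (I * (t / Real.pi)))
        (-1 / (I * (t / Real.pi))) =
      (Real.exp (t * b ^ 2) * Real.exp (-(Real.pi ^ 2 / t) * (v - n) ^ 2) : ℝ) *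
        cexp ((2 * Real.pi * b * (v - n) : ℝ) * I) := by
  have hpi : (Real.pi : ℂ) ≠ 0 := by exact_mod_cast Real.pi_ne_zero
  have htc : (t : ℂ) ≠ 0 := by exact_mod_cast ht.ne'
  rw [jacobiTheta₂_term, ← Real.exp_add, ofReal_exp, ← Complex.exp_add, ← Complex.exp_add]
  congr 1
  push_cast
  field_simp
  ring_nf
  simp only [I_sq]
  ring

lemma gauss_prefactor {t : ℝ} (ht : 0 < t) :
    1 / (-I * (I * ((t : ℂ) / Real.pi))) ^ (1 / 2 : ℂ) = (Real.sqrt (Real.pi / t) : ℝ) := by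
  have h : -I * (I * ((t : ℂ) / Real.pi)) = ((t / Real.pi : ℝ) : ℂ) := by
    push_cast
    rw [← mul_assoc, neg_mul, I_mul_I]; ring
  rw [h, show (1 / 2 : ℂ) = ((1 / 2 : ℝ) : ℂ) by norm_num,
    ← ofReal_cpow (div_pos ht Real.pi_pos).le, ← Real.sqrt_eq_rpow, ← ofReal_one, ← ofReal_div,
    ← inv_div t Real.pi, Real.sqrt_inv, one_div]

lemma gauss_tau_im {t : ℝ} (ht : 0 < t) : 0 < (I * ((t : ℂ) / Real.pi)).im := by
  rw [← ofReal_div, I_mul_im, ofReal_re]; exact div_pos ht Real.pi_pos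

lemma gauss_tau_im_dual {t : ℝ} (ht : 0 < t) : 0 < (-1 / (I * ((t : ℂ) / Real.pi))).im := by
  have h : (-1 / (I * ((t : ℂ) / Real.pi))) = I * ((Real.pi / t : ℝ) : ℂ) := by
    have hpi : (Real.pi : ℂ) ≠ 0 := by exact_mod_cast Real.pi_ne_zero
    have htc : (t : ℂ) ≠ 0 := by exact_mod_cast ht.ne'
    push_cast
    field_simp
    rw [I_sq]
  rw [h, I_mul_im, ofReal_re]; exact div_pos Real.pi_pos ht

/-- Poisson summation for a shifted, modulated Gaussian. -/
lemma tsum_gauss_mul_cos {t : ℝ} (ht : 0 < t) (b v : ℝ) :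
    ∑' n : ℤ, Real.exp (-t * (n - b) ^ 2) * Real.cos (2 * Real.pi * n * v) =
      Real.sqrt (Real.pi / t) * ∑' n : ℤ, Real.exp (-(Real.pi ^ 2 / t) * (v - n) ^ 2) *
        Real.cos (2 * Real.pi * b * (v - n)) := by
  have h1 := hasSum_re (hasSum_jacobiTheta₂_term (v - I * (t * b / Real.pi)) (gauss_tau_im ht))
  have h2 := hasSum_re (((hasSum_jacobiTheta₂_term
    ((v - I * (t * b / Real.pi)) / (I * (t / Real.pi))) (gauss_tau_im_dual ht)).mul_left
    (cexp (-Real.pi * I * (v - I * (t * b / Real.pi)) ^ 2 / (I * (t / Real.pi))))).mul_left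
    ((Real.sqrt (Real.pi / t) : ℝ) : ℂ))
  rw [← mul_assoc, ← gauss_prefactor ht, ← jacobiTheta₂_functional_equation,
    gauss_prefactor ht] at h2
  simp only [jacobiTheta₂_term_gauss] at h1
  simp only [jacobiTheta₂_term_gauss_dual ht, re_ofReal_mul, exp_ofReal_mul_I_re] at h1 h2
  have h3 := h1.tsum_eq.trans h2.tsum_eq.symm
  simp only [mul_assoc, tsum_mul_left] at h3 ⊢
  rw [mul_left_comm] at h3
  exact mul_left_cancel₀ (Real.exp_pos _).ne' h3

/-- Minus the derivative of the modulated Gaussian `exp (-σ u²) cos (φ u)`. -/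
noncomputable def gaussSlope (σ φ u : ℝ) : ℝ :=
  Real.exp (-σ * u ^ 2) * (2 * σ * u * Real.cos (φ * u) + φ * Real.sin (φ * u))

/-- The derivative of Poisson summation for a shifted, modulated Gaussian. -/
lemma hasSum_gaussSlope {t : ℝ} (ht : 0 < t) (b v : ℝ) :
    HasSum (fun n : ℤ => gaussSlope (Real.pi ^ 2 / t) (2 * Real.pi * b) (v - n))
      (2 * Real.pi / Real.sqrt (Real.pi / t) *
        ∑' n : ℤ, n * Real.exp (-t * (n - b) ^ 2) * Real.sin (2 * Real.pi * n * v)) := by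
  have hpi : (Real.pi : ℂ) ≠ 0 := by exact_mod_cast Real.pi_ne_zero
  have htc : (t : ℂ) ≠ 0 := by exact_mod_cast ht.ne'
  set τ : ℂ := I * (t / Real.pi) with hτ
  set z : ℂ := v - I * (t * b / Real.pi) with hz
  have him : 0 < τ.im := gauss_tau_im ht
  have him' : 0 < (-1 / τ).im := gauss_tau_im_dual ht
  have h0 : jacobiTheta₂' z τ = (Real.sqrt (Real.pi / t) : ℝ) *
      (cexp (-Real.pi * I * z ^ 2 / τ) / τ * (jacobiTheta₂' (z / τ) (-1 / τ) -
        2 * Real.pi * I * z * jacobiTheta₂ (z / τ) (-1 / τ))) := by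
    rw [jacobiTheta₂'_functional_equation, ← gauss_prefactor ht, hτ]
    ring
  have h1 := hasSum_re (hasSum_jacobiTheta₂'_term z him)
  have h2 := hasSum_re ((((hasSum_jacobiTheta₂'_term (z / τ) him').sub
    ((hasSum_jacobiTheta₂_term (z / τ) him').mul_left
      (2 * Real.pi * I * z))).mul_left (cexp (-Real.pi * I * z ^ 2 / τ) / τ)).mul_left
    ((Real.sqrt (Real.pi / t) : ℝ) : ℂ))
  rw [← h0] at h2
  have e1 : ∀ n : ℤ, (jacobiTheta₂'_term n z τ).re = -2 * Real.pi * Real.exp (t * b ^ 2) *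
      (n * Real.exp (-t * (n - b) ^ 2) * Real.sin (2 * Real.pi * n * v)) := by
    intro n
    rw [jacobiTheta₂'_term, jacobiTheta₂_term_gauss, show 2 * (Real.pi : ℂ) * I * n *
      ((Real.exp (t * b ^ 2) * Real.exp (-t * (n - b) ^ 2) : ℝ) *
        cexp ((2 * Real.pi * n * v : ℝ) * I)) =
      ((2 * Real.pi * n * (Real.exp (t * b ^ 2) * Real.exp (-t * (n - b) ^ 2)) : ℝ) : ℂ) *
      (I * cexp ((2 * Real.pi * n * v : ℝ) * I)) by push_cast; ring, re_ofReal_mul, I_mul_re,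
      exp_ofReal_mul_I_im]
    ring
  have e2 : ∀ n : ℤ, ((Real.sqrt (Real.pi / t) : ℝ) * (cexp (-Real.pi * I * z ^ 2 / τ) / τ *
      (jacobiTheta₂'_term n (z / τ) (-1 / τ) -
        2 * Real.pi * I * z * jacobiTheta₂_term n (z / τ) (-1 / τ)))).re =
      -Real.exp (t * b ^ 2) * Real.sqrt (Real.pi / t) *
        gaussSlope (Real.pi ^ 2 / t) (2 * Real.pi * b) (v - n) := by
    intro n
    have e3 : cexp (-Real.pi * I * z ^ 2 / τ) / τ * (jacobiTheta₂'_term n (z / τ) (-1 / τ) -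
        2 * Real.pi * I * z * jacobiTheta₂_term n (z / τ) (-1 / τ)) =
        ((2 * Real.pi ^ 2 / t * (Real.exp (t * b ^ 2) *
          Real.exp (-(Real.pi ^ 2 / t) * (v - n) ^ 2)) : ℝ) : ℂ) *
        ((((n - v : ℝ) : ℂ) + I * (t * b / Real.pi : ℝ)) *
          cexp ((2 * Real.pi * b * (v - n) : ℝ) * I)) := by
      have e4 : (2 * Real.pi ^ 2 / t : ℂ) = 2 * Real.pi * I / τ := by
        rw [hτ]; field_simp
      have e5 := jacobiTheta₂_term_gauss_dual ht b v n
      rw [← hτ, ← hz] at e5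
      rw [ofReal_mul, mul_mul_mul_comm, ← e5, jacobiTheta₂'_term]
      push_cast
      rw [e4, hz]
      ring
    rw [e3, re_ofReal_mul, re_ofReal_mul, mul_re, exp_ofReal_mul_I_re, exp_ofReal_mul_I_im,
      gaussSlope]
    simp only [add_re, add_im, ofReal_re, ofReal_im, I_mul_re, I_mul_im]
    field_simp
    ring
  simp only [e1] at h1
  simp only [e2] at h2
  have hs : 0 < Real.sqrt (Real.pi / t) := Real.sqrt_pos.mpr (div_pos Real.pi_pos ht)
  have hE := Real.exp_pos (t * b ^ 2)
  have h3 := h2.mul_left (-(Real.exp (t * b ^ 2) * Real.sqrt (Real.pi / t)))⁻¹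
  rw [← h1.tsum_eq, tsum_mul_left] at h3
  have h4 : ∀ x : ℝ, (-(Real.exp (t * b ^ 2) * Real.sqrt (Real.pi / t)))⁻¹ *
      (-Real.exp (t * b ^ 2) * Real.sqrt (Real.pi / t) * x) = x := fun x => by field_simp
  have h5 : ∀ x : ℝ, (-(Real.exp (t * b ^ 2) * Real.sqrt (Real.pi / t)))⁻¹ *
      (-2 * Real.pi * Real.exp (t * b ^ 2) * x) = 2 * Real.pi / Real.sqrt (Real.pi / t) * x :=
    fun x => by
      have hs' := hs.ne'
      generalize Real.sqrt (Real.pi / t) = r at hs'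
      field_simp
  simpa only [h4, h5] using h3
end

section
open Real

lemma gaussSlope_neg (σ φ u : ℝ) : gaussSlope σ φ (-u) = -gaussSlope σ φ u := by
  simp only [gaussSlope, mul_neg, sin_neg, cos_neg, even_two.neg_pow]
  ring

lemma hasDerivAt_gaussSlope (σ φ u : ℝ) :
    HasDerivAt (gaussSlope σ φ) (exp (-σ * u ^ 2) *
      ((2 * σ + φ ^ 2 - 4 * σ ^ 2 * u ^ 2) * cos (φ * u) - 4 * σ * φ * u * sin (φ * u))) u := by
  have h1 : HasDerivAt (fun u : ℝ => φ * u) φ u := by simpa using (hasDerivAt_id u).const_mul φ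
  have h2 : HasDerivAt (fun u : ℝ => 2 * σ * u) (2 * σ) u := by
    simpa using (hasDerivAt_id u).const_mul (2 * σ)
  have h3 : HasDerivAt (fun u : ℝ => -σ * u ^ 2) (-σ * (2 * u)) u := by
    simpa using (hasDerivAt_pow 2 u).const_mul (-σ)
  convert! h3.exp.mul ((h2.mul h1.cos).add (h1.sin.const_mul φ)) using 1
  simp only [Pi.add_apply, Pi.mul_apply]
  ring

lemma abs_deriv_gaussSlope_le {σ φ u : ℝ} (hσ : 12 ≤ σ) (hφ0 : 0 ≤ φ) (hφ : φ ≤ π)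
    (hu : 3 / 4 ≤ u) :
    |exp (-σ * u ^ 2) * ((2 * σ + φ ^ 2 - 4 * σ ^ 2 * u ^ 2) * cos (φ * u) -
      4 * σ * φ * u * sin (φ * u))| ≤ 9 * σ * exp (-(3 / 4 * σ * u ^ 2)) := by
  have hφ' : φ ≤ 3.15 := hφ.trans pi_lt_d2.le
  have hσu : 9 ≤ σ * u := by nlinarith
  have hc := abs_cos_le_one (φ * u)
  have hs := abs_sin_le_one (φ * u)
  have h1 : |(2 * σ + φ ^ 2 - 4 * σ ^ 2 * u ^ 2) * cos (φ * u) -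
      4 * σ * φ * u * sin (φ * u)| ≤ 6 * σ * (σ * u ^ 2) := by
    have hA : |2 * σ + φ ^ 2 - 4 * σ ^ 2 * u ^ 2| ≤ 2 * σ + φ ^ 2 + 4 * σ ^ 2 * u ^ 2 := by
      rw [abs_le]; constructor <;> nlinarith [sq_nonneg φ, sq_nonneg (σ * u)]
    calc _ ≤ |(2 * σ + φ ^ 2 - 4 * σ ^ 2 * u ^ 2)| * |cos (φ * u)| +
          |4 * σ * φ * u| * |sin (φ * u)| := by
          rw [← abs_mul, ← abs_mul]; exact abs_sub _ _
      _ ≤ (2 * σ + φ ^ 2 + 4 * σ ^ 2 * u ^ 2) * 1 + |4 * σ * φ * u| * 1 := by gcongr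
      _ = 2 * σ + φ ^ 2 + 4 * σ ^ 2 * u ^ 2 + 4 * (σ * u) * φ := by
          rw [abs_of_nonneg (by positivity)]; ring
      _ ≤ _ := by
          have e1 : 2 * σ ≤ 2 * σ * (σ * u ^ 2 / 6.75) := by
            have : 1 ≤ σ * u ^ 2 / 6.75 := by rw [le_div_iff₀ (by norm_num)]; nlinarith
            nlinarith
          have e2 : φ ^ 2 ≤ 0.123 * (σ * u) ^ 2 := by nlinarith
          have e3 : 4 * (σ * u) * φ ≤ 1.4 * (σ * u) ^ 2 := by nlinarith
          nlinarith
  have h2 : σ * u ^ 2 ≤ 3 / 2 * exp (σ * u ^ 2 / 4) := by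
    have h3 := add_one_le_exp (σ * u ^ 2 / 4 - 1)
    rw [exp_sub, le_div_iff₀ (exp_pos 1)] at h3
    nlinarith [exp_one_gt_d9, exp_pos (σ * u ^ 2 / 4), mul_nonneg (by linarith : 0 ≤ σ) (sq_nonneg u)]
  rw [abs_mul, abs_of_pos (exp_pos _)]
  calc _ ≤ exp (-σ * u ^ 2) * (6 * σ * (3 / 2 * exp (σ * u ^ 2 / 4))) := by
        gcongr
        exact h1.trans (by gcongr)
    _ = 9 * σ * (exp (-σ * u ^ 2) * exp (σ * u ^ 2 / 4)) := by ring
    _ = _ := by rw [← exp_add]; ring_nf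

lemma abs_gaussSlope_sub_le {σ φ a c : ℝ} (hσ : 12 ≤ σ) (hφ0 : 0 ≤ φ) (hφ : φ ≤ π)
    (ha : 3 / 4 ≤ a) (hac : a ≤ c) :
    |gaussSlope σ φ c - gaussSlope σ φ a| ≤ 9 * σ * exp (-(3 / 4 * σ * a ^ 2)) * (c - a) := by
  have h := (convex_Ici a).norm_image_sub_le_of_norm_hasDerivWithin_le
    (f := gaussSlope σ φ) (C := 9 * σ * exp (-(3 / 4 * σ * a ^ 2)))
    (fun u _ => (hasDerivAt_gaussSlope σ φ u).hasDerivWithinAt) (fun u hu => ?_)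
    (Set.mem_Ici.mpr le_rfl) (Set.mem_Ici.mpr hac)
  · rwa [norm_eq_abs, norm_eq_abs, abs_of_nonneg (sub_nonneg.mpr hac)] at h
  · have hu' : a ≤ u := hu
    refine (abs_deriv_gaussSlope_le hσ hφ0 hφ (ha.trans hu')).trans ?_
    gcongr

lemma HasSum.sub_le_of_geometric_tail {F : ℕ → ℝ} {S C : ℝ} (h : HasSum F S)
    (hF : ∀ j, |F (j + 1)| ≤ C * (1 / 2) ^ j) : F 0 - 2 * C ≤ S := by
  have h1 : HasSum (fun j => F (j + 1)) (S - F 0) := by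
    simpa using (hasSum_nat_add_iff' 1).mpr h
  have h2 : HasSum (fun j : ℕ => -(C * (1 / 2 : ℝ) ^ j)) (-(C * 2)) :=
    (hasSum_geometric_two.mul_left C).neg
  have h3 := hasSum_le (fun j => neg_le_of_abs_le (hF j)) h2 h1
  linarith

lemma exp_quadratic_le_geometric {σ β a : ℝ} (hσ : 12 ≤ σ) (hβ : 3 / 4 ≤ β) (j : ℕ)
    (ha : j + β ≤ a) :
    exp (-(3 / 4 * σ * a ^ 2)) ≤ exp (-(3 / 4 * σ * β ^ 2)) * (1 / 2) ^ j := by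
  have hj : (0 : ℝ) ≤ j := j.cast_nonneg
  have h1 : exp (-(j : ℝ)) ≤ (1 / 2) ^ j := by
    rw [show -(j : ℝ) = j * (-1) by ring, exp_nat_mul]
    gcongr
    rw [exp_neg, one_div]
    exact inv_anti₀ (by norm_num) (by linarith [exp_one_gt_d9])
  calc _ ≤ exp (-(3 / 4 * σ * β ^ 2) + -(j : ℝ)) := by
        apply exp_le_exp.mpr
        have h2 : (j + β) ^ 2 ≤ a ^ 2 := by gcongr
        have h3 : β ^ 2 + 3 / 2 * j ≤ a ^ 2 := by nlinarith
        nlinarith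
    _ ≤ _ := by rw [exp_add]; gcongr

lemma reflected_slope_algebra {σ φ w c1 s1 cw sw S C : ℝ} (hσ : 12 ≤ σ) (hφ0 : 0 ≤ φ)
    (hw0 : 0 ≤ w) (hw : w ≤ 1 / 4) (hc1 : 0 ≤ c1) (hc1' : c1 ≤ 1) (hs1 : 0 ≤ s1)
    (hcw : 0.7 ≤ cw) (hsw : 0 ≤ sw) (hsφ : 2 * s1 ≤ φ) (htan : φ * c1 ≤ 2 * s1)
    (hsq : s1 ^ 2 + c1 ^ 2 = 1) (hS0 : 0 ≤ S) (hSC : S ≤ C) (hC1 : 1 ≤ C)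
    (hS3 : 3 * w * C ≤ S) :
    8 * w ≤ c1 * (2 * σ * cw * (S - 2 * w * C)) - 2 * φ * c1 * sw * C +
      s1 * sw * (2 * σ * C - 4 * σ * w * S) + s1 * (2 * φ * cw * S) := by
  have m1 : 16.8 * (c1 * (w * C)) ≤ c1 * (2 * σ * cw * (S - 2 * w * C)) := by
    have a1 : w * C ≤ S - 2 * w * C := by linarith
    have a2 : 16.8 ≤ 2 * σ * cw := by nlinarith
    have : 16.8 * (w * C) ≤ 2 * σ * cw * (S - 2 * w * C) := by gcongr
    nlinarith
  have m2 : 2 * φ * c1 * sw * C ≤ s1 * sw * (2 * σ * C - 4 * σ * w * S) := by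
    have a1 : 4 * σ * w * S ≤ σ * C := by
      have : 4 * w * S ≤ 1 * C := by gcongr; linarith
      nlinarith
    have a2 : 4 * C ≤ 2 * σ * C - 4 * σ * w * S := by nlinarith
    calc 2 * φ * c1 * sw * C = 2 * (φ * c1) * (sw * C) := by ring
      _ ≤ 2 * (2 * s1) * (sw * C) := by gcongr
      _ = s1 * sw * (4 * C) := by ring
      _ ≤ _ := mul_le_mul_of_nonneg_left a2 (mul_nonneg hs1 hsw)
  have m3 : 8.4 * (s1 ^ 2 * (w * C)) ≤ s1 * (2 * φ * cw * S) := by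
    calc 8.4 * (s1 ^ 2 * (w * C)) = s1 * (2 * (2 * s1) * 0.7 * (3 * w * C)) := by ring
      _ ≤ s1 * (2 * φ * cw * S) := by gcongr
  have a1 : w ≤ w * C := le_mul_of_one_le_right hw0 hC1
  have a2 : w * C ≤ (c1 + s1 ^ 2) * (w * C) :=
    le_mul_of_one_le_left (hw0.trans a1) (by nlinarith)
  have a3 : 0 ≤ c1 * (w * C) := mul_nonneg hc1 (hw0.trans a1)
  linarith

lemma gaussSlope_sub_reflect_lower {σ φ w : ℝ} (hσ : 12 ≤ σ) (hφ0 : 0 ≤ φ) (hφ : φ ≤ π)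
    (hw0 : 0 ≤ w) (hw : w ≤ 1 / 4) :
    exp (-(5 / 16 * σ)) * (8 * w) ≤
      gaussSlope σ φ (1 / 2 - w) - gaussSlope σ φ (1 / 2 + w) := by
  have hc1 : 0 ≤ cos (φ / 2) := cos_nonneg_of_mem_Icc ⟨by linarith [pi_pos], by linarith⟩
  have hs1 : 0 ≤ sin (φ / 2) := sin_nonneg_of_nonneg_of_le_pi (by linarith) (by linarith [pi_pos])
  have hφw : φ * w ≤ π / 4 := by nlinarith [pi_pos]
  have hcw : 0.7 ≤ cos (φ * w) := by
    have : cos (π / 4) ≤ cos (φ * w) :=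
      cos_le_cos_of_nonneg_of_le_pi (by positivity) (by linarith [pi_pos]) hφw
    rw [cos_pi_div_four] at this
    have h2 : (1.4 : ℝ) ≤ √2 := le_sqrt_of_sq_le (by norm_num)
    linarith
  have hsw : 0 ≤ sin (φ * w) :=
    sin_nonneg_of_nonneg_of_le_pi (by positivity) (by linarith [pi_pos])
  have hsφ : 2 * sin (φ / 2) ≤ φ := by linarith [sin_le (by linarith : 0 ≤ φ / 2)]
  have htan : φ * cos (φ / 2) ≤ 2 * sin (φ / 2) := by
    rcases hφ.eq_or_lt with h | h
    · rw [h, cos_pi_div_two, sin_pi_div_two]; norm_num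
    · have h2 := le_tan (by linarith : 0 ≤ φ / 2) (by linarith)
      rw [tan_eq_sin_div_cos, le_div_iff₀
        (cos_pos_of_mem_Ioo ⟨by linarith [pi_pos], by linarith⟩)] at h2
      linarith
  have hsq := sin_sq_add_cos_sq (φ / 2)
  set c1 := cos (φ / 2)
  set s1 := sin (φ / 2)
  set cw := cos (φ * w)
  set sw := sin (φ * w)
  set S := (exp (σ * w) - exp (-(σ * w))) / 2 with hS
  set C := (exp (σ * w) + exp (-(σ * w))) / 2 with hC
  have hS0 : 0 ≤ S := by
    have : exp (-(σ * w)) ≤ exp (σ * w) := exp_le_exp.mpr (by nlinarith)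
    linarith
  have hSC : S ≤ C := by linarith [exp_pos (-(σ * w))]
  have hC1 : 1 ≤ C := by
    linarith [add_one_le_exp (σ * w), add_one_le_exp (-(σ * w))]
  have hS3 : 3 * w * C ≤ S := by
    have h1 : exp (σ * w) = exp (-(σ * w)) * exp (2 * (σ * w)) := by rw [← exp_add]; ring_nf
    have h2 := add_one_le_exp (2 * (σ * w))
    have h3 : 0 ≤ exp (2 * (σ * w)) * (1 - 3 * w) - (1 + 3 * w) := by
      have : (2 * (σ * w) + 1) * (1 - 3 * w) ≤ exp (2 * (σ * w)) * (1 - 3 * w) :=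
        mul_le_mul_of_nonneg_right h2 (by linarith)
      have : 3 ≤ σ * (1 - 3 * w) := by nlinarith
      nlinarith
    have h4 := mul_nonneg (exp_pos (-(σ * w))).le h3
    rw [hS, hC, h1]
    nlinarith
  have key : gaussSlope σ φ (1 / 2 - w) - gaussSlope σ φ (1 / 2 + w) =
      exp (-σ * (1 / 4 + w ^ 2)) * (c1 * (2 * σ * cw * (S - 2 * w * C)) - 2 * φ * c1 * sw * C +
        s1 * sw * (2 * σ * C - 4 * σ * w * S) + s1 * (2 * φ * cw * S)) := by
    rw [gaussSlope, gaussSlope, show φ * (1 / 2 - w) = φ / 2 - φ * w by ring,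
      show φ * (1 / 2 + w) = φ / 2 + φ * w by ring, cos_sub, cos_add, sin_sub, sin_add,
      show -σ * (1 / 2 - w) ^ 2 = -σ * (1 / 4 + w ^ 2) + σ * w by ring,
      show -σ * (1 / 2 + w) ^ 2 = -σ * (1 / 4 + w ^ 2) + -(σ * w) by ring, exp_add, exp_add, hS, hC]
    ring
  have hc1' : c1 ≤ 1 := cos_le_one _
  clear_value c1 s1 cw sw S C
  rw [key, show -(5 / 16 * σ) = -σ * (1 / 4 + (1 / 4) ^ 2) by ring]
  have hexp : exp (-σ * (1 / 4 + (1 / 4) ^ 2)) ≤ exp (-σ * (1 / 4 + w ^ 2)) := by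
    apply exp_le_exp.mpr
    have : w ^ 2 ≤ (1 / 4) ^ 2 := by gcongr
    nlinarith
  exact mul_le_mul hexp (reflected_slope_algebra hσ hφ0 hw0 hw hc1 hc1' hs1 hcw hsw hsφ htan hsq
    hS0 hSC hC1 hS3) (by positivity) (exp_pos _).le

lemma sin_two_pi_le {v : ℝ} (hv : 0 ≤ v) : sin (2 * π * v) ≤ 6.3 * v :=
  (sin_le (by positivity)).trans (by nlinarith [pi_lt_d2])

/-- A Gaussian-side lower bound for the periodized slope. -/
lemma hasSum_gaussSlope_lower {σ φ v S : ℝ} (hσ : 12 ≤ σ) (hφ0 : 0 ≤ φ) (hφ : φ ≤ π)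
    (hv0 : 0 < v) (hv : v < 1 / 2)
    (h : HasSum (fun n : ℤ => gaussSlope σ φ (v - n)) S) :
    exp (-σ / 2) * sin (2 * π * v) ≤ S := by
  rcases le_total v (1 / 4) with hv4 | hv4
  · have h1 := h.nat_add_neg.sub_le_of_geometric_tail
      (C := 18 * σ * v * exp (-(3 / 4 * σ * (3 / 4) ^ 2))) (fun j => ?_)
    · have hp : exp (-(σ / 16)) * (1.4 * σ * v) ≤ gaussSlope σ φ v := by
        have hφv : φ * v ≤ π / 4 := by nlinarith [pi_pos]
        have hc : 0.7 ≤ cos (φ * v) := by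
          have : cos (π / 4) ≤ cos (φ * v) :=
            cos_le_cos_of_nonneg_of_le_pi (by positivity) (by linarith [pi_pos]) hφv
          rw [cos_pi_div_four] at this
          have h2 : (1.4 : ℝ) ≤ √2 := le_sqrt_of_sq_le (by norm_num)
          linarith
        have hs : 0 ≤ sin (φ * v) :=
          sin_nonneg_of_nonneg_of_le_pi (by positivity) (by linarith [pi_pos])
        rw [gaussSlope]
        have hv2 : σ * v ^ 2 ≤ σ * (1 / 16) := by gcongr; nlinarith
        have a1 : 1.4 * σ * v ≤ 2 * σ * v * cos (φ * v) + φ * sin (φ * v) := by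
          have : 0 ≤ φ * sin (φ * v) := by positivity
          have : 0 ≤ σ * v := by positivity
          nlinarith
        gcongr
        linarith
      simp only [Nat.cast_zero, Int.cast_zero, neg_zero, sub_zero] at h1
      have e1 : 54 * exp (-(3 / 4 * σ * (3 / 4) ^ 2)) ≤ exp (-(σ / 16)) := by
        have a : (54 : ℝ) ≤ exp 4 := by
          have : exp 4 = exp 1 ^ 4 := by rw [← exp_nat_mul]; norm_num
          rw [this]
          calc (54 : ℝ) ≤ 2.718 ^ 4 := by norm_num
            _ ≤ _ := by gcongr; linarith [exp_one_gt_d9]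
        calc _ ≤ exp 4 * exp (-(3 / 4 * σ * (3 / 4) ^ 2)) := by gcongr
          _ ≤ _ := by rw [← exp_add]; apply exp_le_exp.mpr; linarith
      have e2 : exp (-σ / 2) ≤ exp (-(σ / 16)) := exp_le_exp.mpr (by linarith)
      have hsv : 0 < σ * v := by positivity
      have e3 : exp (-σ / 2) * sin (2 * π * v) ≤ exp (-(σ / 16)) * (6.3 * v) :=
        (mul_le_mul_of_nonneg_left (sin_two_pi_le hv0.le) (exp_pos _).le).trans
          (mul_le_mul_of_nonneg_right e2 (by positivity))
      have e4 := mul_le_mul_of_nonneg_left e1 hsv.le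
      have e5 : exp (-(σ / 16)) * (6.3 * v) ≤ exp (-(σ / 16)) * (0.6 * (σ * v)) :=
        mul_le_mul_of_nonneg_left (by nlinarith) (exp_pos _).le
      have e6 : 0 < exp (-(σ / 16)) * (σ * v) := mul_pos (exp_pos _) hsv
      linarith
    · have h2 := abs_gaussSlope_sub_le (a := j + 1 - v) (c := j + 1 + v) hσ hφ0 hφ
        (by linarith [j.cast_nonneg (α := ℝ)]) (by linarith)
      have h3 := exp_quadratic_le_geometric (a := j + 1 - v) hσ le_rfl j (by linarith)
      push_cast
      rw [show v - -((j : ℝ) + 1) = j + 1 + v by ring,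
        show v - ((j : ℝ) + 1) = -(j + 1 - v) by ring, gaussSlope_neg, neg_add_eq_sub]
      refine h2.trans ?_
      calc _ ≤ 9 * σ * (exp (-(3 / 4 * σ * (3 / 4) ^ 2)) * (1 / 2) ^ j) *
            (j + 1 + v - (j + 1 - v)) := by gcongr; linarith
        _ = _ := by ring
  · have hr : HasSum (fun n : ℤ => gaussSlope σ φ (v + n)) S := by
      have := (Equiv.neg ℤ).hasSum_iff.mpr h
      simpa [Function.comp_def] using this
    have h1 := hr.nat_add_neg_add_one.sub_le_of_geometric_tail
      (C := 9 * σ * (1 - 2 * v) * exp (-(3 / 4 * σ * (5 / 4) ^ 2))) (fun j => ?_)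
    · have hp := gaussSlope_sub_reflect_lower (w := 1 / 2 - v) hσ hφ0 hφ (by linarith)
        (by linarith)
      simp only [Nat.cast_zero, Int.cast_zero, zero_add, add_zero, Int.cast_neg,
        Int.cast_one] at h1
      rw [show (1 / 2 - (1 / 2 - v)) = v by ring,
        show (1 / 2 + (1 / 2 - v)) = -(v + -1) by ring, gaussSlope_neg, sub_neg_eq_add] at hp
      have e2 : exp (-σ / 2) ≤ exp (-(5 / 16 * σ)) := exp_le_exp.mpr (by linarith)
      have e6 : sin (2 * π * v) = sin (2 * π * (1 / 2 - v)) := by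
        rw [← sin_pi_sub]; ring_nf
      have e3 : exp (-σ / 2) * sin (2 * π * v) ≤ exp (-(5 / 16 * σ)) * (6.3 * (1 / 2 - v)) := by
        rw [e6]
        exact (mul_le_mul_of_nonneg_left (sin_two_pi_le (by linarith)) (exp_pos _).le).trans
          (mul_le_mul_of_nonneg_right e2 (by linarith))
      have e4 : 36 * σ * exp (-(3 / 4 * σ * (5 / 4) ^ 2)) ≤ 1.7 * exp (-(5 / 16 * σ)) := by
        have b1 := add_one_le_exp (σ / 4 - 1)
        have b2 : σ ≤ 4 * exp (σ / 4 - 1) := by linarith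
        have b3 : (36 * 4 : ℝ) / 1.7 ≤ exp 6 := by
          have : exp 6 = exp 1 ^ 6 := by rw [← exp_nat_mul]; norm_num
          rw [this]
          calc _ ≤ (2.7 : ℝ) ^ 6 := by norm_num
            _ ≤ _ := by gcongr; linarith [exp_one_gt_d9]
        calc _ ≤ 36 * (4 * exp (σ / 4 - 1)) * exp (-(3 / 4 * σ * (5 / 4) ^ 2)) := by gcongr
          _ = 1.7 * (36 * 4 / 1.7 * (exp (σ / 4 - 1) * exp (-(3 / 4 * σ * (5 / 4) ^ 2)))) := by ring
          _ ≤ 1.7 * (exp 6 * (exp (σ / 4 - 1) * exp (-(3 / 4 * σ * (5 / 4) ^ 2)))) := by gcongr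
          _ ≤ _ := by
            rw [← exp_add, ← exp_add]
            gcongr
            linarith
      have e5 := mul_le_mul_of_nonneg_right e4 (by linarith : 0 ≤ 1 / 2 - v)
      linarith
    · have h2 := abs_gaussSlope_sub_le (a := v + (j + 1)) (c := j + 2 - v) hσ hφ0 hφ
        (by linarith [j.cast_nonneg (α := ℝ)]) (by linarith)
      have h3 := exp_quadratic_le_geometric (β := 5 / 4) (a := v + (j + 1)) hσ (by norm_num) j
        (by linarith)
      push_cast
      rw [show v + -((j : ℝ) + 1 + 1) = -(j + 2 - v) by ring, gaussSlope_neg,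
        ← sub_eq_add_neg, abs_sub_comm]
      refine h2.trans ?_
      calc _ ≤ 9 * σ * (exp (-(3 / 4 * σ * (5 / 4) ^ 2)) * (1 / 2) ^ j) *
            (j + 2 - v - (v + (j + 1))) := by gcongr; linarith
        _ = _ := by ring

lemma abs_sin_nat_mul_le (n : ℕ) (θ : ℝ) : |sin (n * θ)| ≤ n * |sin θ| := by
  induction n with
  | zero => simp
  | succ n ih =>
    rw [Nat.cast_succ, add_one_mul, sin_add]
    refine (abs_add_le _ _).trans ?_
    rw [abs_mul, abs_mul]
    nlinarith [abs_cos_le_one θ, abs_cos_le_one (n * θ), abs_nonneg (sin θ), abs_nonneg (sin (n * θ))]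

lemma abs_sine_series_term_le (p : ℕ → ℝ) (v : ℝ) (n : ℕ) :
    |n * p n * sin (2 * π * n * v)| ≤ (n : ℝ) ^ 2 * |p n| * |sin (2 * π * v)| := by
  have := abs_sin_nat_mul_le n (2 * π * v)
  rw [abs_mul, abs_mul, Nat.abs_cast, show 2 * π * n * v = n * (2 * π * v) by ring]
  calc _ ≤ (n : ℝ) * |p n| * (n * |sin (2 * π * v)|) := by gcongr
    _ = _ := by ring

lemma summable_sine_series {p : ℕ → ℝ} (hp : Summable fun n : ℕ => (n : ℝ) ^ 2 * |p n|) (v : ℝ) :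
    Summable fun n : ℕ => n * p n * sin (2 * π * n * v) :=
  (hp.mul_right |sin (2 * π * v)|).of_norm_bounded fun n => abs_sine_series_term_le p v n

lemma abs_sine_series_le {p : ℕ → ℝ} (hp : Summable fun n : ℕ => (n : ℝ) ^ 2 * |p n|) (v : ℝ) :
    |∑' n : ℕ, n * p n * sin (2 * π * n * v)| ≤
      (∑' n : ℕ, (n : ℝ) ^ 2 * |p n|) * |sin (2 * π * v)| := by
  rw [← tsum_mul_right]
  exact tsum_of_norm_bounded (f := fun n : ℕ => n * p n * sin (2 * π * n * v))
    (hp.mul_right |sin (2 * π * v)|).hasSum fun n => abs_sine_series_term_le p v n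

lemma sine_series_lower {p : ℕ → ℝ} (hp : Summable fun n : ℕ => (n : ℝ) ^ 2 * |p n|) {v : ℝ}
    (hv : 0 ≤ sin (2 * π * v)) :
    (p 1 - ∑' n : ℕ, ((n + 2 : ℕ) : ℝ) ^ 2 * |p (n + 2)|) * sin (2 * π * v) ≤
      ∑' n : ℕ, n * p n * sin (2 * π * n * v) := by
  have hs := summable_sine_series hp v
  rw [← hs.sum_add_tsum_nat_add 2]
  have h2 : Summable fun n : ℕ => ((n + 2 : ℕ) : ℝ) ^ 2 * |p (n + 2)| :=
    (summable_nat_add_iff (f := fun n : ℕ => (n : ℝ) ^ 2 * |p n|) 2).mpr hp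
  have h3 := (abs_le.mp <| tsum_of_norm_bounded (f := fun n : ℕ => ((n + 2 : ℕ) : ℝ) * p (n + 2) *
    sin (2 * π * ((n + 2 : ℕ) : ℝ) * v)) (h2.mul_right |sin (2 * π * v)|).hasSum
    fun n => abs_sine_series_term_le p v (n + 2)).1
  rw [tsum_mul_right, abs_of_nonneg hv] at h3
  simp only [Finset.sum_range_succ, Finset.sum_range_zero, Nat.cast_zero, Nat.cast_one]
  simp only [zero_mul, zero_add, one_mul, mul_one]
  linarith

/-- Positivity of a bilinear sine series whose outer coefficients are dominated by the first. -/
lemma bilinear_sine_series_pos {p q : ℕ → ℝ} {x m : ℝ} (hx0 : 0 < x) (hx : x < 1 / 2)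
    (hp : Summable fun n : ℕ => (n : ℝ) ^ 2 * |p n|)
    (hq : Summable fun n : ℕ => (n : ℝ) ^ 2 * |q n|) (hq1 : 0 ≤ q 1)
    (hm : m * sin (2 * π * x) ≤ ∑' n : ℕ, n * p n * sin (2 * π * n * x))
    (hlt : (∑' n : ℕ, (n : ℝ) ^ 2 * |p n|) * ∑' n : ℕ, ((n + 2 : ℕ) : ℝ) ^ 2 * |q (n + 2)| <
      q 1 * m) :
    0 < ∑' l : ℕ, l * q l * ∑' n : ℕ, n * p n * sin (2 * π * n * (l * x)) := by
  have hsin : 0 < sin (2 * π * x) :=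
    sin_pos_of_pos_of_lt_pi (by positivity) (by nlinarith [pi_pos])
  set M := ∑' n : ℕ, (n : ℝ) ^ 2 * |p n|
  have hM : 0 ≤ M := tsum_nonneg fun n => by positivity
  set F : ℕ → ℝ := fun l => l * q l * ∑' n : ℕ, n * p n * sin (2 * π * n * (l * x)) with hF
  have hb : ∀ l : ℕ, ‖F l‖ ≤ (l : ℝ) ^ 2 * |q l| * (M * sin (2 * π * x)) := by
    intro l
    have h1 := abs_sine_series_le hp (l * x)
    have h2 := abs_sin_nat_mul_le l (2 * π * x)
    rw [abs_of_pos hsin] at h2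
    rw [show 2 * π * (l * x) = l * (2 * π * x) by ring] at h1
    rw [hF, norm_eq_abs, abs_mul, abs_mul, Nat.abs_cast]
    calc _ ≤ (l : ℝ) * |q l| * (M * (l * sin (2 * π * x))) := by
          gcongr; exact h1.trans (by gcongr)
      _ = _ := by ring
  have hS : Summable F := (hq.mul_right _).of_norm_bounded hb
  rw [← hS.sum_add_tsum_nat_add 2]
  have h2 : Summable fun n : ℕ => ((n + 2 : ℕ) : ℝ) ^ 2 * |q (n + 2)| :=
    (summable_nat_add_iff (f := fun n : ℕ => (n : ℝ) ^ 2 * |q n|) 2).mpr hq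
  have h3 := (abs_le.mp <| tsum_of_norm_bounded (f := fun n : ℕ => F (n + 2))
    (h2.mul_right (M * sin (2 * π * x))).hasSum fun n => hb (n + 2)).1
  rw [tsum_mul_right] at h3
  have h4 : q 1 * m * sin (2 * π * x) ≤ F 1 := by
    rw [hF]
    simp only [Nat.cast_one, one_mul]
    rw [mul_assoc]
    exact mul_le_mul_of_nonneg_left hm hq1
  have h5 : F 0 = 0 := by simp [hF]
  have h6 := mul_lt_mul_of_pos_right hlt hsin
  simp only [Finset.sum_range_succ, Finset.sum_range_zero, h5]
  linarith

lemma tsum_int_eq_tsum_nat_add_neg {f : ℤ → ℝ} (hf : Summable f) (h0 : f 0 = 0) :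
    ∑' n : ℤ, f n = ∑' n : ℕ, (f n + f (-n)) := by
  have := hf.hasSum.nat_add_neg.tsum_eq
  rw [h0, add_zero] at this
  exact this.symm

lemma summable_of_sq_mul_abs {P : ℤ → ℝ} (hP : Summable fun n : ℤ => (n : ℝ) ^ 2 * |P n|) :
    Summable fun n : ℤ => n * P n := by
  refine hP.of_norm_bounded fun n => ?_
  rw [norm_mul, norm_eq_abs, norm_eq_abs]
  gcongr
  rcases eq_or_ne n 0 with rfl | h
  · simp
  · have : (1 : ℝ) ≤ |(n : ℝ)| := by exact_mod_cast Int.one_le_abs h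
    rw [← sq_abs]
    nlinarith

lemma summable_nat_of_sq_mul_abs {P : ℤ → ℝ} (hP : Summable fun n : ℤ => (n : ℝ) ^ 2 * |P n|) :
    Summable fun n : ℕ => (n : ℝ) ^ 2 * |P n + P (-n)| := by
  refine (hP.hasSum.nat_add_neg.summable).of_norm_bounded fun n => ?_
  rw [norm_of_nonneg (by positivity)]
  push_cast
  have := abs_add_le (P n) (P (-n))
  nlinarith [sq_nonneg (n : ℝ)]

lemma tsum_int_sine_series {P : ℤ → ℝ} (hP : Summable fun n : ℤ => (n : ℝ) ^ 2 * |P n|) (v : ℝ) :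
    ∑' n : ℤ, n * P n * sin (2 * π * n * v) =
      ∑' n : ℕ, n * (P n + P (-n)) * sin (2 * π * n * v) := by
  rw [tsum_int_eq_tsum_nat_add_neg _ (by simp)]
  · refine tsum_congr fun n => ?_
    push_cast
    rw [show 2 * π * -(n : ℝ) * v = -(2 * π * n * v) by ring, sin_neg]
    ring
  · refine (summable_of_sq_mul_abs hP).norm.of_norm_bounded fun n => ?_
    rw [norm_mul (_ * _)]
    exact mul_le_of_le_one_right (norm_nonneg _) (abs_sin_le_one _)

lemma summable_prod_sine {P Q : ℤ → ℝ} (hP : Summable fun n : ℤ => (n : ℝ) ^ 2 * |P n|)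
    (hQ : Summable fun n : ℤ => (n : ℝ) ^ 2 * |Q n|) (x : ℝ) :
    Summable fun k : ℤ × ℤ => k.1 * P k.1 * (k.2 * Q k.2) * sin (2 * π * k.1 * (k.2 * x)) := by
  refine ((summable_of_sq_mul_abs hP).norm.mul_of_nonneg (summable_of_sq_mul_abs hQ).norm
    (fun _ => norm_nonneg _) fun _ => norm_nonneg _).of_norm_bounded fun k => ?_
  rw [← norm_mul, norm_mul (_ * _ * _)]
  exact mul_le_of_le_one_right (norm_nonneg _) (abs_sin_le_one _)

lemma tsum_prod_sine {P Q : ℤ → ℝ} (hP : Summable fun n : ℤ => (n : ℝ) ^ 2 * |P n|)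
    (hQ : Summable fun n : ℤ => (n : ℝ) ^ 2 * |Q n|) (x : ℝ) :
    ∑' k : ℤ × ℤ, k.1 * P k.1 * (k.2 * Q k.2) * sin (2 * π * k.1 * (k.2 * x)) =
      ∑' l : ℕ, l * (Q l + Q (-l)) *
        ∑' n : ℕ, n * (P n + P (-n)) * sin (2 * π * n * (l * x)) := by
  have hS := summable_prod_sine hP hQ x
  have hS' := (Equiv.prodComm ℤ ℤ).summable_iff.mpr hS
  rw [← (Equiv.prodComm ℤ ℤ).tsum_eq]
  refine hS'.tsum_prod.trans ?_
  have hin : ∀ l : ℤ, ∑' n : ℤ, n * P n * (l * Q l) * sin (2 * π * n * (l * x)) =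
      l * Q l * ∑' n : ℕ, n * (P n + P (-n)) * sin (2 * π * n * (l * x)) := by
    intro l
    rw [← tsum_int_sine_series hP, ← tsum_mul_left]
    exact tsum_congr fun n => by ring
  simp only [Function.comp_def, Equiv.prodComm_apply, Prod.fst_swap, Prod.snd_swap]
  simp_rw [hin]
  rw [tsum_int_eq_tsum_nat_add_neg _ (by simp)]
  · refine tsum_congr fun l => ?_
    have : ∑' n : ℕ, (n : ℝ) * (P n + P (-n)) * sin (2 * π * n * (((-l : ℤ) : ℝ) * x)) =
        -∑' n : ℕ, (n : ℝ) * (P n + P (-n)) * sin (2 * π * n * (l * x)) := by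
      rw [← tsum_neg]
      refine tsum_congr fun n => ?_
      push_cast
      rw [show 2 * π * (n : ℝ) * (-(l : ℝ) * x) = -(2 * π * n * (l * x)) by ring, sin_neg]
      ring
    rw [this]
    push_cast
    ring
  · have := hS'.prod
    simp only [Function.comp_def, Equiv.prodComm_apply, Prod.fst_swap, Prod.snd_swap, hin] at this
    exact this

lemma tsum_prod_sine_swap {P Q : ℤ → ℝ} (x : ℝ) :
    ∑' k : ℤ × ℤ, k.1 * P k.1 * (k.2 * Q k.2) * sin (2 * π * k.1 * (k.2 * x)) =
      ∑' k : ℤ × ℤ, k.1 * Q k.1 * (k.2 * P k.2) * sin (2 * π * k.1 * (k.2 * x)) := by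
  rw [← (Equiv.prodComm ℤ ℤ).tsum_eq]
  refine tsum_congr fun k => ?_
  simp only [Equiv.prodComm_apply, Prod.fst_swap, Prod.snd_swap]
  rw [show 2 * π * (k.2 : ℝ) * (k.1 * x) = 2 * π * k.1 * (k.2 * x) by ring]
  ring

/-- The combined Gaussian weight of the lattice points `n` and `-n`, centred at `b`. -/
noncomputable def gaussPair (t b : ℝ) (n : ℕ) : ℝ :=
  exp (-t * (n - b) ^ 2) + exp (-t * (n + b) ^ 2)

lemma gaussPair_pos (t b : ℝ) (n : ℕ) : 0 < gaussPair t b n := by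
  unfold gaussPair; positivity

lemma gaussPair_le {t b : ℝ} (ht : 0 ≤ t) (hb0 : 0 ≤ b) (hb : b ≤ 1 / 2) (j : ℕ) :
    gaussPair t b (j + 2) ≤ gaussPair t b 1 * exp (-t * ((j + 2) * (j + 1))) := by
  have hj : (0 : ℝ) ≤ j := j.cast_nonneg
  unfold gaussPair
  rw [add_mul, ← exp_add, ← exp_add]
  push_cast
  refine add_le_add (exp_le_exp.mpr ?_) (exp_le_exp.mpr ?_)
  · have h : (1 - b) ^ 2 + (j + 2) * (j + 1) ≤ ((j : ℝ) + 2 - b) ^ 2 := by nlinarith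
    nlinarith
  · have h : (1 + b) ^ 2 + (j + 2) * (j + 1) ≤ ((j : ℝ) + 2 + b) ^ 2 := by nlinarith
    nlinarith

lemma gaussPair_zero_le {s : ℝ} (hs : 0 ≤ s) (j : ℕ) :
    gaussPair s 0 (j + 2) ≤ gaussPair s 0 1 * exp (-s) * exp (-s * ((j + 2) * (j + 1))) := by
  have hj : (0 : ℝ) ≤ j := j.cast_nonneg
  unfold gaussPair
  rw [add_mul, add_mul, ← exp_add, ← exp_add, ← exp_add, ← exp_add]
  push_cast
  have h : 1 + 1 + (j + 2) * (j + 1) ≤ ((j : ℝ) + 2) ^ 2 := by nlinarith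
  refine add_le_add (exp_le_exp.mpr ?_) (exp_le_exp.mpr ?_) <;> nlinarith

lemma tsum_sq_mul_tail_le {f : ℕ → ℝ} {K τ : ℝ} (hτ : 0.8 ≤ τ) (hK : 0 ≤ K)
    (hf0 : ∀ j, 0 ≤ f j) (hf : ∀ j : ℕ, f (j + 2) ≤ K * exp (-τ * ((j + 2) * (j + 1)))) :
    ∑' j : ℕ, ((j + 2 : ℕ) : ℝ) ^ 2 * f (j + 2) ≤ 32 / 7 * exp (-2 * τ) * K := by
  have hg := (hasSum_geometric_of_lt_one (r := 1 / 8) (by norm_num) (by norm_num)).mul_left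
    (4 * exp (-2 * τ) * K)
  have := tsum_of_norm_bounded (f := fun j : ℕ => ((j + 2 : ℕ) : ℝ) ^ 2 * f (j + 2)) hg ?_
  · refine (le_norm_self _).trans (this.trans (le_of_eq ?_))
    norm_num
    ring
  intro j
  have hj : (0 : ℝ) ≤ j := j.cast_nonneg
  rw [norm_of_nonneg (mul_nonneg (sq_nonneg _) (hf0 _))]
  have h8 : exp (-(11 / 5 : ℝ)) ≤ 1 / 8 := by
    rw [exp_neg, one_div]
    refine inv_anti₀ (by norm_num) ?_
    have h : (8 : ℝ) ^ 5 ≤ exp (11 / 5) ^ 5 := by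
      rw [← exp_nat_mul]
      have : exp (((5 : ℕ) : ℝ) * (11 / 5)) = exp 1 ^ 11 := by rw [← exp_nat_mul]; norm_num
      rw [this]
      calc (8 : ℝ) ^ 5 ≤ 2.7 ^ 11 := by norm_num
        _ ≤ _ := by gcongr; linarith [exp_one_gt_d9]
    exact le_of_pow_le_pow_left₀ (by norm_num) (exp_pos _).le h
  have hjj : (j : ℝ) ≤ j ^ 2 := by
    rcases Nat.eq_zero_or_pos j with rfl | h
    · simp
    · have : (1 : ℝ) ≤ j := by exact_mod_cast h
      nlinarith
  have h1 : ((j : ℝ) + 2) ^ 2 ≤ 4 * exp j := by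
    have h := add_one_le_exp ((j : ℝ) / 2)
    have h' : exp (j : ℝ) = exp ((j : ℝ) / 2) ^ 2 := by rw [← exp_nat_mul]; push_cast; ring_nf
    rw [h']
    nlinarith
  push_cast
  calc ((j : ℝ) + 2) ^ 2 * f (j + 2)
      ≤ (4 * exp j) * (K * exp (-τ * ((j + 2) * (j + 1)))) := by
        gcongr
        · exact hf0 _
        · exact hf j
    _ = 4 * K * exp (j + -τ * ((j + 2) * (j + 1))) := by rw [exp_add]; ring
    _ ≤ 4 * K * exp (-2 * τ + j * -(11 / 5)) := by
        refine mul_le_mul_of_nonneg_left (exp_le_exp.mpr ?_) (by positivity)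
        have h2 : 4 * (j : ℝ) ≤ j ^ 2 + 3 * j := by linarith
        nlinarith
    _ = 4 * exp (-2 * τ) * K * exp (-(11 / 5)) ^ j := by rw [exp_add, exp_nat_mul]; ring
    _ ≤ _ := by gcongr

lemma tsum_sq_mul_gaussPair_le {t b : ℝ} (ht : 0 < t) (hb0 : 0 ≤ b) (hb : b < 1) :
    ∑' n : ℕ, (n : ℝ) ^ 2 * gaussPair t b n ≤ 8 / (t ^ 2 * (1 - b) ^ 4) := by
  have hb' : 0 < 1 - b := by linarith
  have := tsum_of_norm_bounded (f := fun n : ℕ => (n : ℝ) ^ 2 * gaussPair t b n)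
    (hasSum_zeta_two.mul_left (4 / (t ^ 2 * (1 - b) ^ 4))) ?_
  · refine (le_norm_self _).trans (this.trans ?_)
    have h : π ^ 2 / 6 ≤ 2 := by nlinarith [pi_lt_d2, pi_pos]
    calc _ ≤ 4 / (t ^ 2 * (1 - b) ^ 4) * 2 := by gcongr
      _ = _ := by ring
  intro n
  rw [norm_of_nonneg (mul_nonneg (sq_nonneg _) (gaussPair_pos t b n).le)]
  rcases Nat.eq_zero_or_pos n with rfl | hn
  · simp
  have hn1 : (1 : ℝ) ≤ n := by exact_mod_cast hn
  set X := t * ((1 - b) * n) ^ 2 with hX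
  have hX0 : 0 < X := by positivity
  have he : exp (-X) ≤ 2 / X ^ 2 := by
    rw [exp_neg, ← one_div, div_le_div_iff₀ (exp_pos _) (by positivity)]
    linarith [quadratic_le_exp_of_nonneg hX0.le]
  have h1 : exp (-t * (n - b) ^ 2) ≤ exp (-X) := by
    apply exp_le_exp.mpr
    have : ((1 - b) * n) ^ 2 ≤ (n - b) ^ 2 := by
      apply pow_le_pow_left₀ (by positivity); nlinarith
    rw [hX]; nlinarith
  have h2 : exp (-t * (n + b) ^ 2) ≤ exp (-X) := by
    apply exp_le_exp.mpr
    have : ((1 - b) * n) ^ 2 ≤ (n + b) ^ 2 := by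
      apply pow_le_pow_left₀ (by positivity); nlinarith
    rw [hX]; nlinarith
  calc (n : ℝ) ^ 2 * gaussPair t b n ≤ n ^ 2 * (2 / X ^ 2 + 2 / X ^ 2) := by
        unfold gaussPair; gcongr <;> linarith
    _ = _ := by rw [hX]; field_simp; ring

lemma gauss_sine_lower {t b v : ℝ} (ht : 0 < t) (hσ : 12 ≤ π ^ 2 / t) (hb0 : 0 ≤ b)
    (hb : b ≤ 1 / 2) (hv0 : 0 < v) (hv : v < 1 / 2) :
    exp (-(π ^ 2 / t) / 2) / 4 * sin (2 * π * v) ≤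
      ∑' n : ℤ, n * exp (-t * (n - b) ^ 2) * sin (2 * π * n * v) := by
  have h := hasSum_gaussSlope_lower hσ (by positivity) (by nlinarith [pi_pos]) hv0 hv
    (hasSum_gaussSlope ht b v)
  set G := ∑' n : ℤ, n * exp (-t * (n - b) ^ 2) * sin (2 * π * n * v)
  have hsq : (1.9 : ℝ) ≤ √(π / t) := by
    apply le_sqrt_of_sq_le
    have : π / t = π ^ 2 / t / π := by field_simp
    rw [this, le_div_iff₀ pi_pos]
    nlinarith [pi_lt_d2]
  have hsin : 0 ≤ sin (2 * π * v) :=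
    sin_nonneg_of_nonneg_of_le_pi (by positivity) (by nlinarith [pi_pos])
  have h0 : 0 ≤ exp (-(π ^ 2 / t) / 2) * sin (2 * π * v) := mul_nonneg (exp_pos _).le hsin
  have hpos : 0 < √(π / t) := by linarith
  rw [div_mul_eq_mul_div, le_div_iff₀ hpos] at h
  have h2 := mul_le_mul_of_nonneg_left hsq h0
  have hpi := pi_lt_d2
  have h3 : 0 ≤ G := by
    by_contra hneg
    nlinarith [pi_pos]
  nlinarith

lemma sq_lt_exp_half {σ : ℝ} (hσ : 12 ≤ σ) : 400 ≤ exp (σ / 2) ∧ 1.53 * σ ^ 2 < exp (σ / 2) := by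
  have h6 : (400 : ℝ) ≤ exp 6 := by
    have : exp 6 = exp 1 ^ 6 := by rw [← exp_nat_mul]; norm_num
    rw [this]
    calc (400 : ℝ) ≤ 2.718 ^ 6 := by norm_num
      _ ≤ _ := by gcongr; linarith [exp_one_gt_d9]
  have hq := quadratic_le_exp_of_nonneg (x := σ / 2 - 6) (by linarith)
  have he : exp (σ / 2) = exp 6 * exp (σ / 2 - 6) := by rw [← exp_add]; ring_nf
  have h := mul_le_mul h6 hq (by nlinarith) (exp_pos _).le
  rw [← he] at h
  constructor <;> nlinarith

/-- The alternating Gaussian coefficients. -/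
noncomputable def altGauss (s : ℝ) (n : ℤ) : ℝ := -cos (n * π) * exp (-s * (n : ℝ) ^ 2)

lemma abs_altGauss_pair (s : ℝ) (n : ℕ) :
    |altGauss s n + altGauss s (-n)| = gaussPair s 0 n := by
  have : altGauss s n + altGauss s (-n) = -cos ((n : ℤ) * π) * (2 * exp (-s * (n : ℝ) ^ 2)) := by
    unfold altGauss
    push_cast
    rw [neg_mul (n : ℝ) π, cos_neg, neg_sq]
    ring
  rw [this, abs_mul, abs_neg, abs_cos_int_mul_pi, one_mul, abs_of_pos (by positivity), gaussPair,
    sub_zero, add_zero]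
  ring

lemma altGauss_pair_one (s : ℝ) :
    altGauss s ((1 : ℕ) : ℤ) + altGauss s (-((1 : ℕ) : ℤ)) = gaussPair s 0 1 := by
  simp [altGauss, gaussPair]

lemma summable_sq_mul_gauss {t : ℝ} (ht : 0 < t) (b : ℝ) :
    Summable fun n : ℤ => (n : ℝ) ^ 2 * |exp (-t * (n - b) ^ 2)| := by
  simpa only [sq_abs, abs_exp] using summable_pow_mul_gauss 2 ht b

lemma summable_sq_mul_altGauss {s : ℝ} (hs : 0 < s) :
    Summable fun n : ℤ => (n : ℝ) ^ 2 * |altGauss s n| := by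
  have := summable_sq_mul_gauss hs 0
  simp only [sub_zero] at this
  refine this.congr fun n => ?_
  rw [altGauss, abs_mul, abs_neg, abs_cos_int_mul_pi, one_mul]

lemma altGauss_sine_lower {s v : ℝ} (hs : 0 < s) (hσ : 12 ≤ π ^ 2 / s) (hv0 : 0 < v)
    (hv : v < 1 / 2) :
    exp (-(π ^ 2 / s) / 2) / 4 * sin (2 * π * v) ≤
      ∑' n : ℤ, n * altGauss s n * sin (2 * π * n * v) := by
  have h := gauss_sine_lower (v := 1 / 2 - v) hs hσ le_rfl (by norm_num) (by linarith)
    (by linarith)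
  rw [show 2 * π * (1 / 2 - v) = π - 2 * π * v by ring, sin_pi_sub] at h
  refine h.trans (le_of_eq (tsum_congr fun n => ?_))
  rw [show 2 * π * n * (1 / 2 - v) = n * π - 2 * π * n * v by ring, sin_sub, sin_int_mul_pi,
    altGauss, sub_zero]
  ring

lemma gauss_bilinear_pos {s t b x : ℝ} (hs : 0 < s) (ht : 0 < t) (hst : π ^ 2 ≤ 2 * (s * t))
    (hb0 : 0 ≤ b) (hb : b ≤ 1 / 2) (hx0 : 0 < x) (hx : x < 1 / 2) :
    0 < ∑' k : ℤ × ℤ, k.1 * altGauss s k.1 * (k.2 * exp (-t * (k.2 - b) ^ 2)) *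
      sin (2 * π * k.1 * (k.2 * x)) := by
  set Q : ℤ → ℝ := fun l => exp (-t * (l - b) ^ 2) with hQdef
  have hP := summable_sq_mul_altGauss hs
  have hQ : Summable fun n : ℤ => (n : ℝ) ^ 2 * |Q n| := summable_sq_mul_gauss ht b
  have hPn := summable_nat_of_sq_mul_abs hP
  have hQn := summable_nat_of_sq_mul_abs hQ
  have hQpair : ∀ n : ℕ, Q n + Q (-n) = gaussPair t b n := by
    intro n
    simp only [hQdef, gaussPair]
    push_cast
    rw [show (-(n : ℝ) - b) ^ 2 = (n + b) ^ 2 by ring]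
  have hQabs : ∀ n : ℕ, |Q n + Q (-n)| = gaussPair t b n := fun n => by
    rw [hQpair, abs_of_pos (gaussPair_pos _ _ _)]
  have hsin : 0 < sin (2 * π * x) :=
    sin_pos_of_pos_of_lt_pi (by positivity) (by nlinarith [pi_pos])
  set p1 := gaussPair s 0 1
  set q1 := gaussPair t b 1
  have hp1 : 0 < p1 := gaussPair_pos _ _ _
  have hq1 : 0 < q1 := gaussPair_pos _ _ _
  have hpi : (9.8 : ℝ) ≤ π ^ 2 := by nlinarith [pi_gt_d2]
  have tailP : 0.8 ≤ s → ∑' n : ℕ, ((n + 2 : ℕ) : ℝ) ^ 2 *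
      |altGauss s (n + 2 : ℕ) + altGauss s (-(n + 2 : ℕ))| ≤ 32 / 7 * exp (-3 * s) * p1 := by
    intro h
    simp only [abs_altGauss_pair]
    refine (tsum_sq_mul_tail_le h (by positivity) (fun j => (gaussPair_pos s 0 j).le)
      (gaussPair_zero_le hs.le)).trans (le_of_eq ?_)
    rw [show -3 * s = -2 * s + -s by ring, exp_add]
    ring
  have tailQ : 0.8 ≤ t → ∑' n : ℕ, ((n + 2 : ℕ) : ℝ) ^ 2 *
      |Q (n + 2 : ℕ) + Q (-(n + 2 : ℕ))| ≤ 32 / 7 * exp (-2 * t) * q1 := by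
    intro h
    simp only [hQabs]
    exact tsum_sq_mul_tail_le h hq1.le (fun j => (gaussPair_pos t b j).le)
      (gaussPair_le ht.le hb0 hb)
  have hP1 := altGauss_pair_one s
  have hQ1 := hQpair 1
  rcases lt_or_ge s 0.8 with hs8 | hs8
  · -- the alternating factor is flat
    set σ := π ^ 2 / s with hσ
    have hσs : σ * s = π ^ 2 := by rw [hσ]; field_simp
    have hσ12 : 12 ≤ σ := by nlinarith
    have hσt : σ ≤ 2 * t := by
      rw [hσ, div_le_iff₀ hs]; linarith
    rw [tsum_prod_sine hP hQ]
    refine bilinear_sine_series_pos (m := exp (-σ / 2) / 4) hx0 hx hPn hQn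
      (by rw [hQ1]; exact hq1.le)
      (by rw [← tsum_int_sine_series hP]; exact altGauss_sine_lower hs hσ12 hx0 hx) ?_
    rw [hQ1]
    have hM := tsum_sq_mul_gaussPair_le (b := 0) hs le_rfl one_pos
    have hM' : 8 / (s ^ 2 * (1 - 0) ^ 4) ≤ σ ^ 2 / 12 := by
      rw [div_le_div_iff₀ (by positivity) (by norm_num)]
      have : σ ^ 2 * s ^ 2 = (π ^ 2) ^ 2 := by rw [← mul_pow, hσs]
      nlinarith
    obtain ⟨-, hexp⟩ := sq_lt_exp_half hσ12
    have hE : exp (-2 * t) ≤ exp (-σ) := exp_le_exp.mpr (by linarith)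
    have hE2 : exp (-σ / 2) = exp (σ / 2) * exp (-σ) := by rw [← exp_add]; ring_nf
    simp only [abs_altGauss_pair]
    calc _ ≤ σ ^ 2 / 12 * (32 / 7 * exp (-σ) * q1) := by
          refine mul_le_mul (hM.trans hM') ((tailQ (by linarith)).trans ?_)
            (tsum_nonneg fun n => by positivity) (by positivity)
          gcongr
      _ = q1 * (32 / 84 * σ ^ 2 * exp (-σ)) := by ring
      _ < q1 * (exp (-σ / 2) / 4) := by
          rw [hE2]
          have := mul_lt_mul_of_pos_right hexp (exp_pos (-σ))
          have h0 : 0 ≤ σ ^ 2 * exp (-σ) := by positivity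
          gcongr
          linarith
  rcases lt_or_ge t 0.8 with ht8 | ht8
  · -- the shifted factor is flat
    set σ := π ^ 2 / t with hσ
    have hσs : σ * t = π ^ 2 := by rw [hσ]; field_simp
    have hσ12 : 12 ≤ σ := by nlinarith
    have hσt : σ ≤ 2 * s := by
      rw [hσ, div_le_iff₀ ht]; linarith
    have hswap := tsum_prod_sine_swap (P := altGauss s) (Q := Q) x
    rw [hswap, tsum_prod_sine hQ hP]
    refine bilinear_sine_series_pos (m := exp (-σ / 2) / 4) hx0 hx hQn hPn
      (by rw [hP1]; exact hp1.le)
      (by rw [← tsum_int_sine_series hQ]; exact gauss_sine_lower ht hσ12 hb0 hb hx0 hx) ?_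
    rw [hP1]
    have hM := tsum_sq_mul_gaussPair_le ht hb0 (by linarith)
    have hM' : 8 / (t ^ 2 * (1 - b) ^ 4) ≤ 4 / 3 * σ ^ 2 := by
      have hb4 : (1 / 2 : ℝ) ^ 4 ≤ (1 - b) ^ 4 := by gcongr; linarith
      calc 8 / (t ^ 2 * (1 - b) ^ 4) ≤ 8 / (t ^ 2 * (1 / 2) ^ 4) := by gcongr
        _ ≤ _ := by
          rw [div_le_iff₀ (by positivity)]
          have : σ ^ 2 * t ^ 2 = (π ^ 2) ^ 2 := by rw [← mul_pow, hσs]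
          nlinarith
    obtain ⟨h400, hexp⟩ := sq_lt_exp_half hσ12
    have hE : exp (-3 * s) ≤ exp (-(3 / 2 * σ)) := exp_le_exp.mpr (by linarith)
    have hE2 : exp (-σ / 2) = exp (σ / 2) * exp (σ / 2) * exp (-(3 / 2 * σ)) := by
      rw [← exp_add, ← exp_add]; ring_nf
    simp only [hQabs]
    calc _ ≤ 4 / 3 * σ ^ 2 * (32 / 7 * exp (-(3 / 2 * σ)) * p1) := by
          refine mul_le_mul (hM.trans hM') ((tailP (by linarith)).trans ?_)
            (tsum_nonneg fun n => by positivity) (by positivity)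
          gcongr
      _ = p1 * (128 / 21 * σ ^ 2 * exp (-(3 / 2 * σ))) := by ring
      _ < p1 * (exp (-σ / 2) / 4) := by
          rw [hE2]
          have h1 : 400 * (1.53 * σ ^ 2) < exp (σ / 2) * exp (σ / 2) :=
            mul_lt_mul' h400 hexp (by positivity) (exp_pos _)
          have := mul_lt_mul_of_pos_right h1 (exp_pos (-(3 / 2 * σ)))
          have h0 : 0 ≤ σ ^ 2 * exp (-(3 / 2 * σ)) := by positivity
          gcongr
          linarith
  -- both factors are concentrated
  set ε := 32 / 7 * exp (-3 * s) with hε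
  set δ := 32 / 7 * exp (-2 * t) with hδ
  have hε0 : 0 < ε := by positivity
  have hδ0 : 0 < δ := by positivity
  have key : (1 + ε) * δ < 1 - ε := by
    have h1 := exp_neg_one_lt_d9
    have e6 : exp (-6) ≤ 0.0025 := by
      rw [show (-6 : ℝ) = (6 : ℕ) * -1 by norm_num, exp_nat_mul]
      calc exp (-1) ^ 6 ≤ 0.3679 ^ 6 := by gcongr; linarith
        _ ≤ _ := by norm_num
    have e4 : exp (-4) ≤ 0.0185 := by
      rw [show (-4 : ℝ) = (4 : ℕ) * -1 by norm_num, exp_nat_mul]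
      calc exp (-1) ^ 4 ≤ 0.3679 ^ 4 := by gcongr; linarith
        _ ≤ _ := by norm_num
    have e2 : exp (-2) ≤ 0.136 := by
      rw [show (-2 : ℝ) = (2 : ℕ) * -1 by norm_num, exp_nat_mul]
      calc exp (-1) ^ 2 ≤ 0.3679 ^ 2 := by gcongr; linarith
        _ ≤ _ := by norm_num
    have e16 : exp (-1.6) ≤ 0.203 := by
      refine le_of_pow_le_pow_left₀ (n := 5) (by norm_num) (by norm_num) ?_
      rw [← exp_nat_mul, show ((5 : ℕ) : ℝ) * -1.6 = (8 : ℕ) * -1 by norm_num, exp_nat_mul]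
      calc exp (-1) ^ 8 ≤ 0.3679 ^ 8 := by gcongr; linarith
        _ ≤ _ := by norm_num
    rcases le_total 2.2 t with ht2 | ht2
    · have a : exp (-3 * s) ≤ exp (-2) := exp_le_exp.mpr (by linarith)
      have b : exp (-2 * t) ≤ exp (-4) := exp_le_exp.mpr (by linarith)
      have hε1 : ε ≤ 0.63 := by linarith
      have hδ1 : δ ≤ 0.085 := by linarith
      nlinarith
    · have hs2 : 2 ≤ s := by nlinarith
      have a : exp (-3 * s) ≤ exp (-6) := exp_le_exp.mpr (by linarith)
      have b : exp (-2 * t) ≤ exp (-1.6) := exp_le_exp.mpr (by linarith)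
      have hε1 : ε ≤ 0.012 := by linarith
      have hδ1 : δ ≤ 0.93 := by linarith
      nlinarith
  rw [tsum_prod_sine hP hQ]
  have hlow := sine_series_lower hPn (v := x) hsin.le
  rw [hP1] at hlow
  refine bilinear_sine_series_pos (m := p1 - ε * p1) hx0 hx hPn hQn
    (by rw [hQ1]; exact hq1.le)
    (le_trans (mul_le_mul_of_nonneg_right (by linarith [tailP hs8]) hsin.le) hlow) ?_
  rw [hQ1]
  have hM : ∑' n : ℕ, (n : ℝ) ^ 2 * |altGauss s n + altGauss s (-n)| ≤ p1 + ε * p1 := by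
    rw [← hPn.sum_add_tsum_nat_add 2]
    have := tailP hs8
    simp only [Finset.sum_range_succ, Finset.sum_range_zero, Nat.cast_zero, Nat.cast_one]
    have h1 : |altGauss s 1 + altGauss s (-1)| = p1 := by simpa using abs_altGauss_pair s 1
    rw [h1]
    linarith
  calc _ ≤ (p1 + ε * p1) * (δ * q1) :=
        mul_le_mul hM (tailQ ht8) (tsum_nonneg fun n => by positivity) (by positivity)
    _ = p1 * q1 * ((1 + ε) * δ) := by ring
    _ < p1 * q1 * (1 - ε) := by gcongr
    _ = _ := by ring

/-- The common Fourier form of the two theta functions along the curve of special shifts. -/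
noncomputable def alternatingTheta (s t b x : ℝ) : ℝ :=
  ∑' k : ℤ × ℤ, exp (-s * (k.1 : ℝ) ^ 2) * exp (-t * (k.2 - b) ^ 2) *
    cos (2 * π * k.1 * (k.2 * x + 1 / 2))

lemma summable_gauss {t : ℝ} (ht : 0 < t) (b : ℝ) :
    Summable fun n : ℤ => exp (-t * (n - b) ^ 2) := by
  simpa using summable_pow_mul_gauss 0 ht b

lemma summable_gauss_prod_mul {s t : ℝ} (hs : 0 < s) (ht : 0 < t) (a b : ℝ) {c : ℤ × ℤ → ℝ}
    (hc : ∀ k, |c k| ≤ 1) :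
    Summable fun k : ℤ × ℤ => exp (-s * (k.1 - a) ^ 2) * exp (-t * (k.2 - b) ^ 2) * c k := by
  refine ((summable_gauss hs a).mul_of_nonneg (summable_gauss ht b)
    (fun _ => (exp_pos _).le) fun _ => (exp_pos _).le).of_norm_bounded fun k => ?_
  rw [norm_mul, norm_of_nonneg (by positivity)]
  exact mul_le_of_le_one_right (by positivity) (hc k)

lemma hasDerivAt_alternatingTheta {s t : ℝ} (hs : 0 < s) (ht : 0 < t) (b x : ℝ) :
    HasDerivAt (alternatingTheta s t b)
      (2 * π * ∑' k : ℤ × ℤ, k.1 * altGauss s k.1 * (k.2 * exp (-t * (k.2 - b) ^ 2)) *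
        sin (2 * π * k.1 * (k.2 * x))) x := by
  rw [← tsum_mul_left]
  have hA : Summable fun n : ℤ => n * altGauss s n :=
    summable_of_sq_mul_abs (summable_sq_mul_altGauss hs)
  have hB : Summable fun n : ℤ => n * exp (-t * (n - b) ^ 2) :=
    summable_of_sq_mul_abs (summable_sq_mul_gauss ht b)
  refine hasDerivAt_tsum (𝕜 := ℝ)
    (u := fun k : ℤ × ℤ => 2 * π * (‖k.1 * altGauss s k.1‖ * ‖k.2 * exp (-t * (k.2 - b) ^ 2)‖))
    ((hA.norm.mul_of_nonneg hB.norm (fun _ => norm_nonneg _) fun _ => norm_nonneg _).mul_left _)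
    (g := fun (k : ℤ × ℤ) z => exp (-s * (k.1 : ℝ) ^ 2) * exp (-t * (k.2 - b) ^ 2) *
      cos (2 * π * k.1 * (k.2 * z + 1 / 2)))
    (g' := fun (k : ℤ × ℤ) z => 2 * π * (k.1 * altGauss s k.1 *
      (k.2 * exp (-t * (k.2 - b) ^ 2)) * sin (2 * π * k.1 * (k.2 * z))))
    (fun k z => ?_) (fun k z => ?_) (y₀ := 0) ?_ x
  · have h := ((((hasDerivAt_id z).const_mul (k.2 : ℝ)).add_const (1 / 2 : ℝ)).const_mul
      (2 * π * k.1)).cos.const_mul (exp (-s * (k.1 : ℝ) ^ 2) * exp (-t * (k.2 - b) ^ 2))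
    refine h.congr_deriv ?_
    simp only [id]
    rw [show 2 * π * k.1 * (k.2 * z + 1 / 2) = 2 * π * k.1 * (k.2 * z) + k.1 * π by ring,
      sin_add, sin_int_mul_pi, altGauss]
    ring
  · rw [norm_mul, norm_of_nonneg two_pi_pos.le, ← norm_mul, norm_mul (_ * _ * _)]
    exact mul_le_mul_of_nonneg_left (mul_le_of_le_one_right (norm_nonneg _) (abs_sin_le_one _))
      two_pi_pos.le
  · simpa only [sub_zero] using summable_gauss_prod_mul hs ht 0 b fun k : ℤ × ℤ =>
      abs_cos_le_one (2 * π * k.1 * (k.2 * 0 + 1 / 2))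

lemma deriv_const_mul_alternatingTheta_pos {s t b x c : ℝ} (hs : 0 < s) (ht : 0 < t)
    (hst : π ^ 2 ≤ 2 * (s * t)) (hb0 : 0 ≤ b) (hb : b ≤ 1 / 2) (hx0 : 0 < x) (hx : x < 1 / 2)
    (hc : 0 < c) : 0 < deriv (fun z => c * alternatingTheta s t b z) x := by
  rw [((hasDerivAt_alternatingTheta hs ht b x).const_mul c).deriv]
  have := gauss_bilinear_pos hs ht hst hb0 hb hx0 hx
  positivity

/-- Poisson summation for a modulated Gaussian, solved for the spatial side. -/
lemma tsum_gauss_mul_cos_dual {r : ℝ} (hr : 0 < r) (b v : ℝ) :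
    ∑' n : ℤ, exp (-r * (v - n) ^ 2) * cos (2 * π * b * (v - n)) =
      (√(r / π))⁻¹ * ∑' n : ℤ, exp (-(π ^ 2 / r) * (n - b) ^ 2) * cos (2 * π * n * v) := by
  have h := tsum_gauss_mul_cos (t := π ^ 2 / r) (by positivity) b v
  have h1 : π / (π ^ 2 / r) = r / π := by field_simp
  have h2 : π ^ 2 / (π ^ 2 / r) = r := by field_simp
  rw [h1, h2] at h
  rw [h, inv_mul_cancel_left₀ (by positivity)]

lemma tsum_gauss_le {r : ℝ} (hr : 0 < r) (v : ℝ) :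
    ∑' n : ℤ, exp (-r * (v - n) ^ 2) ≤
      (√(r / π))⁻¹ * ∑' n : ℤ, exp (-(π ^ 2 / r) * (n - 0) ^ 2) := by
  have h := tsum_gauss_mul_cos_dual hr 0 v
  simp only [mul_zero, zero_mul, cos_zero, mul_one] at h
  rw [h]
  have hS := summable_gauss (t := π ^ 2 / r) (by positivity) 0
  gcongr with n
  · refine hS.of_norm_bounded fun n => ?_
    rw [norm_mul, norm_of_nonneg (exp_pos _).le]
    exact mul_le_of_le_one_right (exp_pos _).le (abs_cos_le_one _)
  · exact mul_le_of_le_one_right (exp_pos _).le (cos_le_one _)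

lemma summable_gauss_sub {r : ℝ} (hr : 0 < r) (v : ℝ) :
    Summable fun n : ℤ => exp (-r * (v - n) ^ 2) := by
  simpa only [sub_sq_comm] using summable_gauss hr v

lemma summable_prod_of_row_bound {E : ℤ × ℤ → ℝ} {w : ℤ → ℝ} {C : ℝ} (hE0 : ∀ k, 0 ≤ E k)
    (hw0 : ∀ l, 0 ≤ w l) (hw : Summable w) (hE : ∀ l, Summable fun k => E (k, l))
    (hC : ∀ l, ∑' k, E (k, l) ≤ C) : Summable fun k : ℤ × ℤ => E k * w k.2 := by
  suffices h : Summable fun k : ℤ × ℤ => E (k.2, k.1) * w k.1 from h.prod_symm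
  have hnonneg : 0 ≤ fun k : ℤ × ℤ => E (k.2, k.1) * w k.1 := fun k =>
    mul_nonneg (hE0 _) (hw0 _)
  rw [summable_prod_of_nonneg hnonneg]
  refine ⟨fun l => (hE l).mul_right (w l), ?_⟩
  simp only [tsum_mul_right]
  exact (hw.mul_left C).of_nonneg_of_le
    (fun l => mul_nonneg (tsum_nonneg fun n => hE0 _) (hw0 l))
    fun l => mul_le_mul_of_nonneg_right (hC l) (hw0 l)

/-- A Gaussian over a planar lattice, written with a row-dependent offset, is summable. -/
lemma summable_gauss_skew {r R : ℝ} (hr : 0 < r) (hR : 0 < R) (v : ℤ → ℝ) (b : ℝ) :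
    Summable fun k : ℤ × ℤ => exp (-r * (v k.2 - k.1) ^ 2) * exp (-R * (k.2 - b) ^ 2) :=
  summable_prod_of_row_bound (E := fun k => exp (-r * (v k.2 - k.1) ^ 2))
    (w := fun l => exp (-R * (l - b) ^ 2)) (fun _ => (exp_pos _).le) (fun _ => (exp_pos _).le)
    (summable_gauss hR b) (fun l => summable_gauss_sub hr (v l)) fun l => tsum_gauss_le hr (v l)

lemma tsum_prod_eq_of_rows {A B : ℤ × ℤ → ℝ} (hA : Summable A) (hB : Summable B) {c : ℝ}
    (h : ∀ l : ℤ, ∑' k : ℤ, A (k, l) = c * ∑' n : ℤ, B (n, l)) :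
    ∑' k, A k = c * ∑' k, B k := by
  have key : ∀ {F : ℤ × ℤ → ℝ}, Summable F → ∑' k, F k = ∑' l : ℤ, ∑' k : ℤ, F (k, l) := by
    intro F hF
    rw [← (Equiv.prodComm ℤ ℤ).tsum_eq]
    exact ((Equiv.prodComm ℤ ℤ).summable_iff.mpr hF).tsum_prod
  rw [key hA, key hB, ← tsum_mul_left]
  exact tsum_congr h

lemma bPoint_fst {y : ℝ} (hy : y ≠ 0) (x : ℝ) :
    (bPoint x y).1 = 1 / 2 - x * ((4 * y ^ 2 - 1) / (8 * y ^ 2)) := by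
  rw [bPoint]
  field_simp
  ring

lemma latticeTheta_bPoint {α y : ℝ} (hα : 0 < α) (hy : 0 < y) (x : ℝ) :
    latticeTheta x y (bPoint x y) α = (√(π * α / y / π))⁻¹ *
      alternatingTheta (π ^ 2 / (π * α / y)) (π * α * y) ((4 * y ^ 2 - 1) / (8 * y ^ 2)) x := by
  set b := (4 * y ^ 2 - 1) / (8 * y ^ 2) with hb
  set r := π * α / y with hr
  set R := π * α * y with hR
  have hr0 : 0 < r := by positivity
  have hR0 : 0 < R := by positivity
  have hrR : r * y ^ 2 = R := by rw [hr, hR]; field_simp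
  have hterm : latticeTheta x y (bPoint x y) α = ∑' k : ℤ × ℤ,
      exp (-r * (1 / 2 - x * k.2 - k.1) ^ 2) * exp (-R * (k.2 - b) ^ 2) := by
    rw [latticeTheta, ← (Equiv.neg (ℤ × ℤ)).tsum_eq]
    refine tsum_congr fun k => ?_
    rw [bPoint_fst hy.ne', ← hb, ← exp_add, ← hrR]
    simp only [Equiv.neg_apply, Prod.fst_neg, Prod.snd_neg, Int.cast_neg, bPoint, ← hb]
    congr 1
    ring
  rw [hterm, alternatingTheta]
  have hs : 0 < π ^ 2 / r := by positivity
  have hB := summable_gauss_prod_mul hs hR0 0 b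
    fun k : ℤ × ℤ => abs_cos_le_one (2 * π * k.1 * (k.2 * x + 1 / 2))
  simp only [sub_zero] at hB
  refine tsum_prod_eq_of_rows (summable_gauss_skew hr0 hR0 (fun l => 1 / 2 - x * l) b) hB
    fun l => ?_
  have h := tsum_gauss_mul_cos_dual hr0 0 (1 / 2 - x * l)
  simp only [mul_zero, zero_mul, cos_zero, mul_one, sub_zero] at h
  simp only
  rw [tsum_mul_right, h, mul_assoc, ← tsum_mul_right]
  congr 1
  refine tsum_congr fun n => ?_
  rw [show 2 * π * n * (1 / 2 - x * l) = n * π - 2 * π * n * (l * x) by ring,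
    show 2 * π * n * (l * x + 1 / 2) = n * π + 2 * π * n * (l * x) by ring,
    cos_sub, cos_add, sin_int_mul_pi]
  ring

lemma latticeThetaHat_bPoint {α y : ℝ} (hα : 0 < α) (hy : 0 < y) (x : ℝ) :
    latticeThetaHat x y (bPoint x y) α = (√(π * α / y / π))⁻¹ *
      alternatingTheta (π * α * y) (π ^ 2 / (π * α / y)) ((4 * y ^ 2 - 1) / (8 * y ^ 2)) x := by
  set b := (4 * y ^ 2 - 1) / (8 * y ^ 2) with hb
  set r := π * α / y with hr
  set R := π * α * y with hR
  have hr0 : 0 < r := by positivity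
  have hR0 : 0 < R := by positivity
  have hrR : r * y ^ 2 = R := by rw [hr, hR]; field_simp
  have hterm : latticeThetaHat x y (bPoint x y) α = ∑' k : ℤ × ℤ,
      exp (-r * (-(x * k.2) - k.1) ^ 2) * exp (-R * (k.2 - 0) ^ 2) *
        (cos (2 * π * b * (-(x * k.2) - k.1)) * cos (k.2 * π)) := by
    rw [latticeThetaHat]
    refine tsum_congr fun k => ?_
    rw [bPoint_fst hy.ne', ← hb, ← exp_add, ← hrR]
    simp only [bPoint, ← hb]
    congr 1
    · congr 1
      ring
    · rw [show 2 * π * (k.1 * b - k.2 * (1 / 2 - x * b)) =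
        -(2 * π * b * (-(x * k.2) - k.1)) - k.2 * π by ring, cos_sub, sin_int_mul_pi, cos_neg]
      ring
  have hswap : alternatingTheta R (π ^ 2 / r) b x = ∑' k : ℤ × ℤ,
      exp (-(π ^ 2 / r) * (k.1 - b) ^ 2) * exp (-R * (k.2 - 0) ^ 2) *
        (cos (2 * π * k.1 * -(x * k.2)) * cos (k.2 * π)) := by
    rw [alternatingTheta, ← (Equiv.prodComm ℤ ℤ).tsum_eq]
    refine tsum_congr fun k => ?_
    simp only [Equiv.prodComm_apply, Prod.fst_swap, Prod.snd_swap]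
    rw [show 2 * π * k.2 * (k.1 * x + 1 / 2) = -(2 * π * k.1 * -(x * k.2)) + k.2 * π by ring,
      cos_add, sin_int_mul_pi, cos_neg, sub_zero]
    ring
  have hcos : ∀ u v : ℝ, |cos u * cos v| ≤ 1 := fun u v => by
    rw [abs_mul]
    exact mul_le_one₀ (abs_cos_le_one _) (abs_nonneg _) (abs_cos_le_one _)
  rw [hterm, hswap]
  refine tsum_prod_eq_of_rows ?_
    (summable_gauss_prod_mul (by positivity) hR0 b 0 fun k => hcos _ _) fun l => ?_
  · refine (summable_gauss_skew hr0 hR0 (fun l => -(x * l)) 0).of_norm_bounded fun k => ?_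
    rw [norm_mul, norm_of_nonneg (by positivity)]
    exact mul_le_of_le_one_right (by positivity) (hcos _ _)
  have h := tsum_gauss_mul_cos_dual hr0 b (-(x * l))
  calc _ = (∑' n : ℤ, exp (-r * (-(x * l) - n) ^ 2) * cos (2 * π * b * (-(x * l) - n))) *
        (exp (-R * (l - 0) ^ 2) * cos (l * π)) := by
        rw [← tsum_mul_right]
        exact tsum_congr fun n => by ring
    _ = _ := by
        rw [h, mul_assoc, ← tsum_mul_right]
        congr 1
        exact tsum_congr fun n => by ring

end

/-- First Main Lemma: for every `α > 0`, `y ≥ 1/√2`, `x ∈ (0,1/2)`, the `x`-derivatives of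
`x ↦ θ_{x,y}(b(x,y);α)` and `x ↦ θ̂_{x,y}(b(x,y);α)` are strictly positive. -/
theorem first_main_lemma (α : ℝ) (hα : 0 < α) (y : ℝ) (hy : 1 / Real.sqrt 2 ≤ y)
    (x : ℝ) (hx : x ∈ Set.Ioo (0 : ℝ) (1 / 2)) :
    0 < deriv (fun t => latticeTheta t y (bPoint t y) α) x ∧
    0 < deriv (fun t => latticeThetaHat t y (bPoint t y) α) x := by
  have hy0 : 0 < y := lt_of_lt_of_le (by positivity) hy
  have hy2 : 1 / 2 ≤ y ^ 2 := by
    have h := pow_le_pow_left₀ (by positivity) hy 2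
    rwa [div_pow, one_pow, Real.sq_sqrt (by norm_num)] at h
  have hpi := Real.pi_pos
  have hb0 : 0 ≤ (4 * y ^ 2 - 1) / (8 * y ^ 2) := div_nonneg (by linarith) (by positivity)
  have hb : (4 * y ^ 2 - 1) / (8 * y ^ 2) ≤ 1 / 2 := by
    rw [div_le_iff₀ (by positivity)]
    linarith
  have hst : Real.pi ^ 2 / (Real.pi * α / y) * (Real.pi * α * y) = Real.pi ^ 2 * y ^ 2 := by
    field_simp
  have hle : Real.pi ^ 2 ≤ 2 * (Real.pi ^ 2 * y ^ 2) := by nlinarith [sq_nonneg Real.pi]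
  simp only [latticeTheta_bPoint hα hy0, latticeThetaHat_bPoint hα hy0]
  exact ⟨deriv_const_mul_alternatingTheta_pos (by positivity) (by positivity) (by rwa [hst])
      hb0 hb hx.1 hx.2 (by positivity),
    deriv_const_mul_alternatingTheta_pos (by positivity) (by positivity)
      (by rwa [mul_comm (Real.pi * α * y), hst]) hb0 hb hx.1 hx.2 (by positivity)⟩
end
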